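/- Let d ≥ 3 and δ ∈ (2/3, 1). Let 𝒯 be a set of tuples T = (T_p)_{p∈S} with T_∞ ∈ ℝ_{≥0} and T_p ∈ {p^z : z ∈ ℤ} for p ∈ S_f, and let {A_T}_{T∈𝒯} be a family of Borel subsets of ℚ_S^d of positive volume such that: (a) for each T ∈ 𝒯, A_T = ∏_{p∈S} (A_T)_p with (A_T)_p ⊆ ℚ_p^d Borel (resp. (A_T)_∞ ⊆ ℝ^d) and vol_p((A_T)_p) = T_p for each p ∈ S; (b) A_{T¹} ⊆ A_{T²} whenever T¹ ⪯ T² (meaning T¹_p ≤ T²_p for all p ∈ S); (c) 𝒯 is unbounded as a subset of (ℝ_{≥0})^{s+1} and, for each p ∈ S_f, inf_{T∈𝒯} T_p > 0. Then for every left Haar measure ν on G_d, for ν-almost every g ∈ G_d there exist C > 0 and T⁰ ∈ (ℝ_{≥0})^{s+1} such that for all T ∈ 𝒯 with T ⪰ T⁰: | #( g·P(ℤ_S^d) ∩ A_T ) − vol_S(A_T)/ζ_S(d) | ≤ C·vol_S(A_T)^δ. -/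

import Mathlib

open MeasureTheory Matrix ENNReal

noncomputable section

noncomputable instance Padic.instMeasurableSpace' {p : ℕ} [Fact p.Prime] :
    MeasurableSpace ℚ_[p] := borel _

instance Padic.instBorelSpace' {p : ℕ} [Fact p.Prime] : BorelSpace ℚ_[p] := ⟨rfl⟩

instance Matrix.SpecialLinearGroup.instTopologicalSpace'
    {n : Type*} [DecidableEq n] [Fintype n] {R : Type*} [CommRing R] [TopologicalSpace R] :
    TopologicalSpace (SpecialLinearGroup n R) :=
  show TopologicalSpace {A : Matrix n n R // A.det = 1} from inferInstance

noncomputable instance Matrix.SpecialLinearGroup.instMeasurableSpace'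
    {n : Type*} [DecidableEq n] [Fintype n] {R : Type*} [CommRing R] [TopologicalSpace R] :
    MeasurableSpace (SpecialLinearGroup n R) := borel _

/-- A finite set of distinct primes `p 0, …, p (s-1)`. -/
structure PrimeTup where
  s : ℕ
  p : Fin s → ℕ
  hp : ∀ i, (p i).Prime
  inj : Function.Injective p

namespace PrimeTup

instance (S : PrimeTup) (i : Fin S.s) : Fact (S.p i).Prime := ⟨S.hp i⟩

/-- The `p i`-adic field. -/
abbrev Qp (S : PrimeTup) (i : Fin S.s) : Type := ℚ_[S.p i]

/-- The space `ℚ_S^d = ℝ^d × ∏ᵢ ℚ_{pᵢ}^d`. -/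
abbrev QS (S : PrimeTup) (d : ℕ) : Type :=
  (Fin d → ℝ) × ((i : Fin S.s) → Fin d → S.Qp i)

/-- The ring `ℤ_S = ℤ[1/p₁, …, 1/p_s] ⊆ ℚ`. -/
def Zs (S : PrimeTup) : Subring ℚ :=
  Subring.closure (Set.range fun i : Fin S.s => ((S.p i : ℚ))⁻¹)

/-- The group `G_d = SL_d(ℝ) × ∏ᵢ SL_d(ℚ_{pᵢ})`. -/
abbrev G (S : PrimeTup) (d : ℕ) : Type :=
  SpecialLinearGroup (Fin d) ℝ × ((i : Fin S.s) → SpecialLinearGroup (Fin d) (S.Qp i))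

/-- Diagonal embedding of `SL_d(ℤ_S)` into `G_d`. -/
def toG (S : PrimeTup) (d : ℕ) : SpecialLinearGroup (Fin d) S.Zs →* S.G d :=
  MonoidHom.prod
    (SpecialLinearGroup.map ((Rat.castHom ℝ).comp S.Zs.subtype))
    (Pi.monoidHom fun i => SpecialLinearGroup.map ((Rat.castHom (S.Qp i)).comp S.Zs.subtype))

/-- The lattice `Γ_d`, the diagonally embedded copy of `SL_d(ℤ_S)` in `G_d`. -/
def Gamma (S : PrimeTup) (d : ℕ) : Subgroup (S.G d) := (S.toG d).range

/-- The componentwise linear action of `G_d` on `ℚ_S^d`. -/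
def act (S : PrimeTup) {d : ℕ} (g : S.G d) (x : S.QS d) : S.QS d :=
  ((g.1 : Matrix (Fin d) (Fin d) ℝ).mulVec x.1,
   fun i => ((g.2 i : Matrix (Fin d) (Fin d) (S.Qp i))).mulVec (x.2 i))

/-- Diagonal embedding of rational vectors into `ℚ_S^d`. -/
def diag (S : PrimeTup) {d : ℕ} (v : Fin d → ℚ) : S.QS d :=
  (fun j => (v j : ℝ), fun i j => (v j : S.Qp i))

/-- The first standard basis vector of `ℤ_S^d`. -/
def e1 (S : PrimeTup) (d : ℕ) : Fin d → S.Zs := fun j => if j.1 = 0 then 1 else 0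

/-- The set of `S`-primitive vectors `P(ℤ_S^d) = SL_d(ℤ_S)·e₁` inside `(ℤ_S)^d`. -/
def primZs (S : PrimeTup) (d : ℕ) : Set (Fin d → S.Zs) :=
  {w | ∃ γ : SpecialLinearGroup (Fin d) S.Zs,
    w = (γ : Matrix (Fin d) (Fin d) S.Zs).mulVec (S.e1 d)}

/-- The set of `S`-primitive vectors regarded inside `ℚ_S^d` via the diagonal embedding. -/
def prim (S : PrimeTup) (d : ℕ) : Set (S.QS d) :=
  (fun w : Fin d → S.Zs => S.diag fun j => ((w j : ℚ))) '' S.primZs d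

/-- Multiplication of a vector of `ℚ_S^d` by a (diagonally embedded) rational scalar. -/
def ratSMul (S : PrimeTup) {d : ℕ} (q : ℚ) (x : S.QS d) : S.QS d :=
  (fun j => (q : ℝ) * x.1 j, fun i j => (q : S.Qp i) * x.2 i j)

/-- `ℕ_S`: positive integers coprime to all the primes of `S`. -/
def NS (S : PrimeTup) : Set ℕ := {m | 0 < m ∧ ∀ i, ¬ (S.p i ∣ m)}

/-- The `S`-arithmetic zeta value `ζ_S(d)`. -/
def zetaS (S : PrimeTup) (d : ℕ) : ℝ := ∑' m : S.NS, (1 : ℝ) / ((m : ℕ) : ℝ) ^ d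

/-- The "unit box" `[0,1]^d × ∏ᵢ ℤ_{pᵢ}^d` used to normalize the volume on `ℚ_S^d`. -/
def unitBox (S : PrimeTup) (d : ℕ) : Set (S.QS d) :=
  {x | (∀ j, x.1 j ∈ Set.Icc (0:ℝ) 1) ∧ ∀ i j, ‖x.2 i j‖ ≤ 1}

/-- `v` is the measure `vol_S` on `ℚ_S^d`: the (unique) translation-invariant regular Borel
measure giving the unit box `[0,1]^d × ∏ᵢ ℤ_{pᵢ}^d` measure one; equivalently, the product of
Lebesgue measure on `ℝ^d` and the normalized Haar measures on the `ℚ_{pᵢ}^d`. -/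
def IsVolS (S : PrimeTup) (d : ℕ) (v : Measure (S.QS d)) : Prop :=
  v.IsAddHaarMeasure ∧ v.Regular ∧ v (S.unitBox d) = 1

/-- `μ` is an admissible measure on `G_d/Γ_d`: a regular Borel probability measure invariant
under the left `G_d`-action. -/
def Admissible (S : PrimeTup) (d : ℕ) (μ : Measure (S.G d ⧸ S.Gamma d)) : Prop :=
  IsProbabilityMeasure μ ∧ μ.Regular ∧ SMulInvariantMeasure (S.G d) (S.G d ⧸ S.Gamma d) μ

end PrimeTup

end

section Unfolding

/-- A positive measurable function on `H` whose sum over every right coset of `j(Γ)` equals one. -/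
structure IsCosetWeight {H Γ : Type*} [Group H] [Group Γ] [MeasurableSpace H] (j : Γ →* H)
    (φ : H → ℝ≥0∞) : Prop where
  meas : Measurable φ
  pos : ∀ g, φ g ≠ 0
  tsum_eq : ∀ g, ∑' γ, φ (g * j γ) = 1

variable {H Γ : Type*} [Group H] [Group Γ] [Countable Γ] [MeasurableSpace H] [MeasurableMul₂ H]
  [MeasurableInv H] {j : Γ →* H} {ν : Measure H} {φ : H → ℝ≥0∞}

theorem IsCosetWeight.le_one (hφ : IsCosetWeight j φ) (g : H) : φ g ≤ 1 := by
  rw [← hφ.tsum_eq g]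
  simpa using ENNReal.le_tsum (f := fun γ => φ (g * j γ)) 1

theorem IsCosetWeight.sigmaFinite [SigmaFinite ν] (hφ : IsCosetWeight j φ) :
    SigmaFinite (ν.withDensity φ) :=
  SigmaFinite.withDensity_of_ne_top
    (Filter.Eventually.of_forall fun g => ((hφ.le_one g).trans_lt one_lt_top).ne)

theorem IsCosetWeight.absolutelyContinuous (hφ : IsCosetWeight j φ) : ν ≪ ν.withDensity φ :=
  withDensity_absolutelyContinuous' hφ.meas.aemeasurable (Filter.Eventually.of_forall hφ.pos)

theorem IsCosetWeight.lintegral_unfold [ν.IsMulRightInvariant] (hφ : IsCosetWeight j φ)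
    {h ψ : H → ℝ≥0∞} (hh : Measurable h) (hinv : ∀ g γ, h (g * j γ) = h g) (hψ : Measurable ψ) :
    ∫⁻ g, h g * ∑' γ, ψ (g * j γ) ∂(ν.withDensity φ) = ∫⁻ g, h g * ψ g ∂ν := by
  have hm : Measurable fun g => h g * ∑' γ, ψ (g * j γ) :=
    hh.mul (Measurable.tsum fun γ => hψ.comp (measurable_mul_const _))
  rw [lintegral_withDensity_eq_lintegral_mul _ hφ.meas hm]
  have e1 : ∀ g, (φ * fun g => h g * ∑' γ, ψ (g * j γ)) g
      = ∑' γ, φ g * h g * ψ (g * j γ) := by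
    intro g
    rw [Pi.mul_apply, ENNReal.tsum_mul_left, mul_assoc]
  have e2 : ∀ g, ∑' γ : Γ, φ (g * (j γ)⁻¹) * h g * ψ g = h g * ψ g := by
    intro g
    rw [ENNReal.tsum_mul_right, ENNReal.tsum_mul_right, ← (Equiv.inv Γ).tsum_eq]
    simp [hφ.tsum_eq]
  simp_rw [e1]
  have a1 : ∀ γ : Γ, AEMeasurable (fun g => φ g * h g * ψ (g * j γ)) ν := fun γ =>
    ((hφ.meas.mul hh).mul (hψ.comp (measurable_mul_const (j γ)))).aemeasurable
  have a2 : ∀ γ : Γ, AEMeasurable (fun g => φ (g * (j γ)⁻¹) * h g * ψ g) ν := fun γ =>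
    (((hφ.meas.comp (measurable_mul_const (j γ)⁻¹)).mul hh).mul hψ).aemeasurable
  rw [lintegral_tsum a1]
  simp_rw [← e2]
  rw [lintegral_tsum a2]
  refine tsum_congr fun γ => ?_
  rw [← lintegral_mul_right_eq_self (fun g => φ (g * (j γ)⁻¹) * h g * ψ g) (j γ)]
  refine lintegral_congr fun g => ?_
  simp only [mul_inv_cancel_right, hinv]

theorem IsCosetWeight.lintegral_mul_left [ν.IsMulLeftInvariant] [ν.IsMulRightInvariant]
    (hφ : IsCosetWeight j φ) {h : H → ℝ≥0∞} (hh : Measurable h)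
    (hinv : ∀ g γ, h (g * j γ) = h g) (x : H) :
    ∫⁻ g, h (x * g) ∂(ν.withDensity φ) = ∫⁻ g, h g ∂(ν.withDensity φ) := by
  have hψ : Measurable fun g => φ (x⁻¹ * g) := hφ.meas.comp (measurable_const_mul _)
  have key := hφ.lintegral_unfold (ν := ν) hh hinv hψ
  have e : ∀ g, h g * ∑' γ, φ (x⁻¹ * (g * j γ)) = h g := by
    intro g
    simp_rw [← mul_assoc]
    rw [hφ.tsum_eq, mul_one]
  simp_rw [e] at key
  rw [key, lintegral_withDensity_eq_lintegral_mul _ hφ.meas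
      (show Measurable fun g => h (x * g) from hh.comp (measurable_const_mul x)),
    ← lintegral_mul_left_eq_self (fun g => h g * φ (x⁻¹ * g)) x]
  refine lintegral_congr fun g => ?_
  simp [mul_comm]

end Unfolding

section Uniqueness

variable {H Y : Type*} [Group H] [MeasurableSpace H] [MeasurableMul₂ H] [MeasurableInv H]
  [MeasurableSpace Y] [MulAction H Y] [MeasurableSMul₂ H Y]

theorem orbit_measure_mul_univ (ν : Measure H) [SFinite ν] [ν.IsMulRightInvariant] {m : Measure Y}
    [SFinite m] [SMulInvariantMeasure H Y m] {x₀ : Y} (hm : m (MulAction.orbit H x₀)ᶜ = 0)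
    {N : Set Y} (hN : MeasurableSet N) :
    ν {g | g • x₀ ∈ N} * m Set.univ = ν Set.univ * m N := by
  have hS : MeasurableSet {z : H × Y | z.1 • z.2 ∈ N} := measurable_smul hN
  have h1 : (ν.prod m) {z : H × Y | z.1 • z.2 ∈ N} = ν Set.univ * m N := by
    rw [Measure.prod_apply hS]
    have : ∀ g : H, m (Prod.mk g ⁻¹' {z : H × Y | z.1 • z.2 ∈ N}) = m N := fun g =>
      measure_preimage_smul m g N
    simp_rw [this, lintegral_const, mul_comm]
  have h2 : (ν.prod m) {z : H × Y | z.1 • z.2 ∈ N} = ν {g | g • x₀ ∈ N} * m Set.univ := by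
    rw [Measure.prod_apply_symm hS, ← lintegral_const]
    refine lintegral_congr_ae ?_
    have : ∀ᵐ x ∂m, x ∈ MulAction.orbit H x₀ := hm
    filter_upwards [this] with x hx
    obtain ⟨a, rfl⟩ := hx
    have : ((fun g : H => (g, a • x₀)) ⁻¹' {z : H × Y | z.1 • z.2 ∈ N})
        = (fun g => g * a) ⁻¹' {g | g • x₀ ∈ N} := by
      ext g; simp [mul_smul]
    rw [this, measure_preimage_mul_right]
  rw [← h1, h2]

theorem orbit_null_iff (ν : Measure H) [SFinite ν] [ν.IsMulRightInvariant] (hν : ν ≠ 0)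
    {m : Measure Y} [SFinite m] [SMulInvariantMeasure H Y m] {x₀ : Y}
    (hm : m (MulAction.orbit H x₀)ᶜ = 0) {N : Set Y} (hN : MeasurableSet N)
    (h0 : ν {g | g • x₀ ∈ N} = 0) : m N = 0 := by
  have := orbit_measure_mul_univ ν hm hN
  rw [h0, zero_mul, eq_comm, mul_eq_zero] at this
  exact this.resolve_left (by simpa using hν)

theorem orbit_measure_pos (ν : Measure H) [SFinite ν] [ν.IsMulRightInvariant]
    {m : Measure Y} [SFinite m] [SMulInvariantMeasure H Y m] (hm0 : m ≠ 0) {x₀ : Y}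
    (hm : m (MulAction.orbit H x₀)ᶜ = 0) {N : Set Y} (hN : MeasurableSet N)
    (h0 : ν {g | g • x₀ ∈ N} ≠ 0) : m N ≠ 0 := by
  intro h
  have := orbit_measure_mul_univ ν hm hN
  rw [h, mul_zero, mul_eq_zero] at this
  exact this.elim h0 (by simpa using hm0)

/-- Invariant measures concentrated on one orbit of a unimodular group are proportional. -/
theorem exists_eq_smul_of_orbit (ν : Measure H) [SFinite ν] [ν.IsMulRightInvariant] (hν : ν ≠ 0)
    {m lam : Measure Y} [SFinite m] [SigmaFinite lam] [SMulInvariantMeasure H Y m]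
    [SMulInvariantMeasure H Y lam] (hl0 : lam ≠ 0) {x₀ : Y}
    (hm : m (MulAction.orbit H x₀)ᶜ = 0) (hl : lam (MulAction.orbit H x₀)ᶜ = 0) :
    ∃ c : ℝ≥0∞, m = c • lam := by
  have hac : m ≪ lam := by
    refine Measure.AbsolutelyContinuous.mk fun N hN h => orbit_null_iff ν hν hm hN ?_
    by_contra h0
    exact orbit_measure_pos ν hl0 hl hN h0 h
  set f := m.rnDeriv lam with hf
  have hfm : Measurable f := Measure.measurable_rnDeriv _ _
  have hd : lam.withDensity f = m := Measure.withDensity_rnDeriv_eq _ _ hac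
  have hinv : ∀ g : H, ∀ᵐ x ∂lam, f (g • x) = f x := by
    intro g
    have hg : Measurable fun x => f (g • x) := hfm.comp (measurable_const_smul g)
    refine (withDensity_eq_iff_of_sigmaFinite hg.aemeasurable hfm.aemeasurable).1 ?_
    ext N hN
    rw [withDensity_apply _ hN, hd, ← measure_preimage_smul m g⁻¹ N, ← hd,
      withDensity_apply _ (measurable_const_smul g⁻¹ hN)]
    rw [← lintegral_indicator hN, ← lintegral_indicator (measurable_const_smul g⁻¹ hN)]
    rw [← (measurePreserving_smul g lam).lintegral_comp
      (hfm.indicator (measurable_const_smul g⁻¹ hN))]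
    refine lintegral_congr fun x => ?_
    by_cases hx : x ∈ N <;> simp [Set.indicator, hx]
  have hS : MeasurableSet {z : H × Y | f (z.1 • z.2) = f z.2} :=
    measurableSet_eq_fun (hfm.comp measurable_smul) (hfm.comp measurable_snd)
  have hae : ∀ᵐ x ∂lam, ∀ᵐ g ∂ν, f (g • x) = f x := by
    have := (Measure.ae_prod_iff_ae_ae (μ := ν) (ν := lam)
      (p := fun z : H × Y => f (z.1 • z.2) = f z.2) hS).2 (Filter.Eventually.of_forall hinv)
    exact (Measure.ae_ae_comm (p := fun (g : H) (x : Y) => f (g • x) = f x) hS).1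
      (Filter.Eventually.of_forall hinv)
  have hor : ∀ᵐ x ∂lam, x ∈ MulAction.orbit H x₀ := hl
  have : (ae lam).NeBot := ae_neBot.2 hl0
  obtain ⟨_, hx, ⟨a, rfl⟩⟩ := (hae.and hor).exists
  set c := f (a • x₀) with hc
  refine ⟨c, ?_⟩
  have hN : MeasurableSet {x | f x ≠ c} := (hfm (measurableSet_singleton c)).compl
  have hfc : f =ᵐ[lam] fun _ => c := by
    refine orbit_null_iff ν hν hl hN ?_
    have h1 : ν {g | ¬ f (g • a • x₀) = c} = 0 := hx
    have h2 : {g : H | ¬ f (g • a • x₀) = c} = (fun g => g * a) ⁻¹' {g | g • x₀ ∈ {x | f x ≠ c}} := by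
      ext g; simp [mul_smul]
    rwa [h2, measure_preimage_mul_right] at h1
  rw [← hd, withDensity_congr_ae hfc, withDensity_const]

end Uniqueness

section Siegel

variable {H Γ Y L : Type*} [Group H] [Group Γ] [Countable Γ] [MeasurableSpace H] [MeasurableMul₂ H]
  [MeasurableInv H] [MeasurableSpace Y] [MulAction H Y] [MeasurableSMul₂ H Y] [MulAction Γ L]
  [Countable L]

/-- The sum of `f` over the points `g • i z`, `z ∈ Q`. -/
noncomputable def orbitSum (i : L → Y) (Q : Set L) (f : Y → ℝ≥0∞) (g : H) : ℝ≥0∞ :=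
  ∑' z, Q.indicator (fun z => f (g • i z)) z

variable {i : L → Y} {Q : Set L} {f : Y → ℝ≥0∞}

theorem measurable_orbitSum (hf : Measurable f) : Measurable (orbitSum (H := H) i Q f) := by
  refine Measurable.tsum fun z => ?_
  by_cases hz : z ∈ Q
  · simp only [Set.indicator_of_mem hz]
    exact hf.comp (measurable_smul_const (i z))
  · simp [hz]

theorem orbitSum_mono {f' : Y → ℝ≥0∞} (h : ∀ y, f y ≤ f' y) (g : H) :
    orbitSum i Q f g ≤ orbitSum i Q f' g :=
  ENNReal.tsum_le_tsum fun _ => Set.indicator_le_indicator (h _)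

variable {j : Γ →* H} {ν : Measure H} {φ : H → ℝ≥0∞}

theorem orbitSum_mul_right (hi : ∀ γ z, i (γ • z) = j γ • i z) (hQ : ∀ (γ : Γ) z, γ • z ∈ Q ↔ z ∈ Q)
    (g : H) (γ : Γ) : orbitSum i Q f (g * j γ) = orbitSum i Q f g := by
  unfold orbitSum
  rw [← (MulAction.toPerm γ).tsum_eq (fun z => Q.indicator (fun z => f (g • i z)) z)]
  refine tsum_congr fun z => ?_
  by_cases hz : z ∈ Q <;> simp [hz, hQ, hi, mul_smul]

/-- The mean value of the counting function of a `Γ`-stable set is proportional to an invariant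
measure on the ambient orbit. -/
theorem IsCosetWeight.exists_siegel [SigmaFinite ν] [ν.IsMulLeftInvariant] [ν.IsMulRightInvariant]
    (hν : ν ≠ 0) (hφ : IsCosetWeight j φ) (hi : ∀ γ z, i (γ • z) = j γ • i z)
    (hQ : ∀ (γ : Γ) z, γ • z ∈ Q ↔ z ∈ Q) {lam : Measure Y} [SigmaFinite lam]
    [SMulInvariantMeasure H Y lam] (hl0 : lam ≠ 0) {x₀ : Y}
    (hO : MeasurableSet (MulAction.orbit H x₀))
    (hl : lam (MulAction.orbit H x₀)ᶜ = 0) (hQo : ∀ z ∈ Q, i z ∈ MulAction.orbit H x₀) :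
    ∃ c : ℝ≥0∞, ∀ f : Y → ℝ≥0∞, Measurable f →
      ∫⁻ g, orbitSum i Q f g ∂(ν.withDensity φ) = c * ∫⁻ y, f y ∂lam := by
  have := hφ.sigmaFinite (ν := ν)
  set μ := ν.withDensity φ
  let m : Measure Y := Measure.sum fun z : Q => μ.map fun g => g • i z
  have hm : ∀ f : Y → ℝ≥0∞, Measurable f → ∫⁻ y, f y ∂m = ∫⁻ g, orbitSum i Q f g ∂μ := by
    intro f hf
    simp only [m, lintegral_sum_measure]
    have e : ∀ g : H, orbitSum i Q f g = ∑' z : Q, f (g • i z) := fun g =>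
      (tsum_subtype Q fun z => f (g • i z)).symm
    simp_rw [e]
    rw [lintegral_tsum fun z : Q => show AEMeasurable (fun g : H => f (g • i z)) μ from
      (hf.comp (measurable_smul_const (i z.1))).aemeasurable]
    exact tsum_congr fun z => lintegral_map hf (measurable_smul_const _)
  have hms : ∀ N, MeasurableSet N → m N = ∫⁻ g, orbitSum i Q (N.indicator 1) g ∂μ := by
    intro N hN
    rw [← hm _ (measurable_one.indicator hN), lintegral_indicator_one hN]
  have : SMulInvariantMeasure H Y m := by
    refine ⟨fun x N hN => ?_⟩
    rw [hms _ hN, hms _ (measurable_const_smul x hN),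
      ← hφ.lintegral_mul_left (measurable_orbitSum (measurable_one.indicator hN))
        (orbitSum_mul_right hi hQ) x]
    refine lintegral_congr fun g => ?_
    refine tsum_congr fun z => ?_
    have e : g • i z ∈ (x • ·) ⁻¹' N ↔ (x * g) • i z ∈ N := by rw [mul_smul]; rfl
    by_cases hz : z ∈ Q
    · simp only [Set.indicator_of_mem hz]
      exact Set.indicator_eq_indicator e rfl
    · simp only [Set.indicator_of_notMem hz]
  have hmo : m (MulAction.orbit H x₀)ᶜ = 0 := by
    rw [hms _ hO.compl]
    have e : ∀ g : H, orbitSum i Q ((MulAction.orbit H x₀)ᶜ.indicator 1) g = 0 := by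
      intro g
      refine ENNReal.tsum_eq_zero.2 fun z => ?_
      by_cases hz : z ∈ Q
      · have : g • i z ∈ MulAction.orbit H x₀ := MulAction.mem_orbit_of_mem_orbit g (hQo z hz)
        simp [hz, this]
      · simp [hz]
    simp [e]
  obtain ⟨c, hc⟩ := exists_eq_smul_of_orbit ν hν hl0 hmo hl
  refine ⟨c, fun f hf => ?_⟩
  rw [← hm f hf, hc, lintegral_smul_measure, smul_eq_mul]

end Siegel

section Perfect

variable {ι F : Type*} [DecidableEq ι] [Fintype ι]

theorem Matrix.SpecialLinearGroup.ext_smul [CommRing F] {A B : SpecialLinearGroup ι F}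
    (h : ∀ v : ι → F, A • v = B • v) : A = B :=
  Subtype.ext (Matrix.ext_of_mulVec_single fun _ => h _)

theorem Matrix.SpecialLinearGroup.transvection_smul_apply [CommRing F] {i j : ι} (hij : i ≠ j)
    (b : F) (v : ι → F) (p : ι) :
    (SpecialLinearGroup.transvection hij b • v) p = v p + if p = i then b * v j else 0 := by
  rw [SpecialLinearGroup.smul_def, SpecialLinearGroup.transvection_coe, smul_eq_mulVec, add_mulVec,
    one_mulVec, Pi.add_apply, single_mulVec_eq]
  by_cases h : p = i
  · subst h; simp
  · simp [h]

theorem Matrix.SpecialLinearGroup.diag2n_decompose [Field F] {i j : ι} (hij : i ≠ j) (a : F)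
    (ha : a ≠ 0) :
    SpecialLinearGroup.diag2n hij a ha = SpecialLinearGroup.transvection hij a *
      SpecialLinearGroup.transvection hij.symm (- a⁻¹) * SpecialLinearGroup.transvection hij a *
      SpecialLinearGroup.transvection hij (-1) * SpecialLinearGroup.transvection hij.symm 1 *
      SpecialLinearGroup.transvection hij (-1) := by
  refine SpecialLinearGroup.ext_smul fun v => funext fun p => ?_
  have hD : (SpecialLinearGroup.diag2n hij a ha • v) p
      = (if p = i then a else if p = j then a⁻¹ else 1) * v p := by
    rw [SpecialLinearGroup.smul_def, SpecialLinearGroup.diag2n_coe, smul_eq_mulVec,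
      mulVec_diagonal]
  rw [hD]
  simp only [mul_smul, SpecialLinearGroup.transvection_smul_apply]
  by_cases h1 : p = i
  · subst h1
    simp only [hij, hij.symm, if_true, if_false]
    field_simp
    ring
  · by_cases h2 : p = j
    · subst h2
      simp only [hij, hij.symm, if_true, if_false]
      field_simp
      ring
    · simp [h1, h2]

theorem Matrix.SpecialLinearGroup.map_transvection_eq_one [CommRing F] {M : Type*} [CommMonoid M]
    (χ : SpecialLinearGroup ι F →* M) {i j k : ι} (hij : i ≠ j) (hik : i ≠ k) (hkj : k ≠ j)
    (b : F) : χ (SpecialLinearGroup.transvection hij b) = 1 := by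
  have key : SpecialLinearGroup.transvection hik b * SpecialLinearGroup.transvection hkj 1
      = SpecialLinearGroup.transvection hij b * (SpecialLinearGroup.transvection hkj 1 *
        SpecialLinearGroup.transvection hik b) := by
    refine SpecialLinearGroup.ext_smul fun v => funext fun p => ?_
    simp only [mul_smul, SpecialLinearGroup.transvection_smul_apply, hij.symm, hkj.symm,
      if_true, if_false]
    split_ifs <;> ring
  have h2 := congrArg χ key
  rw [map_mul, map_mul, map_mul, mul_comm (χ (SpecialLinearGroup.transvection hkj 1))] at h2
  have hu := ((Group.isUnit (SpecialLinearGroup.transvection hik b)).map χ).mul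
    ((Group.isUnit (SpecialLinearGroup.transvection hkj (1 : F))).map χ)
  exact (hu.mul_right_cancel ((one_mul _).trans h2)).symm

theorem Matrix.SpecialLinearGroup.map_eq_one_of_field {d : ℕ} (hd : 3 ≤ d) [Field F] {M : Type*}
    [CommMonoid M] (χ : SpecialLinearGroup (Fin d) F →* M) (g : SpecialLinearGroup (Fin d) F) :
    χ g = 1 := by
  have : Nontrivial (Fin d) := Fin.nontrivial_iff_two_le.2 (by omega)
  have ht : ∀ (i j : Fin d) (hij : i ≠ j) (b : F), χ (SpecialLinearGroup.transvection hij b) = 1 := by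
    intro i j hij b
    obtain ⟨k, hk⟩ : ∃ k : Fin d, k ∉ ({i, j} : Finset (Fin d)) := by
      by_contra! h
      have := Finset.card_le_card (fun k _ => h k : (Finset.univ : Finset (Fin d)) ⊆ {i, j})
      have h2 := Finset.card_le_two (a := i) (b := j)
      simp at this
      omega
    simp only [Finset.mem_insert, Finset.mem_singleton, not_or] at hk
    exact SpecialLinearGroup.map_transvection_eq_one χ hij (Ne.symm hk.1) hk.2 b
  refine SpecialLinearGroup.diagonal_transvection_induction' (fun g => χ g = 1) g ?_ ht ?_
  · intro i j hij c hc
    simp [SpecialLinearGroup.diag2n_decompose, ht]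
  · intro A B hA hB
    simp [hA, hB]

end Perfect

section Invariance

/-- On a group without nontrivial homomorphisms to `ℝ≥0`, left Haar measures are right
invariant. -/
theorem isMulRightInvariant_of_perfect {G : Type*} [Group G] [TopologicalSpace G]
    [IsTopologicalGroup G] [LocallyCompactSpace G] [MeasurableSpace G] [BorelSpace G]
    (ν : Measure G) [ν.IsHaarMeasure] [ν.InnerRegular]
    (hG : ∀ χ : G →* NNReal, χ = 1) : ν.IsMulRightInvariant := by
  refine ⟨fun g => ?_⟩
  have h := DFunLike.congr_fun (hG Measure.modularCharacter) g
  rw [Measure.map_right_mul_eq_modularCharacterFun_smul]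
  have h2 : Measure.modularCharacterFun g = 1 := h
  rw [h2, one_smul]

theorem smulInvariantMeasure_of_perfect {G A : Type*} [Group G] [AddCommGroup A]
    [DistribMulAction G A] [TopologicalSpace A] [IsTopologicalAddGroup A] [LocallyCompactSpace A]
    [ContinuousConstSMul G A] [MeasurableSpace A] [BorelSpace A] (μ : Measure A)
    [μ.IsAddHaarMeasure] [μ.Regular] (hG : ∀ χ : G →* NNReal, χ = 1) :
    SMulInvariantMeasure G A μ := by
  refine ⟨fun g s _ => ?_⟩
  rw [Set.preimage_smul, ← distribHaarChar_mul, hG (distribHaarChar A)]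
  simp

end Invariance

section Weight

open scoped Pointwise in
theorem exists_isCosetWeight {H Γ : Type*} [Group H] [TopologicalSpace H] [IsTopologicalGroup H]
    [T2Space H] [SigmaCompactSpace H] [MeasurableSpace H] [BorelSpace H] [Group Γ]
    [Countable Γ] (j : Γ →* H) (hj : ∀ K : Set H, IsCompact K → {γ | j γ ∈ K}.Finite) :
    ∃ φ, IsCosetWeight j φ := by
  classical
  let K := compactCovering H
  have hK : ∀ i, IsCompact (K i) := isCompact_compactCovering H
  have hfin : ∀ i, {γ | j γ ∈ (K i)⁻¹ * K i}.Finite := fun i => hj _ ((hK i).inv.mul (hK i))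
  let c : ℕ → ℝ≥0∞ := fun i => 2⁻¹ ^ i * ((hfin i).toFinset.card + 1 : ℝ≥0∞)⁻¹
  let ψ : H → ℝ≥0∞ := fun g => ∑' i, c i * (K i).indicator 1 g
  have hψm : Measurable ψ := Measurable.tsum fun i =>
    measurable_const.mul (measurable_one.indicator (hK i).isClosed.measurableSet)
  have hc0 : ∀ i, c i ≠ 0 := fun i => by simp [c]
  have hψ0 : ∀ g, ψ g ≠ 0 := by
    intro g
    obtain ⟨i, hi⟩ := Set.mem_iUnion.1 ((iUnion_compactCovering H).symm ▸ Set.mem_univ g)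
    intro h
    have := ENNReal.tsum_eq_zero.1 h i
    have hi' : g ∈ K i := hi
    simp [hi', hc0] at this
  let s : H → ℝ≥0∞ := fun g => ∑' γ, ψ (g * j γ)
  have hsm : Measurable s := Measurable.tsum fun γ => hψm.comp (measurable_mul_const _)
  have hcount : ∀ g i, ∑' γ, (K i).indicator (1 : H → ℝ≥0∞) (g * j γ)
      ≤ ((hfin i).toFinset.card : ℝ≥0∞) := by
    intro g i
    by_cases h : ∃ γ₀, g * j γ₀ ∈ K i
    · obtain ⟨γ₀, h0⟩ := h
      rw [← (Equiv.mulLeft γ₀).tsum_eq, tsum_eq_sum (s := (hfin i).toFinset)]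
      · refine (Finset.sum_le_card_nsmul _ _ 1 fun γ _ => ?_).trans (by simp)
        exact Set.indicator_le_self' (fun _ _ => zero_le_one) _
      · intro γ hγ
        refine Set.indicator_of_notMem (fun h => hγ ?_) _
        rw [Set.Finite.mem_toFinset]
        refine Set.mem_mul.2 ⟨_, Set.inv_mem_inv.2 h0, _, h, ?_⟩
        simp [mul_assoc]
    · push Not at h
      simp [h]
  have hs_top : ∀ g, s g ≠ ⊤ := by
    intro g
    have : s g ≤ ∑' i : ℕ, (2⁻¹ : ℝ≥0∞) ^ i := by
      simp only [s, ψ]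
      rw [ENNReal.tsum_comm]
      refine ENNReal.tsum_le_tsum fun i => ?_
      rw [ENNReal.tsum_mul_left]
      calc c i * ∑' γ, (K i).indicator (1 : H → ℝ≥0∞) (g * j γ)
          ≤ c i * ((hfin i).toFinset.card + 1 : ℝ≥0∞) :=
            mul_le_mul_right ((hcount g i).trans le_self_add) _
        _ = 2⁻¹ ^ i := by
            simp only [c]
            rw [mul_assoc, ENNReal.inv_mul_cancel (by simp) (by simp [ENNReal.add_eq_top]), mul_one]
    refine (this.trans_lt ?_).ne
    rw [ENNReal.tsum_geometric]
    simp
  have hs0 : ∀ g, s g ≠ 0 := fun g h => by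
    have := ENNReal.tsum_eq_zero.1 h 1
    exact hψ0 _ this
  have hsinv : ∀ g γ, s (g * j γ) = s g := by
    intro g γ
    simp only [s]
    rw [← (Equiv.mulLeft γ).tsum_eq fun γ' => ψ (g * j γ')]
    simp [mul_assoc]
  refine ⟨fun g => ψ g * (s g)⁻¹, hψm.mul hsm.inv, fun g => mul_ne_zero (hψ0 g)
    (ENNReal.inv_ne_zero.2 (hs_top g)), fun g => ?_⟩
  simp_rw [hsinv]
  rw [ENNReal.tsum_mul_right]
  exact ENNReal.mul_inv_cancel (hs0 g) (hs_top g)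

end Weight

section Columns

variable {ι A : Type*} [DecidableEq ι] [Fintype ι] [CommRing A]

theorem Matrix.det_updateCol_one (k : ι) (y : ι → A) :
    ((1 : Matrix ι ι A).updateCol k y).det = y k := by
  rw [← cramer_apply, cramer_one]
  rfl

theorem Matrix.updateCol_mulVec_single_self (M : Matrix ι ι A) (k : ι) (y : ι → A) :
    M.updateCol k y *ᵥ Pi.single k 1 = y := by
  ext i; simp

theorem Matrix.updateCol_mulVec_single_ne (M : Matrix ι ι A) {k i : ι} (h : i ≠ k) (y : ι → A) :
    M.updateCol k y *ᵥ Pi.single i 1 = M *ᵥ Pi.single i 1 := by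
  ext p; simp [updateCol_ne h]

/-- The unimodular matrix equal to the identity except for its `k`-th column `y`. -/
def Matrix.SpecialLinearGroup.colShear (k : ι) (y : ι → A) (hy : y k = 1) : SpecialLinearGroup ι A :=
  ⟨(1 : Matrix ι ι A).updateCol k y, by rw [det_updateCol_one, hy]⟩

namespace Matrix.SpecialLinearGroup

theorem colShear_smul_single_ne {k i : ι} (h : i ≠ k) (y : ι → A) (hy : y k = 1) :
    colShear k y hy • (Pi.single i 1 : ι → A) = Pi.single i 1 :=
  (updateCol_mulVec_single_ne _ h _).trans (one_mulVec _)

theorem colShear_smul (k : ι) (y : ι → A) (hy : y k = 1) (x : ι → A) :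
    colShear k y hy • x = x + x k • (y - Pi.single k 1) := by
  rw [SpecialLinearGroup.smul_def, smul_eq_mulVec]
  have : (colShear k y hy).1 = 1 + vecMulVec (y - Pi.single k 1) (Pi.single k 1) := by
    ext p q
    by_cases hq : q = k
    · subst hq
      by_cases hp : p = q
      · subst hp; simp [colShear, vecMulVec_apply]
      · simp [colShear, vecMulVec_apply, hp]
    · simp [colShear, vecMulVec_apply, hq]
  rw [this, add_mulVec, one_mulVec, vecMulVec_mulVec]
  ext p
  simp [mul_comm]

theorem exists_smul_single_eq_of_isUnit {k j : ι} (hkj : j ≠ k) {y : ι → A} (hy : IsUnit (y k)) :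
    ∃ γ : SpecialLinearGroup ι A, γ • (Pi.single k 1 : ι → A) = y ∧
      ∀ i, i ≠ k → i ≠ j → γ • (Pi.single i 1 : ι → A) = Pi.single i 1 := by
  obtain ⟨u, hu⟩ := hy
  let M : Matrix ι ι A := (1 : Matrix ι ι A).updateCol k y
  have hM : M.updateCol j (Pi.single j 1) = M := by
    ext p q
    by_cases hq : q = j
    · subst hq
      simp [M, updateCol_ne hkj, Pi.single_apply, one_apply]
    · rw [updateCol_ne hq]
  refine ⟨⟨M.updateCol j ((↑u⁻¹ : A) • Pi.single j 1), ?_⟩, ?_, fun i hik hij => ?_⟩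
  · rw [det_updateCol_smul, hM, det_updateCol_one, ← hu, Units.inv_mul]
  · exact (updateCol_mulVec_single_ne _ hkj.symm _).trans (updateCol_mulVec_single_self _ _ _)
  · exact (updateCol_mulVec_single_ne _ hij _).trans
      ((updateCol_mulVec_single_ne _ hik _).trans (one_mulVec _))

theorem map_smul_map {B : Type*} [CommRing B] (f : A →+* B) (γ : SpecialLinearGroup ι A)
    (v : ι → A) : SpecialLinearGroup.map f γ • (fun i => f (v i)) = fun i => f ((γ • v) i) := by
  ext i
  rw [SpecialLinearGroup.smul_def, SpecialLinearGroup.smul_def]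
  simp only [smul_eq_mulVec]
  exact (RingHom.map_mulVec f γ.1 v i).symm

end Matrix.SpecialLinearGroup

end Columns

namespace PrimeTup

variable (S : PrimeTup)

/-- The product of the primes in `S`. -/
def primeProd : ℕ := ∏ i, S.p i

theorem primeProd_pos : 0 < S.primeProd := Finset.prod_pos fun i _ => (S.hp i).pos

theorem inv_p_mem (i : Fin S.s) : ((S.p i : ℚ))⁻¹ ∈ S.Zs := Subring.subset_closure ⟨i, rfl⟩

variable {S}

theorem mem_Zs_iff {q : ℚ} : q ∈ S.Zs ↔ ∃ (k : ℕ) (a : ℤ), q * (S.primeProd : ℚ) ^ k = a := by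
  constructor
  · intro h
    induction h using Subring.closure_induction with
    | mem x hx =>
      obtain ⟨i, rfl⟩ := hx
      refine ⟨1, ((∏ l ∈ Finset.univ.erase i, S.p l : ℕ) : ℤ), ?_⟩
      have : S.primeProd = S.p i * ∏ l ∈ Finset.univ.erase i, S.p l :=
        (Finset.mul_prod_erase _ _ (Finset.mem_univ i)).symm
      have hp : (S.p i : ℚ) ≠ 0 := by exact_mod_cast (S.hp i).ne_zero
      rw [this, pow_one]
      push_cast
      field_simp
    | zero => exact ⟨0, 0, by simp⟩
    | one => exact ⟨0, 1, by simp⟩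
    | add x y _ _ hx hy =>
      obtain ⟨k, a, ha⟩ := hx
      obtain ⟨l, b, hb⟩ := hy
      refine ⟨k + l, a * (S.primeProd : ℤ) ^ l + b * (S.primeProd : ℤ) ^ k, ?_⟩
      push_cast
      rw [← ha, ← hb]; ring
    | neg x _ hx =>
      obtain ⟨k, a, ha⟩ := hx
      exact ⟨k, -a, by push_cast; rw [← ha]; ring⟩
    | mul x y _ _ hx hy =>
      obtain ⟨k, a, ha⟩ := hx
      obtain ⟨l, b, hb⟩ := hy
      exact ⟨k + l, a * b, by push_cast; rw [← ha, ← hb]; ring⟩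
  · rintro ⟨k, a, h⟩
    have hq : q = a * (∏ i, ((S.p i : ℚ))⁻¹) ^ k := by
      have hp : (S.primeProd : ℚ) ≠ 0 := by exact_mod_cast S.primeProd_pos.ne'
      rw [Finset.prod_inv_distrib, ← Nat.cast_prod, ← primeProd, ← h, inv_pow,
        mul_inv_cancel_right₀ (pow_ne_zero _ hp)]
    rw [hq]
    exact mul_mem (intCast_mem _ _) (pow_mem (prod_mem fun i _ => S.inv_p_mem i) _)

theorem eq_p_of_prime_dvd_den {q : ℚ} (hq : q ∈ S.Zs) {r : ℕ} (hr : r.Prime) (h : r ∣ q.den) :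
    ∃ i, S.p i = r := by
  obtain ⟨k, a, ha⟩ := mem_Zs_iff.1 hq
  have hd : (q.den : ℤ) ∣ (S.primeProd : ℤ) ^ k := by
    have h1 : q.num * (S.primeProd : ℤ) ^ k = a * q.den := by
      have : (q.num : ℚ) = q * q.den := (Rat.mul_den_eq_num q).symm
      have h2 : (q.num : ℚ) * (S.primeProd : ℚ) ^ k = a * q.den := by
        rw [this, ← ha]; ring
      exact_mod_cast h2
    have h3 : (q.den : ℤ) ∣ q.num * (S.primeProd : ℤ) ^ k := ⟨a, by rw [h1]; ring⟩
    refine IsCoprime.dvd_of_dvd_mul_left ?_ h3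
    rw [Int.isCoprime_iff_gcd_eq_one]
    simpa [Int.gcd] using q.reduced.symm
  have hd' : r ∣ S.primeProd ^ k := h.trans (by exact_mod_cast hd)
  obtain ⟨i, -, hi⟩ := (Prime.dvd_finsetProd_iff hr.prime _).1 (hr.dvd_of_dvd_pow hd')
  exact ⟨i, ((Nat.prime_dvd_prime_iff_eq hr (S.hp i)).1 hi).symm⟩

theorem exists_int_of_norm_le_one {q : ℚ} (hq : q ∈ S.Zs) (h : ∀ i, ‖(q : S.Qp i)‖ ≤ 1) :
    ∃ a : ℤ, q = a := by
  have hd : q.den = 1 := by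
    by_contra hne
    obtain ⟨r, hr, hrd⟩ := Nat.exists_prime_and_dvd hne
    obtain ⟨i, rfl⟩ := eq_p_of_prime_dvd_den hq hr hrd
    have h1 : ‖((q.den : ℕ) : S.Qp i)‖ < 1 := by
      have := (Padic.norm_intCast_lt_one_iff (p := S.p i) (k := (q.den : ℤ))).2
        (by exact_mod_cast hrd)
      simpa using this
    have h2 : ‖((q.num : ℤ) : S.Qp i)‖ = 1 := by
      refine le_antisymm (Padic.norm_int_le_one _) (not_lt.1 fun hlt => ?_)
      have h3 := (Padic.norm_intCast_lt_one_iff (p := S.p i)).1 hlt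
      have h4 : S.p i ∣ q.num.natAbs := Int.natCast_dvd.1 h3
      exact (S.hp i).one_lt.ne' (Nat.dvd_one.1 (q.reduced ▸ Nat.dvd_gcd h4 hrd))
    have h5 : ((q.num : ℤ) : S.Qp i) = (q : S.Qp i) * ((q.den : ℕ) : S.Qp i) := by
      have := congrArg (Rat.cast : ℚ → S.Qp i) (Rat.mul_den_eq_num q)
      push_cast at this
      exact this.symm
    rw [h5, norm_mul] at h2
    have := mul_lt_one_of_nonneg_of_lt_one_right (h i) (norm_nonneg _) h1
    exact this.ne h2
  exact ⟨q.num, (Rat.coe_int_num_of_den_eq_one hd).symm⟩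

theorem isUnit_p (i : Fin S.s) : IsUnit ((S.p i : ℕ) : S.Zs) := by
  refine IsUnit.of_mul_eq_one ⟨_, S.inv_p_mem i⟩ (Subtype.ext ?_)
  have hp : (S.p i : ℚ) ≠ 0 := by exact_mod_cast (S.hp i).ne_zero
  simp [hp]

theorem isUnit_primeProd : IsUnit (S.primeProd : S.Zs) := by
  rw [primeProd, Nat.cast_prod]
  exact (IsUnit.prod_univ_iff).2 isUnit_p

theorem exists_isUnit_mul_NS (m : ℕ) (hm : 0 < m) :
    ∃ u : S.Zs, IsUnit u ∧ ∃ n ∈ S.NS, n ≤ m ∧ (m : S.Zs) = u * n := by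
  induction m using Nat.strong_induction_on with
  | _ m ih =>
    by_cases h : m ∈ S.NS
    · exact ⟨1, isUnit_one, m, h, le_rfl, by simp⟩
    · obtain ⟨i, m', rfl⟩ : ∃ i, S.p i ∣ m := by
        by_contra hc
        exact h ⟨hm, fun i hi => hc ⟨i, hi⟩⟩
      have hm' : 0 < m' := Nat.pos_of_mul_pos_left hm
      have hlt : m' < S.p i * m' := by
        nlinarith [(S.hp i).two_le]
      obtain ⟨u, hu, n, hn, hnm, he⟩ := ih m' hlt hm'
      refine ⟨S.p i * u, (isUnit_p i).mul hu, n, hn, hnm.trans hlt.le, ?_⟩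
      rw [Nat.cast_mul, he]; ring

theorem exists_primeProd_pow_mul (q : S.Zs) :
    ∃ (k : ℕ) (a : ℤ), q * (S.primeProd : S.Zs) ^ k = a := by
  obtain ⟨k, a, h⟩ := mem_Zs_iff.1 q.2
  exact ⟨k, a, Subtype.ext (by simpa using h)⟩

theorem exists_isUnit_mul_NS_of_ne_zero {q : S.Zs} (hq : q ≠ 0) :
    ∃ u : S.Zs, IsUnit u ∧ ∃ n ∈ S.NS, q = u * n := by
  obtain ⟨k, a, h⟩ := exists_primeProd_pow_mul q
  have hP : IsUnit ((S.primeProd : S.Zs) ^ k) := isUnit_primeProd.pow k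
  have ha : a ≠ 0 := by
    rintro rfl
    rw [Int.cast_zero] at h
    exact hq (hP.mul_left_eq_zero.1 h)
  obtain ⟨u, hu, n, hn, -, he⟩ := exists_isUnit_mul_NS (S := S) a.natAbs (Int.natAbs_pos.2 ha)
  obtain ⟨w, hw⟩ := hP
  have key : ∃ e : S.Zs, IsUnit e ∧ (a : S.Zs) = e * (a.natAbs : S.Zs) := by
    rcases Int.natAbs_eq a with h' | h'
    · refine ⟨1, isUnit_one, ?_⟩
      rw [one_mul, ← Int.cast_natCast]
      exact congrArg _ h'
    · refine ⟨-1, isUnit_one.neg, ?_⟩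
      rw [neg_one_mul, ← Int.cast_natCast, ← Int.cast_neg]
      exact congrArg _ h'
  obtain ⟨e, he1, he2⟩ := key
  refine ⟨↑w⁻¹ * e * u, ((Units.isUnit _).mul he1).mul hu, n, hn, ?_⟩
  rw [mul_assoc, ← he, mul_assoc, ← he2, ← h, ← hw, mul_comm q, Units.inv_mul_cancel_left]

theorem NS_coprime_primeProd {n : ℕ} (hn : n ∈ S.NS) : n.Coprime S.primeProd :=
  Nat.Coprime.prod_right fun i _ => ((Nat.Prime.coprime_iff_not_dvd (S.hp i)).2 (hn.2 i)).symm

theorem exists_remainder {n : ℕ} (hn : n ∈ S.NS) (a : S.Zs) :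
    ∃ r < n, ∃ b : S.Zs, a = r + n * b := by
  obtain ⟨k, c, h⟩ := exists_primeProd_pow_mul a
  have hco : IsCoprime (n : ℤ) ((S.primeProd : ℤ) ^ k) := by
    have := (Nat.Coprime.pow_right k (NS_coprime_primeProd hn)).isCoprime
    exact_mod_cast this
  obtain ⟨x, y, hxy⟩ := hco
  obtain ⟨w, hw⟩ := isUnit_primeProd (S := S)
  have hn0 : (0 : ℤ) < n := by exact_mod_cast hn.1
  have hr0 := Int.emod_nonneg (c * y) hn0.ne'
  have hr1 := Int.emod_lt_of_pos (c * y) hn0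
  have hr := Int.emod_add_mul_ediv (c * y) n
  obtain ⟨r, hr'⟩ := Int.eq_ofNat_of_zero_le hr0
  generalize (c * y) / n = t at hr
  rw [hr'] at hr hr1
  refine ⟨r, by exact_mod_cast hr1, x * a + t, ?_⟩
  have h1 : (a : S.Zs) = n * (x * a) + y * c := by
    have := congrArg (Int.cast : ℤ → S.Zs) hxy
    push_cast at this
    rw [← h]
    linear_combination -a * this
  have h2 := congrArg (Int.cast : ℤ → S.Zs) hr
  push_cast at h2
  rw [mul_add]
  linear_combination h1 - h2

theorem NS_dvd_of_mul_eq {n n' : ℕ} (hn : n ∈ S.NS) {x : S.Zs} (h : (n : S.Zs) * x = n') :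
    n ∣ n' := by
  obtain ⟨k, c, hc⟩ := exists_primeProd_pow_mul x
  have h1 : (n : S.Zs) * c = n' * (S.primeProd : S.Zs) ^ k := by rw [← hc, ← h]; ring
  have h2 : (n : ℤ) * c = n' * (S.primeProd : ℤ) ^ k := by
    have := congrArg (Subtype.val) h1
    push_cast at this
    exact_mod_cast this
  have h3 : (n : ℤ) ∣ ((n' * S.primeProd ^ k : ℕ) : ℤ) := ⟨c, by rw [h2]; push_cast; rfl⟩
  exact (Nat.Coprime.pow_right k (NS_coprime_primeProd hn)).dvd_of_dvd_mul_right
    (Int.natCast_dvd_natCast.1 h3)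

end PrimeTup

namespace PrimeTup

variable (S : PrimeTup)

/-- The ring `ℚ_S = ℝ × ∏ᵢ ℚ_{pᵢ}`. -/
abbrev R : Type := ℝ × ((i : Fin S.s) → S.Qp i)

/-- The diagonal embedding of `ℤ_S` into `ℚ_S`. -/
noncomputable def emb : S.Zs →+* S.R :=
  RingHom.prod ((Rat.castHom ℝ).comp S.Zs.subtype)
    (RingHom.pi fun i => (Rat.castHom (S.Qp i)).comp S.Zs.subtype)

@[simp] theorem emb_fst (z : S.Zs) : (S.emb z).1 = ((z : ℚ) : ℝ) := rfl

@[simp] theorem emb_snd (z : S.Zs) (i : Fin S.s) : (S.emb z).2 i = ((z : ℚ) : S.Qp i) := rfl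

/-- The fundamental domain `[0, 1) × ∏ᵢ ℤ_{pᵢ}` of `ℤ_S` in `ℚ_S`. -/
def tile : Set S.R := {r | r.1 ∈ Set.Ico (0 : ℝ) 1 ∧ ∀ i, ‖r.2 i‖ ≤ 1}

variable {S}

theorem eq_zero_of_emb_small {z : S.Zs} (h1 : |(S.emb z).1| < 1) (h2 : ∀ i, ‖(S.emb z).2 i‖ ≤ 1) :
    z = 0 := by
  obtain ⟨a, ha⟩ := exists_int_of_norm_le_one z.2 h2
  rw [emb_fst, ha, Rat.cast_intCast, ← Int.cast_abs] at h1
  have : a = 0 := Int.abs_lt_one_iff.1 (by exact_mod_cast h1)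
  exact Subtype.ext (by rw [ha, this]; simp)

theorem exists_Zs_approx_single (i : Fin S.s) (y : S.Qp i) :
    ∃ z : S.Zs, ‖y - (z : ℚ)‖ ≤ 1 ∧ ∀ l ≠ i, ‖((z : ℚ) : S.Qp l)‖ ≤ 1 := by
  have hp0 : (S.p i : S.Qp i) ≠ 0 := by exact_mod_cast (S.hp i).ne_zero
  obtain ⟨k, hk⟩ : ∃ k : ℕ, ‖(S.p i : S.Qp i) ^ k * y‖ ≤ 1 := by
    obtain ⟨k, hk⟩ := pow_unbounded_of_one_lt ‖y‖
      (by exact_mod_cast (S.hp i).one_lt : (1 : ℝ) < S.p i)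
    refine ⟨k, ?_⟩
    rw [norm_mul, norm_pow, Padic.norm_p, inv_pow, inv_mul_le_one₀ (by
      have := (S.hp i).pos; positivity)]
    exact hk.le
  set w : ℤ_[S.p i] := ⟨_, hk⟩ with hw
  have h1 : ‖w - (w.appr k : ℤ_[S.p i])‖ ≤ (S.p i : ℝ) ^ (-k : ℤ) :=
    (PadicInt.norm_le_pow_iff_mem_span_pow _ _).2 (PadicInt.appr_spec k w)
  refine ⟨(w.appr k : S.Zs) * ⟨_, S.inv_p_mem i⟩ ^ k, ?_, fun l hl => ?_⟩
  · have h2 : ‖(S.p i : S.Qp i) ^ k * y - (w.appr k : S.Qp i)‖ ≤ (S.p i : ℝ) ^ (-k : ℤ) := by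
      rw [PadicInt.norm_def] at h1
      rwa [PadicInt.coe_sub, PadicInt.coe_natCast] at h1
    have h3 : (y - (((w.appr k : S.Zs) * ⟨_, S.inv_p_mem i⟩ ^ k : S.Zs) : ℚ) : S.Qp i) =
        ((S.p i : S.Qp i) ^ k)⁻¹ * ((S.p i : S.Qp i) ^ k * y - (w.appr k : S.Qp i)) := by
      push_cast
      rw [mul_sub, inv_mul_cancel_left₀ (pow_ne_zero _ hp0), inv_pow, mul_comm (w.appr k : S.Qp i)]
    rw [h3, norm_mul, norm_inv, norm_pow, Padic.norm_p, inv_pow, inv_inv]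
    have hpos : (0 : ℝ) < (S.p i : ℝ) ^ k := by have := (S.hp i).pos; positivity
    calc _ ≤ (S.p i : ℝ) ^ k * (S.p i : ℝ) ^ (-k : ℤ) := by gcongr
      _ = 1 := by rw [_root_.zpow_neg, zpow_natCast, mul_inv_cancel₀ hpos.ne']
  · push_cast
    have hl' : ‖((S.p i : ℕ) : S.Qp l)‖ = 1 :=
      Padic.norm_natCast_eq_one_iff.2 ((Nat.coprime_primes (S.hp l) (S.hp i)).2
        fun h => hl (S.inj h))
    rw [norm_mul, norm_pow, norm_inv, hl', inv_one, one_pow, mul_one]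
    exact_mod_cast Padic.norm_int_le_one (p := S.p l) (w.appr k : ℤ)

theorem exists_Zs_approx (y : (i : Fin S.s) → S.Qp i) : ∃ z : S.Zs, ∀ i, ‖y i - (z : ℚ)‖ ≤ 1 := by
  choose z hz hz' using fun i => exists_Zs_approx_single i (y i)
  refine ⟨∑ i, z i, fun i => ?_⟩
  have h1 : (y i - ((∑ l, z l : S.Zs) : ℚ) : S.Qp i) =
      (y i - (z i : ℚ)) + ∑ l ∈ Finset.univ.erase i, (-((z l : ℚ) : S.Qp i)) := by
    rw [← Finset.add_sum_erase _ _ (Finset.mem_univ i)]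
    push_cast
    rw [Finset.sum_neg_distrib]
    ring
  rw [h1]
  refine (Padic.nonarchimedean _ _).trans (max_le (hz i) ?_)
  refine IsUltrametricDist.norm_sum_le_of_forall_le_of_nonneg zero_le_one fun l hl => ?_
  rw [norm_neg]
  exact hz' l i (Finset.ne_of_mem_erase hl).symm

theorem norm_sub_le_one {i : Fin S.s} {x y : S.Qp i} (hx : ‖x‖ ≤ 1) (hy : ‖y‖ ≤ 1) : ‖x - y‖ ≤ 1 := by
  rw [sub_eq_add_neg]
  exact (Padic.nonarchimedean _ _).trans (max_le hx (by rwa [norm_neg]))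

theorem existsUnique_sub_mem_tile (r : S.R) : ∃! z : S.Zs, r - S.emb z ∈ S.tile := by
  obtain ⟨w, hw⟩ := exists_Zs_approx r.2
  refine ⟨w + (⌊r.1 - ((w : ℚ) : ℝ)⌋ : ℤ), ⟨?_, fun i => ?_⟩, fun z' hz' => ?_⟩
  · have := Int.fract_nonneg (r.1 - ((w : ℚ) : ℝ))
    have h' := Int.fract_lt_one (r.1 - ((w : ℚ) : ℝ))
    rw [Int.fract] at this h'
    constructor <;> simp <;> linarith
  · have : (r - S.emb (w + (⌊r.1 - ((w : ℚ) : ℝ)⌋ : ℤ))).2 i =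
        (r.2 i - (w : ℚ)) - ((⌊r.1 - ((w : ℚ) : ℝ)⌋ : ℤ) : S.Qp i) := by
      simp; ring
    rw [this]
    exact norm_sub_le_one (hw i) (Padic.norm_int_le_one _)
  · rw [← sub_eq_zero]
    have h2 := hz'.1
    simp only [Prod.fst_sub, emb_fst, Set.mem_Ico] at h2
    have e := Int.self_sub_floor (r.1 - ((w : ℚ) : ℝ))
    have hf := Int.fract_nonneg (r.1 - ((w : ℚ) : ℝ))
    have hf' := Int.fract_lt_one (r.1 - ((w : ℚ) : ℝ))
    rw [← e] at hf hf'
    refine eq_zero_of_emb_small ?_ fun i => ?_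
    · simp only [map_sub, map_add, Prod.fst_sub, Prod.fst_add, emb_fst, map_intCast, Prod.fst_intCast]
      rw [abs_lt]; constructor <;> linarith [h2.1, h2.2]
    · have h3 := hz'.2 i
      have h4 := norm_sub_le_one (hw i)
        (Padic.norm_int_le_one (p := S.p i) (⌊r.1 - ((w : ℚ) : ℝ)⌋ : ℤ))
      have h5 := norm_sub_le_one h4 h3
      convert h5 using 2
      simp
      ring

theorem finite_emb_mem {K : Set S.R} (hK : IsCompact K) : {z : S.Zs | S.emb z ∈ K}.Finite := by
  obtain ⟨t, -, ht, hc⟩ := hK.finite_cover_balls (e := 1 / 2) (by norm_num)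
  refine (ht.biUnion fun x _ => Set.Subsingleton.finite
    (s := {z : S.Zs | S.emb z ∈ Metric.ball x (1 / 2)}) ?_).subset fun z hz => ?_
  · intro z hz w hw
    have h : ‖S.emb z - S.emb w‖ < 1 := by
      rw [← dist_eq_norm]
      linarith [dist_triangle_right (S.emb z) (S.emb w) x, Metric.mem_ball.1 hz,
        Metric.mem_ball.1 hw]
    rw [← map_sub, Prod.norm_def, max_lt_iff] at h
    exact sub_eq_zero.1 (eq_zero_of_emb_small h.1 fun i => (norm_le_pi_norm _ i).trans h.2.le)
  · obtain ⟨x, hx, hzx⟩ := Set.mem_iUnion₂.1 (hc hz)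
    exact Set.mem_biUnion hx hzx

theorem eq_prod_inv_norm (m : ℕ) (hm : m ≠ 0) (h : ∀ r : ℕ, r.Prime → r ∣ m → ∃ i, S.p i = r) :
    (m : ℝ) = ∏ i, ‖(m : S.Qp i)‖⁻¹ := by
  induction m using Nat.recOnMul with
  | zero => exact absurd rfl hm
  | one => simp
  | prime r hr =>
    obtain ⟨i, rfl⟩ := h r hr dvd_rfl
    rw [Finset.prod_eq_single i, Padic.norm_p, inv_inv]
    · intro l _ hl
      rw [Padic.norm_natCast_eq_one_iff.2 ((Nat.coprime_primes (S.hp l) (S.hp i)).2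
        fun h => hl (S.inj h)), inv_one]
    · simp
  | mul a b iha ihb =>
    have ha := iha (left_ne_zero_of_mul hm) fun r hr hd => h r hr (hd.mul_right b)
    have hb := ihb (right_ne_zero_of_mul hm) fun r hr hd => h r hr (hd.mul_left a)
    simp only [Nat.cast_mul, norm_mul, mul_inv, Finset.prod_mul_distrib]
    rw [← ha, ← hb]

theorem inv_norm_den_le {i : Fin S.s} (q : ℚ) :
    ‖(q.den : S.Qp i)‖⁻¹ ≤ max 1 ‖(q : S.Qp i)‖ := by
  by_cases hd : S.p i ∣ q.den
  · have h2 : ‖((q.num : ℤ) : S.Qp i)‖ = 1 := by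
      refine le_antisymm (Padic.norm_int_le_one _) (not_lt.1 fun hlt => ?_)
      have h3 := (Padic.norm_intCast_lt_one_iff (p := S.p i)).1 hlt
      have h4 : S.p i ∣ q.num.natAbs := Int.natCast_dvd.1 h3
      exact (S.hp i).one_lt.ne' (Nat.dvd_one.1 (q.reduced ▸ Nat.dvd_gcd h4 hd))
    have h5 : (q : S.Qp i) = (q.num : S.Qp i) / (q.den : S.Qp i) := Rat.cast_def q
    rw [h5, norm_div, h2, one_div]
    exact le_max_right _ _
  · rw [Padic.norm_natCast_eq_one_iff.2 (((S.hp i).coprime_iff_not_dvd).2 hd), inv_one]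
    exact le_max_left _ _

theorem den_le {q : ℚ} (hq : q ∈ S.Zs) : (q.den : ℝ) ≤ ∏ i, max 1 ‖(q : S.Qp i)‖ := by
  rw [eq_prod_inv_norm q.den q.den_nz fun r hr hd => eq_p_of_prime_dvd_den hq hr hd]
  exact Finset.prod_le_prod (fun i _ => inv_nonneg.2 (norm_nonneg _)) fun i _ => inv_norm_den_le q

/-- The height of a rational number. -/
def height (q : ℚ) : ℕ := max q.num.natAbs q.den

theorem height_le {q : ℚ} (hq : q ∈ S.Zs) :
    (height q : ℝ) ≤ max 1 |(q : ℝ)| * ∏ i, max 1 ‖(q : S.Qp i)‖ := by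
  have hd : (0 : ℝ) < q.den := by exact_mod_cast q.den_pos
  have h1 : (height q : ℝ) = max 1 |(q : ℝ)| * q.den := by
    rw [max_mul_of_nonneg _ _ hd.le, one_mul, max_comm, height, Nat.cast_max]
    congr 1
    have : (q : ℝ) = q.num / q.den := Rat.cast_def q
    rw [this, abs_div, abs_of_pos hd, div_mul_cancel₀ _ hd.ne', Nat.cast_natAbs, Int.cast_abs]
  rw [h1]
  gcongr
  exact den_le hq

theorem summable_height : Summable fun q : ℚ => ((height q : ℝ) ^ 3)⁻¹ := by
  have h0 : Summable fun n : ℕ => ((n : ℝ) ^ (3 / 2 : ℝ))⁻¹ :=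
    Real.summable_nat_rpow_inv.2 (by norm_num)
  have h1 : Summable fun n : ℤ => ((n.natAbs : ℝ) ^ (3 / 2 : ℝ))⁻¹ :=
    Summable.of_nat_of_neg (by simpa using h0) (by simpa using h0)
  have h2 := h1.mul_of_nonneg h0 (fun n => by positivity) (fun n => by positivity)
  have hinj : Function.Injective fun q : ℚ => (q.num, q.den) := fun q r h =>
    Rat.ext (congrArg Prod.fst h) (congrArg Prod.snd h)
  refine Summable.of_norm_bounded_eventually (h2.comp_injective hinj) ?_
  filter_upwards [(Set.finite_singleton (0 : ℚ)).compl_mem_cofinite] with q hq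
  have hn : 0 < q.num.natAbs := Int.natAbs_pos.2 (Rat.num_ne_zero.2 hq)
  have hd := q.den_pos
  have hH : (0 : ℝ) < height q := by exact_mod_cast lt_max_of_lt_right hd
  rw [Real.norm_of_nonneg (by positivity)]
  change _ ≤ ((q.num.natAbs : ℝ) ^ (3 / 2 : ℝ))⁻¹ * ((q.den : ℝ) ^ (3 / 2 : ℝ))⁻¹
  rw [← mul_inv]
  have h3 : (height q : ℝ) ^ 3 = (height q : ℝ) ^ (3 / 2 : ℝ) * (height q : ℝ) ^ (3 / 2 : ℝ) := by
    rw [← Real.rpow_add hH, ← Real.rpow_natCast]; norm_num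
  rw [h3]
  have hl : (q.num.natAbs : ℝ) ≤ height q := by exact_mod_cast le_max_left _ _
  have hr : (q.den : ℝ) ≤ height q := by exact_mod_cast le_max_right _ _
  gcongr

end PrimeTup

namespace Matrix.SpecialLinearGroup

/-- The subgroup of `SL_d(A)` fixing the first `k` standard basis vectors. -/
def fixFirst (d : ℕ) (A : Type*) [CommRing A] (k : ℕ) : Subgroup (SpecialLinearGroup (Fin d) A) :=
  fixingSubgroup _ ((fun i : Fin d => (Pi.single i 1 : Fin d → A)) '' {i | i.1 < k})

variable {d : ℕ} {A : Type*} [CommRing A]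

theorem mem_fixFirst {k : ℕ} {γ : SpecialLinearGroup (Fin d) A} :
    γ ∈ fixFirst d A k ↔ ∀ i : Fin d, i.1 < k → γ • (Pi.single i 1 : Fin d → A) = Pi.single i 1 := by
  simp [fixFirst, mem_fixingSubgroup_iff]

theorem exists_shear {k : ℕ} {j : Fin d} (hj : k ≤ j.1) {v : Fin d → A} (hv : v j = 0) :
    ∃ γ ∈ fixFirst d A k, ∀ x : Fin d → A, γ • x = x + x j • v := by
  refine ⟨colShear j (Pi.single j 1 + v) (by simp [hv]), mem_fixFirst.2 fun i hi => ?_, fun x => ?_⟩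
  · exact colShear_smul_single_ne (by rintro rfl; omega) _ _
  · rw [colShear_smul, add_sub_cancel_left]

theorem exists_smul_apply_eq_single {k : ℕ} (hk : k + 2 ≤ d) {x : Fin d → A} {j : Fin d}
    (hkj : k ≤ j.1) {u n : A} (hu : IsUnit u) (hj : x j = u * n)
    (h0 : ∀ i : Fin d, k ≤ i.1 → i ≠ j → x i = 0) :
    ∃ γ ∈ fixFirst d A k, ∀ i : Fin d, k ≤ i.1 → (γ • x) i = if i.1 = k then n else 0 := by
  let k₀ : Fin d := ⟨k, by omega⟩
  have main : ∀ (x : Fin d → A) (j : Fin d) (c : A), k ≤ j.1 → j ≠ k₀ → x j = u * n →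
      x k₀ = c * (u * n) → (∀ i : Fin d, k ≤ i.1 → i ≠ j → i ≠ k₀ → x i = 0) →
      ∃ γ ∈ fixFirst d A k, ∀ i : Fin d, k ≤ i.1 → (γ • x) i = if i.1 = k then n else 0 := by
    intro x j c hkj hjk hxj hxk h0
    obtain ⟨w, rfl⟩ := hu
    obtain ⟨γ, hγ, h1⟩ := exists_shear (A := A) hkj (v := Pi.single k₀ (↑w⁻¹ - c)) (by simp [hjk])
    obtain ⟨γ', hγ', h2⟩ := exists_shear (A := A) (k := k) (j := k₀) le_rfl
      (v := Pi.single j (-(w : A))) (by simp [hjk.symm])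
    have hw : (w : A) * ↑w⁻¹ = 1 := w.mul_inv
    refine ⟨γ' * γ, mul_mem hγ' hγ, fun i hi => ?_⟩
    rw [mul_smul, h2, h1]
    simp only [Pi.add_apply, Pi.smul_apply, smul_eq_mul]
    by_cases hik : i = k₀
    · subst hik
      simp only [Pi.single_eq_same, Pi.single_eq_of_ne hjk.symm, k₀, if_true]
      rw [hxk, hxj]
      linear_combination n * hw
    · have hik' : i.1 ≠ k := fun h => hik (Fin.ext h)
      rw [if_neg hik', Pi.single_eq_of_ne hik]
      by_cases hij : i = j
      · subst hij
        simp only [Pi.single_eq_same]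
        rw [hxk, hxj]
        linear_combination -n * w * hw
      · rw [Pi.single_eq_of_ne hij, h0 i hi hij hik]
        ring
  by_cases hjk : j = k₀
  · rw [hjk] at hj h0
    let k₁ : Fin d := ⟨k + 1, by omega⟩
    have h10 : k₁ ≠ k₀ := by simp [k₁, k₀]
    obtain ⟨γ, hγ, h1⟩ := exists_shear (A := A) (k := k) (j := k₀) le_rfl
      (v := Pi.single k₁ 1) (by simp [h10.symm])
    obtain ⟨γ', hγ', h2⟩ := main (γ • x) k₁ 1 (by simp [k₁]) h10
      (by rw [h1]; simp [hj, h0 k₁ (by simp [k₁]) h10])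
      (by rw [h1]; simp [hj, h10.symm])
      (fun i hi hi1 hi0 => by rw [h1]; simp [hi1, h0 i hi hi0])
    exact ⟨γ' * γ, mul_mem hγ' hγ, fun i hi => by rw [mul_smul]; exact h2 i hi⟩
  · exact main x j 0 hkj hjk hj (by rw [h0 k₀ le_rfl (Ne.symm hjk)]; ring)
      fun i hi h1 _ => h0 i hi h1

end Matrix.SpecialLinearGroup

namespace PrimeTup

open Matrix.SpecialLinearGroup

variable {S : PrimeTup} {d : ℕ}

theorem exists_smul_tail_eq {k : ℕ} (hk : k + 2 ≤ d) (w : Fin d → S.Zs)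
    (hw : ∃ i : Fin d, k ≤ i.1 ∧ w i ≠ 0) :
    ∃ γ ∈ fixFirst d S.Zs k, ∃ n ∈ S.NS,
      ∀ i : Fin d, k ≤ i.1 → (γ • w) i = if i.1 = k then (n : S.Zs) else 0 := by
  classical
  let P : ℕ → Prop := fun n => n ∈ S.NS ∧ ∃ γ ∈ fixFirst d S.Zs k, ∃ j : Fin d, k ≤ j.1 ∧
    ∃ u, IsUnit u ∧ (γ • w) j = u * n
  have hP : ∃ n, P n := by
    obtain ⟨i, hi, hwi⟩ := hw
    obtain ⟨u, hu, n, hn, h⟩ := exists_isUnit_mul_NS_of_ne_zero hwi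
    exact ⟨n, hn, 1, one_mem _, i, hi, u, hu, by rw [one_smul, h]⟩
  obtain ⟨hn, γ, hγ, j, hkj, u, hu, hj⟩ := Nat.find_spec hP
  have hmin : ∀ m, P m → Nat.find hP ≤ m := fun m hm => Nat.find_min' hP hm
  generalize Nat.find hP = n at hn hj hmin
  obtain ⟨u, rfl⟩ := hu
  choose r hr b hb using fun i => exists_remainder hn (↑u⁻¹ * (γ • w) i)
  have hu' : (u : S.Zs) * ↑u⁻¹ = 1 := u.mul_inv
  obtain ⟨γ', hγ', h1⟩ := exists_shear (A := S.Zs) hkj (v := Function.update (-b) j 0) (by simp)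
  have hx : ∀ i, i ≠ j → (γ' • γ • w) i = u * r i := fun i hi => by
    rw [h1]
    simp only [Pi.add_apply, Pi.smul_apply, smul_eq_mul, Function.update_of_ne hi, Pi.neg_apply, hj]
    linear_combination u * hb i - (γ • w) i * hu'
  have hr0 : ∀ i : Fin d, k ≤ i.1 → i ≠ j → r i = 0 := fun i hi hij => by
    by_contra hne
    obtain ⟨u', hu', n', hn', hle, he⟩ := exists_isUnit_mul_NS (S := S) (r i) (Nat.pos_of_ne_zero hne)
    refine absurd (hmin n' ⟨hn', γ' * γ, mul_mem hγ' hγ, i, hi, u * u', u.isUnit.mul hu', ?_⟩)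
      (not_le.2 (hle.trans_lt (hr i)))
    rw [mul_smul, hx i hij, he, mul_assoc]
  obtain ⟨γ'', hγ'', h2⟩ := exists_smul_apply_eq_single hk (x := γ' • γ • w) hkj u.isUnit (n := n)
    (by rw [h1]; simp [hj]) fun i hi hij => by rw [hx i hij, hr0 i hi hij]; simp
  exact ⟨γ'' * (γ' * γ), mul_mem hγ'' (mul_mem hγ' hγ), n, hn, fun i hi => by
    rw [mul_smul, mul_smul]; exact h2 i hi⟩

end PrimeTup

noncomputable instance Padic.instMeasureSpace' {p : ℕ} [Fact p.Prime] : MeasureSpace ℚ_[p] where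
  toMeasurableSpace := Padic.instMeasurableSpace'
  volume := Measure.addHaarMeasure ⟨⟨Metric.closedBall 0 1, isCompact_closedBall 0 1⟩, by
    rw [interior_eq_iff_isOpen.2 (IsUltrametricDist.isOpen_closedBall 0 one_ne_zero)]
    exact ⟨0, by simp⟩⟩

instance Padic.isAddHaarMeasure_volume {p : ℕ} [Fact p.Prime] :
    (volume : Measure ℚ_[p]).IsAddHaarMeasure :=
  Measure.isAddHaarMeasure_addHaarMeasure _

theorem Padic.volume_unitBall {p : ℕ} [Fact p.Prime] : volume {x : ℚ_[p] | ‖x‖ ≤ 1} = 1 := by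
  have : {x : ℚ_[p] | ‖x‖ ≤ 1} = Metric.closedBall 0 1 := by ext; simp
  rw [this]
  exact Measure.addHaarMeasure_self

namespace Matrix.SpecialLinearGroup

variable {n : Type*} [DecidableEq n] [Fintype n] {A : Type*} [CommRing A] [TopologicalSpace A]

instance instBorelSpace' : BorelSpace (SpecialLinearGroup n A) := ⟨rfl⟩

theorem isEmbedding_coe : Topology.IsEmbedding ((↑) : SpecialLinearGroup n A → Matrix n n A) :=
  Topology.IsEmbedding.subtypeVal

instance instSecondCountableTopology' [SecondCountableTopology A] :
    SecondCountableTopology (SpecialLinearGroup n A) :=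
  have : SecondCountableTopology (Matrix n n A) :=
    inferInstanceAs (SecondCountableTopology (n → n → A))
  isEmbedding_coe.secondCountableTopology

instance instT2Space' [T2Space A] : T2Space (SpecialLinearGroup n A) :=
  isEmbedding_coe.t2Space

variable [IsTopologicalRing A]

instance instIsTopologicalGroup' : IsTopologicalGroup (SpecialLinearGroup n A) :=
  topologicalGroup

theorem isClosedEmbedding_coe [T1Space A] :
    Topology.IsClosedEmbedding ((↑) : SpecialLinearGroup n A → Matrix n n A) :=
  isClosedEmbedding_val

instance instLocallyCompactSpace' [T2Space A] [LocallyCompactSpace A] :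
    LocallyCompactSpace (SpecialLinearGroup n A) :=
  have : LocallyCompactSpace (Matrix n n A) := inferInstanceAs (LocallyCompactSpace (n → n → A))
  isClosedEmbedding_coe.locallyCompactSpace

instance instContinuousSMul' : ContinuousSMul (SpecialLinearGroup n A) (n → A) where
  continuous_smul := by
    have h : Continuous fun q : SpecialLinearGroup n A × (n → A) => (q.1 : Matrix n n A) :=
      isEmbedding_coe.continuous.comp continuous_fst
    exact h.matrix_mulVec continuous_snd

end Matrix.SpecialLinearGroup

namespace PrimeTup

variable (S : PrimeTup) (d k : ℕ)

instance instIsAddHaarMeasureR : (volume : Measure S.R).IsAddHaarMeasure :=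
  Measure.prod.instIsAddHaarMeasure _ _

/-- The `ℚ_S`-module `ℚ_S^d`. -/
abbrev V : Type := Fin d → S.R

/-- The group `SL_d(ℚ_S)`. -/
abbrev H : Type := SpecialLinearGroup (Fin d) S.R

instance instIsAddHaarMeasureV : (volume : Measure (S.V d)).IsAddHaarMeasure :=
  Measure.pi.isAddHaarMeasure _

instance instIsAddHaarMeasureY : (volume : Measure (Fin k → S.V d)).IsAddHaarMeasure :=
  Measure.pi.isAddHaarMeasure _

instance instMeasurableSMul₂V : MeasurableSMul₂ (S.H d) (S.V d) :=
  ⟨continuous_smul.measurable⟩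

instance instMeasurableSMul₂Y : MeasurableSMul₂ (S.H d) (Fin k → S.V d) :=
  ⟨continuous_smul.measurable⟩

variable {d}

theorem G_monoidHom_eq_one (hd : 3 ≤ d) {M : Type*} [CommMonoid M] (χ : S.G d →* M) : χ = 1 := by
  ext g
  have h1 : g = (g.1, 1) * (1, g.2) := by simp
  have h2 : χ (g.1, 1) = 1 :=
    SpecialLinearGroup.map_eq_one_of_field hd (χ.comp (MonoidHom.inl _ _)) g.1
  have h3 : χ.comp (MonoidHom.inr _ _) = 1 := by
    refine MonoidHom.pi_ext fun i x => ?_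
    exact SpecialLinearGroup.map_eq_one_of_field hd
      ((χ.comp (MonoidHom.inr _ _)).comp (MonoidHom.mulSingle (fun i => SpecialLinearGroup (Fin d) (S.Qp i)) i)) x
  have h4 : χ (1, g.2) = 1 := DFunLike.congr_fun h3 g.2
  rw [h1, map_mul, h2, h4, one_mul]
  rfl

variable (d)

/-- `SL_d(ℚ_S)` is the product of the groups `SL_d(ℚ_p)`. -/
noncomputable def equivG : S.H d ≃ₜ* S.G d where
  toFun h := (SpecialLinearGroup.map (RingHom.fst _ _) h,
    fun i => SpecialLinearGroup.map ((Pi.evalRingHom _ i).comp (RingHom.snd _ _)) h)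
  invFun g := ⟨Matrix.of fun a b => (g.1 a b, fun i => g.2 i a b), by
    refine Prod.ext ?_ (funext fun i => ?_)
    · exact (RingHom.map_det (RingHom.fst ℝ ((i : Fin S.s) → S.Qp i)) _).trans g.1.2
    · exact (RingHom.map_det
        ((Pi.evalRingHom S.Qp i).comp (RingHom.snd ℝ ((i : Fin S.s) → S.Qp i))) _).trans (g.2 i).2⟩
  left_inv h := by ext <;> rfl
  right_inv g := by
    refine Prod.ext ?_ (funext fun i => ?_) <;> ext <;> rfl
  map_mul' g h := by
    refine Prod.ext ?_ (funext fun i => ?_)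
    · exact map_mul _ _ _
    · exact map_mul _ _ _
  continuous_toFun := by
    refine Continuous.prodMk ?_ (continuous_pi fun i => ?_)
    · exact continuous_fst.specialLinearGroup_map
    · exact Continuous.specialLinearGroup_map ((continuous_apply i).comp continuous_snd)
  continuous_invFun := by
    refine continuous_induced_rng.2 (continuous_matrix fun a b => ?_)
    refine Continuous.prodMk ?_ (continuous_pi fun i => ?_)
    · exact (SpecialLinearGroup.isEmbedding_coe.continuous.comp continuous_fst).matrix_elem a b
    · exact (SpecialLinearGroup.isEmbedding_coe.continuous.comp
        ((continuous_apply i).comp continuous_snd)).matrix_elem a b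

variable {d}

theorem H_monoidHom_eq_one (hd : 3 ≤ d) {M : Type*} [CommMonoid M] (χ : S.H d →* M) : χ = 1 := by
  have h := S.G_monoidHom_eq_one hd (χ.comp (S.equivG d).symm.toMonoidHom)
  ext g
  have := DFunLike.congr_fun h (S.equivG d g)
  exact (congrArg χ ((S.equivG d).symm_apply_apply g)).symm.trans this

theorem isMulRightInvariant_H (hd : 3 ≤ d) (ν : Measure (S.H d)) [ν.IsHaarMeasure] :
    ν.IsMulRightInvariant :=
  have := TopologicalSpace.metrizableSpace_of_t3_secondCountable (S.H d)
  isMulRightInvariant_of_perfect ν (S.H_monoidHom_eq_one hd)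

theorem smulInvariantMeasure_V (hd : 3 ≤ d) :
    SMulInvariantMeasure (S.H d) (S.V d) volume :=
  have : (volume : Measure (S.V d)).Regular :=
    Measure.Regular.of_sigmaCompactSpace_of_isLocallyFiniteMeasure _
  smulInvariantMeasure_of_perfect _ (S.H_monoidHom_eq_one hd)

theorem smulInvariantMeasure_Y (hd : 3 ≤ d) :
    SMulInvariantMeasure (S.H d) (Fin k → S.V d) volume :=
  have : (volume : Measure (Fin k → S.V d)).Regular :=
    Measure.Regular.of_sigmaCompactSpace_of_isLocallyFiniteMeasure _
  smulInvariantMeasure_of_perfect _ (S.H_monoidHom_eq_one hd)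

end PrimeTup

theorem measurableSet_orbit_of_sigmaCompact {H Y : Type*} [Group H] [TopologicalSpace H]
    [SigmaCompactSpace H] [TopologicalSpace Y] [T2Space Y] [MeasurableSpace Y] [BorelSpace Y]
    [MulAction H Y] [ContinuousSMul H Y] (y : Y) : MeasurableSet (MulAction.orbit H y) := by
  have : MulAction.orbit H y = ⋃ n, (fun g : H => g • y) '' compactCovering H n := by
    rw [← Set.image_iUnion, iUnion_compactCovering, Set.image_univ]
    rfl
  rw [this]
  exact MeasurableSet.iUnion fun n => ((isCompact_compactCovering H n).image
    (continuous_id.smul continuous_const)).measurableSet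

namespace PrimeTup

open Matrix.SpecialLinearGroup

variable {S : PrimeTup} {d : ℕ}

instance instSigmaFiniteR : SigmaFinite (volume : Measure S.R) := by
  rw [Measure.volume_eq_prod]
  have : SigmaFinite (volume : Measure ((i : Fin S.s) → S.Qp i)) := Measure.pi.sigmaFinite _
  infer_instance

instance instSigmaFiniteV : SigmaFinite (volume : Measure (S.V d)) := Measure.pi.sigmaFinite _

instance instSigmaFiniteY {k : ℕ} : SigmaFinite (volume : Measure (Fin k → S.V d)) :=
  Measure.pi.sigmaFinite _

/-- The embedding of `SL_d(ℤ_S)` in `SL_d(ℚ_S)`. -/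
noncomputable abbrev toH (S : PrimeTup) (d : ℕ) : SpecialLinearGroup (Fin d) S.Zs →* S.H d :=
  SpecialLinearGroup.map S.emb

/-- The embedding of tuples of `S`-integral vectors in tuples of vectors over `ℚ_S`. -/
noncomputable def embV (S : PrimeTup) (d k : ℕ) (z : Fin k → Fin d → S.Zs) : Fin k → S.V d :=
  fun a b => S.emb (z a b)

/-- The first `k` standard basis vectors. -/
noncomputable def stdFrame (A : Type*) [CommRing A] {d k : ℕ} (hk : k ≤ d) : Fin k → Fin d → A :=
  fun a => Pi.single (Fin.castLE hk a) 1

theorem toH_smul_embV {k : ℕ} (γ : SpecialLinearGroup (Fin d) S.Zs) (z : Fin k → Fin d → S.Zs) :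
    S.embV d k (γ • z) = S.toH d γ • S.embV d k z := by
  funext a
  exact (map_smul_map S.emb γ (z a)).symm

theorem embV_stdFrame {k : ℕ} (hk : k ≤ d) :
    S.embV d k (stdFrame S.Zs hk) = stdFrame S.R hk := by
  funext a b
  simp only [embV, stdFrame, Pi.single_apply]
  split_ifs <;> simp

theorem finite_toH_mem {K : Set (S.H d)} (hK : IsCompact K) : {γ | S.toH d γ ∈ K}.Finite := by
  have hf : ∀ a b : Fin d, {z : S.Zs | S.emb z ∈ (fun h : S.H d => h.1 a b) '' K}.Finite := fun a b =>
    finite_emb_mem (hK.image (isEmbedding_coe.continuous.matrix_elem a b))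
  have hpi := Set.Finite.pi' fun a => Set.Finite.pi' fun b => hf a b
  refine Set.Finite.of_finite_image (f := fun γ => (γ.1 : Fin d → Fin d → S.Zs))
    (hpi.subset ?_) fun γ _ γ' _ h => Subtype.ext h
  rintro _ ⟨γ, hγ, rfl⟩ a b
  exact ⟨_, hγ, rfl⟩

theorem measurableSet_orbit {k : ℕ} (y : Fin k → S.V d) : MeasurableSet (MulAction.orbit (S.H d) y) :=
  measurableSet_orbit_of_sigmaCompact y

theorem volume_not_isUnit : volume {r : S.R | ¬ IsUnit r} = 0 := by
  have h : {r : S.R | ¬ IsUnit r} ⊆ Prod.fst ⁻¹' {0} ∪ ⋃ i, Prod.snd ⁻¹' (Function.eval i ⁻¹' {0}) := by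
    intro r hr
    by_contra hc
    simp only [Set.mem_union, Set.mem_preimage, Set.mem_singleton_iff, Set.mem_iUnion, not_or,
      not_exists] at hc
    exact hr (Prod.isUnit_iff.2 ⟨isUnit_iff_ne_zero.2 hc.1,
      Pi.isUnit_iff.2 fun i => isUnit_iff_ne_zero.2 (hc.2 i)⟩)
  refine measure_mono_null h (measure_union_null ?_ (measure_iUnion_null fun i => ?_))
  · exact Measure.quasiMeasurePreserving_fst.preimage_null (by simp)
  · exact Measure.quasiMeasurePreserving_snd.preimage_null
      ((Measure.quasiMeasurePreserving_eval _ i).preimage_null (by simp))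

theorem volume_not_isUnit_coord (b : Fin d) : volume {v : S.V d | ¬ IsUnit (v b)} = 0 :=
  (Measure.quasiMeasurePreserving_eval (fun _ : Fin d => (volume : Measure S.R)) b).preimage_null
    volume_not_isUnit

theorem volume_orbit_compl (hd : 3 ≤ d) {k : ℕ} (hk : k + 1 ≤ d) :
    volume (MulAction.orbit (S.H d) (stdFrame S.R (Nat.le_of_succ_le hk)))ᶜ = 0 := by
  induction k with
  | zero =>
    convert measure_empty (μ := (volume : Measure (Fin 0 → S.V d)))
    rw [Set.compl_empty_iff, Set.eq_univ_iff_forall]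
    exact fun y => ⟨1, Subsingleton.elim _ _⟩
  | succ k ih =>
    have hinv := S.smulInvariantMeasure_V hd
    have ih := ih (by omega)
    set O := MulAction.orbit (S.H d) (stdFrame S.R (Nat.le_of_succ_le hk)) with hO
    have hOm : MeasurableSet O := measurableSet_orbit _
    have mp := volume_preserving_piFinSuccAbove (fun _ : Fin (k + 1) => S.V d) (Fin.last k)
    rw [← mp.symm.measure_preimage hOm.compl.nullMeasurableSet, Measure.volume_eq_prod,
      Measure.prod_apply_symm (μ := (volume : Measure (S.V d)))
        (ν := (volume : Measure (Fin k → S.V d))) ((MeasurableEquiv.measurable _) hOm.compl),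
      lintegral_eq_zero_iff
        (measurable_measure_prodMk_right ((MeasurableEquiv.measurable _) hOm.compl))]
    filter_upwards [compl_mem_ae_iff.2 ih] with y hy
    rw [compl_compl] at hy
    obtain ⟨g, rfl⟩ := hy
    refine measure_mono_null (t := (fun v => g⁻¹ • v) ⁻¹' {v | ¬ IsUnit (v ⟨k, by omega⟩)}) ?_ ?_
    · intro v hv hu
      obtain ⟨γ, h1, h2⟩ := exists_smul_single_eq_of_isUnit
        (k := (⟨k, by omega⟩ : Fin d)) (j := ⟨k + 1, by omega⟩) (by simp) hu
      refine hv ⟨g * γ, ?_⟩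
      change _ = Fin.insertNth (α := fun _ => S.V d) (Fin.last k) v (g • stdFrame S.R _)
      rw [Fin.insertNth_last']
      funext a
      refine Fin.lastCases ?_ (fun a => ?_) a
      · rw [Fin.snoc_last]
        change (g * γ) • (Pi.single (⟨k, _⟩ : Fin d) 1 : Fin d → S.R) = v
        rw [mul_smul, h1, smul_inv_smul]
      · rw [Fin.snoc_castSucc]
        change (g * γ) • (Pi.single (⟨a, _⟩ : Fin d) 1 : Fin d → S.R) =
          g • (Pi.single (⟨a, _⟩ : Fin d) 1 : Fin d → S.R)
        rw [mul_smul, h2]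
        · have := a.2; simp [Fin.ext_iff]; omega
        · have := a.2; simp [Fin.ext_iff]; omega
    · rw [measure_preimage_smul]
      exact volume_not_isUnit_coord _

end PrimeTup

namespace PrimeTup

open Matrix.SpecialLinearGroup

variable {S : PrimeTup} {d : ℕ}

/-- The embedding of `ℤ_S^d` in `ℚ_S^d`. -/
noncomputable def embV1 (S : PrimeTup) (d : ℕ) : (Fin d → S.Zs) →+ S.V d where
  toFun z b := S.emb (z b)
  map_zero' := by ext <;> simp
  map_add' z w := by funext b; simp

@[simp] theorem embV1_apply (z : Fin d → S.Zs) (b : Fin d) : S.embV1 d z b = S.emb (z b) := rfl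

theorem embV1_smul (γ : SpecialLinearGroup (Fin d) S.Zs) (z : Fin d → S.Zs) :
    S.embV1 d (γ • z) = S.toH d γ • S.embV1 d z := (map_smul_map S.emb γ z).symm

theorem embV1_single (a : Fin d) : S.embV1 d (Pi.single a 1) = Pi.single a 1 := by
  funext b
  simp only [embV1_apply, Pi.single_apply]
  split_ifs <;> simp

instance instCountableZs : Countable S.Zs := Subtype.val_injective.countable

/-- The box in `ℚ_S` of real interval `s` and `p`-adic unit balls. -/
def boxR (S : PrimeTup) (s : Set ℝ) : Set S.R := {r | r.1 ∈ s ∧ ∀ i, ‖r.2 i‖ ≤ 1}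

theorem boxR_eq (s : Set ℝ) : S.boxR s = s ×ˢ Set.univ.pi fun i => {x : S.Qp i | ‖x‖ ≤ 1} := by
  ext; simp [boxR]

theorem measurableSet_boxR {s : Set ℝ} (hs : MeasurableSet s) : MeasurableSet (S.boxR s) := by
  rw [boxR_eq]
  exact hs.prod (MeasurableSet.univ_pi fun i => measurableSet_le measurable_norm measurable_const)

theorem volume_boxR (s : Set ℝ) : volume (S.boxR s) = volume s := by
  rw [boxR_eq, Measure.volume_eq_prod, Measure.prod_prod, volume_pi_pi]
  simp [Padic.volume_unitBall]

/-- The fundamental domain of `ℤ_S^d` in `ℚ_S^d`. -/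
def tileV (S : PrimeTup) (d : ℕ) : Set (S.V d) := Set.univ.pi fun _ => S.tile

theorem measurableSet_tileV : MeasurableSet (S.tileV d) :=
  MeasurableSet.univ_pi fun _ => measurableSet_boxR measurableSet_Ico

theorem volume_tileV : volume (S.tileV d) = 1 := by
  rw [tileV, volume_pi_pi]
  exact Finset.prod_eq_one fun _ _ => (volume_boxR _).trans (by simp)

theorem existsUnique_sub_mem_tileV (v : S.V d) : ∃! z, v - S.embV1 d z ∈ S.tileV d := by
  choose z hz hz' using fun b => existsUnique_sub_mem_tile (v b)
  exact ⟨z, fun b _ => hz b, fun w hw => funext fun b => hz' b _ (hw b trivial)⟩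

theorem lintegral_eq_lintegral_tileV {f : S.V d → ℝ≥0∞} (hf : Measurable f) :
    ∫⁻ v, f v = ∫⁻ v in S.tileV d, ∑' z, f (v + S.embV1 d z) := by
  have hU : (⋃ z, (fun v => v - S.embV1 d z) ⁻¹' S.tileV d) = Set.univ :=
    Set.eq_univ_of_forall fun v => Set.mem_iUnion.2 (existsUnique_sub_mem_tileV v).exists
  have hm : ∀ z, MeasurableSet ((fun v => v - S.embV1 d z) ⁻¹' S.tileV d) := fun z =>
    (measurable_sub_const _) measurableSet_tileV
  have hdis : Pairwise (Function.onFun Disjoint fun z => (fun v => v - S.embV1 d z) ⁻¹' S.tileV d) :=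
    fun z w hzw => Set.disjoint_left.2 fun v hv hv' =>
      hzw ((existsUnique_sub_mem_tileV v).unique hv hv')
  rw [← setLIntegral_univ, ← hU, lintegral_iUnion hm hdis,
    lintegral_tsum (f := fun z v => f (v + S.embV1 d z))
      fun z => (hf.comp (measurable_add_const (S.embV1 d z))).aemeasurable]
  congr 1
  funext z
  have mp := measurePreserving_sub_right (volume : Measure (S.V d)) (S.embV1 d z)
  have := mp.setLIntegral_comp_preimage measurableSet_tileV
    (hf.comp (measurable_add_const (S.embV1 d z)))
  simpa using this

theorem exists_ne_add_mem {T : Set (S.V d)} (hT : MeasurableSet T) (h1 : 1 < volume T) :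
    ∃ v, ∃ z w, z ≠ w ∧ v + S.embV1 d z ∈ T ∧ v + S.embV1 d w ∈ T := by
  by_contra! hc
  refine absurd h1 (not_lt.2 ?_)
  calc volume T = ∫⁻ v, T.indicator 1 v := (lintegral_indicator_one hT).symm
    _ = ∫⁻ v in S.tileV d, ∑' z, T.indicator 1 (v + S.embV1 d z) :=
      lintegral_eq_lintegral_tileV (measurable_one.indicator hT)
    _ ≤ ∫⁻ v in S.tileV d, 1 := by
      refine lintegral_mono fun v => ?_
      by_cases hv : ∃ z, v + S.embV1 d z ∈ T
      · obtain ⟨z, hz⟩ := hv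
        rw [tsum_eq_single z fun w hw => Set.indicator_of_notMem (hc v z w hw.symm hz) _]
        exact Set.indicator_le_self' (fun _ _ => zero_le_one) _
      · push Not at hv
        simp [Set.indicator_of_notMem (hv _)]
    _ = 1 := by rw [setLIntegral_one, volume_tileV]

theorem smul_single_one_apply {A : Type*} [CommRing A] (γ : SpecialLinearGroup (Fin d) A)
    (i b : Fin d) : (γ • (Pi.single b 1 : Fin d → A)) i = γ.1 i b := by
  change (γ.1 *ᵥ Pi.single b 1) i = γ.1 i b
  rw [mulVec_single_one]
  rfl

theorem smul_eq_of_mem_fixFirst {A : Type*} [CommRing A] {k : ℕ} {γ : SpecialLinearGroup (Fin d) A}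
    (hγ : γ ∈ fixFirst d A k) {x : Fin d → A} (hx : ∀ b : Fin d, k ≤ b.1 → x b = 0) : γ • x = x := by
  funext i
  have h : ∀ b, γ.1 i b * x b = (1 : Matrix (Fin d) (Fin d) A) i b * x b := fun b => by
    by_cases hb : b.1 < k
    · have := congrFun (mem_fixFirst.1 hγ b hb) i
      rw [← smul_single_one_apply, this, Pi.single_apply, one_apply]
    · rw [hx b (not_lt.1 hb), mul_zero, mul_zero]
  calc (γ • x) i = ∑ b, γ.1 i b * x b := rfl
    _ = ((1 : Matrix (Fin d) (Fin d) A) *ᵥ x) i := Finset.sum_congr rfl fun b _ => h b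
    _ = x i := by rw [one_mulVec]

theorem apply_eq_one_of_mem_fixFirst {A : Type*} [CommRing A] {k : ℕ}
    {γ : SpecialLinearGroup (Fin d) A} (hγ : γ ∈ fixFirst d A k) {a : Fin d} (ha : a.1 = k)
    (hk : k + 1 = d) : (γ • (Pi.single a 1 : Fin d → A)) a = 1 := by
  have h1 : γ.1 = (1 : Matrix (Fin d) (Fin d) A).updateCol a (γ • (Pi.single a 1 : Fin d → A)) := by
    ext i b
    by_cases hb : b = a
    · subst hb
      rw [updateCol_self, smul_single_one_apply]
    · rw [updateCol_ne hb]
      have hb' : b.1 < k := by have := b.2; have : b.1 ≠ a.1 := fun h => hb (Fin.ext h); omega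
      have := congrFun (mem_fixFirst.1 hγ b hb') i
      rw [← smul_single_one_apply, this, Pi.single_apply, one_apply]
  exact (det_updateCol_one a _).symm.trans ((congrArg det h1).symm.trans γ.2)

theorem norm_le_of_mem_boxR {r : S.R} {c : ℝ} (hc : 1 ≤ c) (h1 : |r.1| ≤ c) (h2 : ∀ i, ‖r.2 i‖ ≤ 1) :
    ‖r‖ ≤ c :=
  max_le h1 ((pi_norm_le_iff_of_nonneg (by linarith)).2 fun i => (h2 i).trans hc)

theorem exists_fixFirst_norm_le_of_tail {k : ℕ} {a : Fin d} (ha : a.1 = k) {h : S.H d}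
    (hh : h ∈ fixFirst d S.R k) {γ : SpecialLinearGroup (Fin d) S.Zs} (hγ : γ ∈ fixFirst d S.Zs k)
    (hn : ∀ b : Fin d, k ≤ b.1 → ‖(h • S.embV1 d (γ • Pi.single a 1)) b‖ ≤ 2) :
    ∃ γ ∈ fixFirst d S.Zs k, ‖h • S.embV1 d (γ • Pi.single a 1)‖ ≤ 2 := by
  choose c hc using fun b => (existsUnique_sub_mem_tile ((h • S.embV1 d (γ • Pi.single a 1)) b)).exists
  let t : Fin d → S.Zs := fun b => if b.1 < k then -c b else 0
  have ht : ∀ b : Fin d, k ≤ b.1 → t b = 0 := fun b hb => if_neg (not_lt.2 hb)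
  obtain ⟨τ, hτ, h1⟩ := exists_shear (A := S.Zs) ha.ge (ht a ha.ge)
  refine ⟨γ * τ, mul_mem hγ hτ, ?_⟩
  have h2 : h • S.embV1 d ((γ * τ) • Pi.single a 1) =
      h • S.embV1 d (γ • Pi.single a 1) + S.embV1 d t := by
    rw [mul_smul, h1, Pi.single_eq_same, one_smul, smul_add, smul_eq_of_mem_fixFirst hγ ht, map_add,
      smul_add, smul_eq_of_mem_fixFirst hh (x := S.embV1 d t)]
    intro b hb
    rw [embV1_apply, ht b hb, map_zero]
  rw [h2, pi_norm_le_iff_of_nonneg zero_le_two]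
  intro b
  rw [Pi.add_apply, embV1_apply]
  by_cases hb : b.1 < k
  · have h3 : t b = -c b := if_pos hb
    rw [h3, map_neg, ← sub_eq_add_neg]
    obtain ⟨h4, h5⟩ := hc b
    exact norm_le_of_mem_boxR one_le_two (abs_le.2 ⟨by linarith [h4.1], by linarith [h4.2]⟩) h5
  · rw [ht b (not_lt.1 hb), map_zero, add_zero]
    exact hn b (not_lt.1 hb)

theorem norm_NS {n : ℕ} (hn : n ∈ S.NS) (i : Fin S.s) : ‖(n : S.Qp i)‖ = 1 :=
  Padic.norm_natCast_eq_one_iff.2 ((S.hp i).coprime_iff_not_dvd.2 (hn.2 i))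

theorem exists_fixFirst_norm_le (hd : 3 ≤ d) {k : ℕ} {a : Fin d} (ha : a.1 = k) {h : S.H d}
    (hh : h ∈ fixFirst d S.R k) :
    ∃ γ ∈ fixFirst d S.Zs k, ‖h • S.embV1 d (γ • Pi.single a 1)‖ ≤ 2 := by
  have hinv := S.smulInvariantMeasure_V hd
  rcases (show k + 1 ≤ d by omega).eq_or_lt with hk | hk
  · refine exists_fixFirst_norm_le_of_tail ha hh (one_mem _) fun b hb => ?_
    obtain rfl : b = a := Fin.ext (by omega)
    rw [one_smul, embV1_single, apply_eq_one_of_mem_fixFirst hh ha hk]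
    exact norm_le_of_mem_boxR one_le_two (by simp) (by simp)
  · let T : Set (S.V d) := Set.univ.pi fun b : Fin d =>
      S.boxR (Set.Ico 0 (if b.1 < k then 1 else 2))
    have hT : MeasurableSet T := MeasurableSet.univ_pi fun b => measurableSet_boxR measurableSet_Ico
    have hT1 : 1 < volume ((h • ·) ⁻¹' T) := by
      rw [measure_preimage_smul, volume_pi_pi]
      simp only [volume_boxR, Real.volume_Ico, sub_zero]
      refine lt_of_lt_of_le ENNReal.one_lt_two ?_
      rw [← Finset.mul_prod_erase _ _ (Finset.mem_univ a), if_neg (by omega)]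
      calc (2 : ℝ≥0∞) = ENNReal.ofReal 2 * ∏ b ∈ Finset.univ.erase a, 1 := by simp
        _ ≤ _ := by
          gcongr with b
          split_ifs <;> simp
    obtain ⟨v, z, w, hzw, hz, hw⟩ := exists_ne_add_mem ((measurable_const_smul h) hT) hT1
    set x := z - w with hx
    have hx0 : x ≠ 0 := sub_ne_zero.2 hzw
    have hdiff : h • S.embV1 d x = h • (v + S.embV1 d z) - h • (v + S.embV1 d w) := by
      rw [hx, map_sub, ← smul_sub]; congr 1; abel
    have hr1 : ∀ b, |((h • S.embV1 d x) b).1| < if b.1 < k then 1 else 2 := fun b => by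
      have h1 := (hz b trivial).1
      have h2 := (hw b trivial).1
      rw [hdiff]
      simp only [Pi.sub_apply, Prod.fst_sub]
      exact abs_lt.2 ⟨by linarith [h1.1, h2.2], by linarith [h1.2, h2.1]⟩
    have hr2 : ∀ b i, ‖((h • S.embV1 d x) b).2 i‖ ≤ 1 := fun b i => by
      rw [hdiff]
      exact norm_sub_le_one ((hz b trivial).2 i) ((hw b trivial).2 i)
    have htail : ∃ i : Fin d, k ≤ i.1 ∧ x i ≠ 0 := by
      by_contra! hc
      refine hx0 (funext fun b => ?_)
      by_cases hb : b.1 < k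
      · have h3 : h • S.embV1 d x = S.embV1 d x := smul_eq_of_mem_fixFirst hh fun b hb => by
          rw [embV1_apply, hc b hb, map_zero]
        have h4 := hr1 b
        rw [h3, if_pos hb] at h4
        exact eq_zero_of_emb_small h4 fun i => by have := hr2 b i; rwa [h3] at this
      · exact hc b (not_lt.1 hb)
    obtain ⟨γ, hγ, n, hn, h5⟩ := exists_smul_tail_eq hk x htail
    refine exists_fixFirst_norm_le_of_tail ha hh (inv_mem hγ) fun b hb => ?_
    set t : Fin d → S.Zs := fun b => if b.1 < k then (γ • x) b else 0 with ht
    have ht0 : ∀ b : Fin d, k ≤ b.1 → t b = 0 := fun b hb => if_neg (not_lt.2 hb)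
    have h6 : γ • x = t + (n : S.Zs) • Pi.single a 1 := by
      funext b
      simp only [ht, Pi.add_apply, Pi.smul_apply, smul_eq_mul, Pi.single_apply]
      by_cases hb : b.1 < k
      · have : b ≠ a := by rintro rfl; omega
        simp [hb, this]
      · rw [h5 b (not_lt.1 hb), if_neg hb]
        have : b = a ↔ b.1 = k := by rw [Fin.ext_iff, ha]
        simp [this]
    have h7 : x = t + (n : S.Zs) • (γ⁻¹ • (Pi.single a 1 : Fin d → S.Zs)) := by
      rw [← inv_smul_smul γ x, h6, smul_add, smul_eq_of_mem_fixFirst (inv_mem hγ) ht0]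
      congr 1
      exact mulVec_smul (γ⁻¹).1 _ _
    have h8 : (h • S.embV1 d x) b = (n : S.R) * (h • S.embV1 d (γ⁻¹ • Pi.single a 1)) b := by
      rw [h7, map_add, smul_add, smul_eq_of_mem_fixFirst hh (x := S.embV1 d t)
        (fun b hb => by rw [embV1_apply, ht0 b hb, map_zero]), Pi.add_apply, embV1_apply, ht0 b hb,
        map_zero, zero_add]
      have : S.embV1 d ((n : S.Zs) • (γ⁻¹ • (Pi.single a 1 : Fin d → S.Zs))) =
          (n : S.R) • S.embV1 d (γ⁻¹ • Pi.single a 1) := by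
        funext b; simp
      rw [this]
      exact congrFun (mulVec_smul h.1 (n : S.R) _) b
    have hn1 : (1 : ℝ) ≤ n := by exact_mod_cast hn.1
    refine norm_le_of_mem_boxR one_le_two ?_ fun i => ?_
    · have h9 := hr1 b
      rw [h8, if_neg (not_lt.2 hb), Prod.fst_mul, abs_mul, Prod.fst_natCast, Nat.abs_cast] at h9
      nlinarith [abs_nonneg ((h • S.embV1 d (γ⁻¹ • Pi.single a 1)) b).1]
    · have h9 := hr2 b i
      rw [h8, Prod.snd_mul, Pi.mul_apply, norm_mul, Prod.snd_natCast, Pi.natCast_apply,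
        norm_NS hn, one_mul] at h9
      exact h9

end PrimeTup

namespace PrimeTup

open Matrix.SpecialLinearGroup Pointwise

variable {S : PrimeTup} {d : ℕ}

theorem volume_Y_ne_zero {k : ℕ} : (volume : Measure (Fin k → S.V d)) ≠ 0 :=
  NeZero.ne _

/-- The `k`-frames which extend to a basis of `ℤ_S^d` of determinant one. -/
def frames (S : PrimeTup) {d k : ℕ} (hk : k ≤ d) : Set (Fin k → Fin d → S.Zs) :=
  MulAction.orbit (SpecialLinearGroup (Fin d) S.Zs) (stdFrame S.Zs hk)

instance instCountableSLZs : Countable (SpecialLinearGroup (Fin d) S.Zs) :=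
  have : Countable (Matrix (Fin d) (Fin d) S.Zs) :=
    inferInstanceAs (Countable (Fin d → Fin d → S.Zs))
  Subtype.val_injective.countable

theorem smul_mem_frames_iff {k : ℕ} (hk : k ≤ d) (γ : SpecialLinearGroup (Fin d) S.Zs)
    (z : Fin k → Fin d → S.Zs) : γ • z ∈ S.frames hk ↔ z ∈ S.frames hk :=
  by
  rw [frames, ← MulAction.orbit_eq_iff, ← MulAction.orbit_eq_iff, MulAction.orbit_smul]

theorem embV_mem_orbit {k : ℕ} {hk : k ≤ d} {z : Fin k → Fin d → S.Zs} (hz : z ∈ S.frames hk) :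
    S.embV d k z ∈ MulAction.orbit (S.H d) (stdFrame S.R hk) := by
  obtain ⟨γ, rfl⟩ := hz
  exact ⟨S.toH d γ, by simp only [toH_smul_embV, embV_stdFrame]⟩

variable {ν : Measure (S.H d)} [ν.IsHaarMeasure] {φ : S.H d → ℝ≥0∞}

theorem exists_siegel_subset (hd : 3 ≤ d) (hφ : IsCosetWeight (S.toH d) φ) {k : ℕ} (hk : k + 1 ≤ d)
    {Q : Set (Fin k → Fin d → S.Zs)} (hQ : ∀ (γ : SpecialLinearGroup (Fin d) S.Zs) z, γ • z ∈ Q ↔ z ∈ Q)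
    (hQo : ∀ z ∈ Q, S.embV d k z ∈ MulAction.orbit (S.H d)
      (stdFrame S.R (Nat.le_of_succ_le hk) : Fin k → S.V d)) :
    ∃ c : ℝ≥0∞, ∀ f : (Fin k → S.V d) → ℝ≥0∞, Measurable f →
      ∫⁻ g, orbitSum (S.embV d k) Q f g ∂(ν.withDensity φ) = c * ∫⁻ y, f y := by
  have := S.isMulRightInvariant_H hd ν
  have := S.smulInvariantMeasure_Y (k := k) hd
  exact hφ.exists_siegel (NeZero.ne ν) toH_smul_embV hQ volume_Y_ne_zero (measurableSet_orbit _)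
    (volume_orbit_compl hd hk) hQo

theorem exists_siegel_frames (hd : 3 ≤ d) (hφ : IsCosetWeight (S.toH d) φ) {k : ℕ} (hk : k + 1 ≤ d) :
    ∃ c : ℝ≥0∞, ∀ f : (Fin k → S.V d) → ℝ≥0∞, Measurable f →
      ∫⁻ g, orbitSum (S.embV d k) (S.frames (Nat.le_of_succ_le hk)) f g ∂(ν.withDensity φ) =
        c * ∫⁻ y, f y :=
  exists_siegel_subset hd hφ hk (smul_mem_frames_iff _) fun _ => embV_mem_orbit

theorem lintegral_orbitSum_frames_self_lt_top (hd : 3 ≤ d) (hφ : IsCosetWeight (S.toH d) φ)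
    {C : Set (Fin d → S.V d)} (hC : IsCompact C) :
    ∫⁻ g, orbitSum (S.embV d d) (S.frames le_rfl) (C.indicator 1) g ∂(ν.withDensity φ) < ∞ := by
  have := S.isMulRightInvariant_H hd ν
  set x : Fin d → Fin d → S.Zs := stdFrame S.Zs le_rfl
  have hx : ∀ γ : SpecialLinearGroup (Fin d) S.Zs, γ • x = fun a b => γ.1 b a := fun γ => by
    funext a b
    exact smul_single_one_apply γ b a
  have hinj : Function.Injective fun γ : SpecialLinearGroup (Fin d) S.Zs => γ • x := by
    intro γ γ' h
    simp only [hx] at h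
    exact Subtype.ext (Matrix.ext fun b a => congrFun (congrFun h a) b)
  set ψ : S.H d → ℝ≥0∞ := fun g => C.indicator 1 (g • stdFrame S.R le_rfl) with hψ
  have hmC : Measurable (C.indicator (1 : (Fin d → S.V d) → ℝ≥0∞)) :=
    measurable_one.indicator hC.measurableSet
  have hmψ : Measurable ψ := hmC.comp (measurable_smul_const _)
  have h1 : ∀ g, orbitSum (S.embV d d) (S.frames le_rfl) (C.indicator 1) g =
      1 * ∑' γ, ψ (g * S.toH d γ) := by
    intro g
    rw [one_mul, orbitSum, ← tsum_subtype]
    change ∑' z : Set.range fun γ : SpecialLinearGroup (Fin d) S.Zs => γ • x, _ = _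
    rw [tsum_range (fun z => C.indicator (1 : (Fin d → S.V d) → ℝ≥0∞) (g • S.embV d d z)) hinj]
    refine tsum_congr fun γ => ?_
    simp only [hψ, x, toH_smul_embV, embV_stdFrame, mul_smul]
  simp_rw [h1]
  rw [hφ.lintegral_unfold measurable_const (fun _ _ => rfl) hmψ]
  set K : Set (S.H d) := {g | g • stdFrame S.R le_rfl ∈ C}
  have hK : IsCompact K := by
    have h2 : IsCompact ((fun M : Fin d → S.V d => (Matrix.of M)ᵀ) '' C) :=
      hC.image (continuous_matrix fun i j => (_root_.continuous_apply i).comp (_root_.continuous_apply j))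
    have h3 : K = (fun g : S.H d => (g : Matrix (Fin d) (Fin d) S.R)) ⁻¹'
        ((fun M : Fin d → S.V d => (Matrix.of M)ᵀ) '' C) := by
      ext g
      have h4 : g • (stdFrame S.R le_rfl : Fin d → S.V d) = fun a b => g.1 b a := by
        funext a b
        exact smul_single_one_apply g b a
      simp only [K, Set.mem_ofPred_eq, h4, Set.mem_preimage, Set.mem_image]
      constructor
      · exact fun h => ⟨_, h, rfl⟩
      · rintro ⟨M, hM, h5⟩
        convert hM using 1
        funext a b
        exact (congrFun (congrFun h5 b) a).symm
    rw [h3]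
    exact isClosedEmbedding_coe.isCompact_preimage h2
  have h6 : ∀ g, 1 * ψ g = K.indicator 1 g := fun g => by
    rw [one_mul]; rfl
  simp_rw [h6]
  rw [lintegral_indicator_one hK.measurableSet]
  exact hK.measure_lt_top

theorem exists_snoc_mem_frames (hd : 3 ≤ d) {k : ℕ} (hk : k + 1 ≤ d) {z : Fin k → Fin d → S.Zs}
    (hz : z ∈ S.frames (Nat.le_of_succ_le hk)) {g : S.H d} {K : Set (S.H d)}
    (hg : g • S.embV d k z ∈ (fun κ : S.H d => κ • (stdFrame S.R (Nat.le_of_succ_le hk) :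
      Fin k → S.V d)) '' K) :
    ∃ v, Fin.snoc (α := fun _ => Fin d → S.Zs) z v ∈ S.frames hk ∧
      g • S.embV1 d v ∈ (fun q : S.H d × S.V d => q.1 • q.2) '' (K ×ˢ Metric.closedBall 0 2) := by
  obtain ⟨γ, rfl⟩ := hz
  obtain ⟨κ, hκ, h1⟩ := hg
  simp only [toH_smul_embV, embV_stdFrame] at h1
  have h2 : κ⁻¹ * g * S.toH d γ ∈ fixFirst d S.R k := by
    refine mem_fixFirst.2 fun i hi => ?_
    have h3 := congrFun h1 ⟨i, hi⟩
    change κ • (Pi.single i 1 : Fin d → S.R) = g • S.toH d γ • (Pi.single i 1 : Fin d → S.R) at h3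
    rw [mul_smul, mul_smul, ← h3, inv_smul_smul]
  obtain ⟨γ', hγ', h4⟩ := exists_fixFirst_norm_le hd (a := ⟨k, hk⟩) rfl h2
  refine ⟨(γ * γ') • Pi.single ⟨k, hk⟩ 1, ⟨γ * γ', ?_⟩, (κ, _), ⟨hκ, mem_closedBall_zero_iff.2 h4⟩, ?_⟩
  · funext a
    refine Fin.lastCases ?_ (fun a => ?_) a
    · rw [Fin.snoc_last]; rfl
    · rw [Fin.snoc_castSucc]
      change (γ * γ') • (Pi.single (⟨a, _⟩ : Fin d) 1 : Fin d → S.Zs) =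
        γ • (Pi.single (⟨a, _⟩ : Fin d) 1 : Fin d → S.Zs)
      rw [mul_smul, mem_fixFirst.1 hγ' _ a.2]
  · simp only
    rw [mul_smul γ, embV1_smul γ, mul_smul, mul_smul, smul_inv_smul]

theorem lintegral_orbitSum_frames_lt_top (hd : 3 ≤ d) (hφ : IsCosetWeight (S.toH d) φ)
    {k : ℕ} (hk : k ≤ d) {C : Set (Fin k → S.V d)} (hC : IsCompact C) :
    ∫⁻ g, orbitSum (S.embV d k) (S.frames hk) (C.indicator 1) g ∂(ν.withDensity φ) < ∞ := by
  have := S.isMulRightInvariant_H hd ν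
  induction hk using Nat.decreasingInduction with
  | self => exact lintegral_orbitSum_frames_self_lt_top hd hφ hC
  | of_succ k hk ih =>
    have := S.smulInvariantMeasure_Y (k := k) hd
    obtain ⟨c, hc⟩ := exists_siegel_frames (ν := ν) hd hφ hk
    obtain ⟨K, hK, hK1⟩ := exists_compact_mem_nhds (1 : S.H d)
    set x : Fin k → S.V d := stdFrame S.R (Nat.le_of_succ_le hk)
    set U := (fun κ : S.H d => κ • x) '' K
    have hU : IsCompact U := hK.image (continuous_id.smul continuous_const)
    set E := (fun q : S.H d × S.V d => q.1 • q.2) '' (K ×ˢ Metric.closedBall 0 2)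
    have hE : IsCompact E := (hK.prod (isCompact_closedBall _ _)).image continuous_smul
    set C' : Set (Fin (k + 1) → S.V d) :=
      (fun q : (Fin k → S.V d) × S.V d => Fin.snoc (α := fun _ => S.V d) q.1 q.2) '' (U ×ˢ E)
    have hC' : IsCompact C' := (hU.prod hE).image
      (continuous_pi fun a => by
        refine Fin.lastCases ?_ (fun a => ?_) a
        · simpa using continuous_snd
        · simp only [Fin.snoc_castSucc]
          exact (_root_.continuous_apply a).comp continuous_fst)
    have hle : ∀ g : S.H d, orbitSum (S.embV d k) (S.frames (Nat.le_of_succ_le hk)) (U.indicator 1) g ≤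
        orbitSum (S.embV d (k + 1)) (S.frames hk) (C'.indicator 1) g := by
      intro g
      have hex : ∀ z : Fin k → Fin d → S.Zs, ∃ v : Fin d → S.Zs,
          (S.frames (Nat.le_of_succ_le hk)).indicator
            (fun z => U.indicator (1 : (Fin k → S.V d) → ℝ≥0∞) (g • S.embV d k z)) z ≤
          (S.frames hk).indicator (fun z => C'.indicator 1 (g • S.embV d (k + 1) z))
            (Fin.snoc (α := fun _ => Fin d → S.Zs) z v) := by
        intro z
        by_cases hz : z ∈ S.frames (Nat.le_of_succ_le hk) ∧ g • S.embV d k z ∈ U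
        · obtain ⟨v, hv, hvE⟩ := exists_snoc_mem_frames hd hk hz.1 hz.2
          refine ⟨v, ?_⟩
          rw [Set.indicator_of_mem hz.1, Set.indicator_of_mem hz.2, Set.indicator_of_mem hv,
            Set.indicator_of_mem]
          · exact le_rfl
          · refine ⟨(_, _), ⟨hz.2, hvE⟩, ?_⟩
            funext a
            refine Fin.lastCases ?_ (fun a => ?_) a
            · simp only [Fin.snoc_last, Pi.smul_apply]
              congr 1
              funext b
              simp [embV]
            · simp only [Fin.snoc_castSucc, Pi.smul_apply]
              congr 1
              funext b
              simp [embV]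
        · refine ⟨0, ?_⟩
          by_cases h1 : z ∈ S.frames (Nat.le_of_succ_le hk)
          · rw [Set.indicator_of_mem h1, Set.indicator_of_notMem fun h2 => hz ⟨h1, h2⟩]
            exact zero_le
          · rw [Set.indicator_of_notMem h1]
            exact zero_le
      choose v hv using hex
      refine (ENNReal.tsum_le_tsum hv).trans (ENNReal.tsum_comp_le_tsum_of_injective
        (f := fun z => Fin.snoc (α := fun _ => Fin d → S.Zs) z (v z)) (fun z z' h => ?_) _)
      funext a
      simpa using congrFun h a.castSucc
    have hlt : c * volume U < ∞ := by
      rw [← lintegral_indicator_one hU.measurableSet,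
        ← hc _ (measurable_one.indicator hU.measurableSet)]
      exact (lintegral_mono hle).trans_lt (ih hC')
    have hU0 : volume U ≠ 0 := by
      refine orbit_measure_pos ν volume_Y_ne_zero (volume_orbit_compl hd hk) hU.measurableSet
        (ne_of_gt ?_)
      exact (MeasureTheory.Measure.measure_pos_of_mem_nhds ν hK1).trans_le (measure_mono fun g hg => ⟨g, hg, rfl⟩)
    have hc' : c < ∞ := by
      by_contra h
      rw [not_lt_top.1 h, ENNReal.top_mul hU0] at hlt
      exact lt_irrefl _ hlt
    rw [hc _ (measurable_one.indicator hC.measurableSet), lintegral_indicator_one hC.measurableSet]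
    exact ENNReal.mul_lt_top hc' hC.measure_lt_top

end PrimeTup

namespace PrimeTup

open Matrix.SpecialLinearGroup Pointwise

variable {S : PrimeTup} {d : ℕ}

theorem e1_eq_single (hd : 0 < d) : S.e1 d = Pi.single (⟨0, hd⟩ : Fin d) 1 := by
  funext b
  simp [e1, Pi.single_apply, Fin.ext_iff]

theorem mem_primZs_iff (hd : 0 < d) {w : Fin d → S.Zs} : w ∈ S.primZs d ↔
    ∃ γ : SpecialLinearGroup (Fin d) S.Zs, γ • (Pi.single (⟨0, hd⟩ : Fin d) 1 : Fin d → S.Zs) = w := by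
  rw [← e1_eq_single hd]
  exact exists_congr fun γ => eq_comm

theorem smul_mem_primZs_iff (γ : SpecialLinearGroup (Fin d) S.Zs)
    (z : Fin d → S.Zs) : γ • z ∈ S.primZs d ↔ z ∈ S.primZs d := by
  have h : S.primZs d = MulAction.orbit (SpecialLinearGroup (Fin d) S.Zs) (S.e1 d) := by
    ext w
    exact exists_congr fun γ => eq_comm
  rw [h, ← MulAction.orbit_eq_iff, ← MulAction.orbit_eq_iff, MulAction.orbit_smul]

theorem mem_frames_one_iff (hd : 1 ≤ d) {z : Fin 1 → Fin d → S.Zs} :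
    z ∈ S.frames hd ↔ z 0 ∈ S.primZs d := by
  rw [mem_primZs_iff hd]
  refine exists_congr fun γ => ⟨fun h => congrFun h 0, fun h => ?_⟩
  funext a
  rw [Subsingleton.elim a 0]
  exact h

theorem orbitSum_frames_one (hd : 1 ≤ d) (f : S.V d → ℝ≥0∞) (g : S.H d) :
    orbitSum (S.embV d 1) (S.frames hd) (fun y => f (y 0)) g =
      orbitSum (S.embV1 d) (S.primZs d) f g := by
  unfold orbitSum
  rw [← (Equiv.funUnique (Fin 1) (Fin d → S.Zs)).symm.tsum_eq]
  refine tsum_congr fun v => ?_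
  by_cases hv : v ∈ S.primZs d
  · rw [Set.indicator_of_mem hv, Set.indicator_of_mem ((mem_frames_one_iff hd).2 hv)]
    rfl
  · rw [Set.indicator_of_notMem hv, Set.indicator_of_notMem (mt (mem_frames_one_iff hd).1 hv)]

variable {ν : Measure (S.H d)} [ν.IsHaarMeasure] {φ : S.H d → ℝ≥0∞}

theorem measure_univ_lt_top (hd : 3 ≤ d) (hφ : IsCosetWeight (S.toH d) φ) :
    ν.withDensity φ Set.univ < ∞ := by
  have h := lintegral_orbitSum_frames_lt_top (ν := ν) hd hφ (Nat.zero_le d)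
    (C := Set.univ) (Set.finite_univ.isCompact)
  have h1 : ∀ g : S.H d, orbitSum (S.embV d 0) (S.frames (Nat.zero_le d))
      (Set.univ.indicator 1) g = 1 := fun g => by
    have h2 : (0 : Fin 0 → Fin d → S.Zs) ∈ S.frames (Nat.zero_le d) :=
      ⟨1, Subsingleton.elim _ _⟩
    rw [orbitSum, tsum_eq_single 0 fun z hz => (hz (Subsingleton.elim _ _)).elim,
      Set.indicator_of_mem h2]
    simp
  simp_rw [h1] at h
  rwa [lintegral_one] at h

theorem exists_siegel_frames_ne_top (hd : 3 ≤ d) (hφ : IsCosetWeight (S.toH d) φ) {k : ℕ}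
    (hk : k + 1 ≤ d) :
    ∃ c : ℝ≥0∞, c ≠ ∞ ∧ ∀ f : (Fin k → S.V d) → ℝ≥0∞, Measurable f →
      ∫⁻ g, orbitSum (S.embV d k) (S.frames (Nat.le_of_succ_le hk)) f g ∂(ν.withDensity φ) =
        c * ∫⁻ y, f y := by
  obtain ⟨c, hc⟩ := exists_siegel_frames (ν := ν) hd hφ hk
  refine ⟨c, fun h => ?_, hc⟩
  have hB := isCompact_closedBall (0 : Fin k → S.V d) 1
  have h1 := lintegral_orbitSum_frames_lt_top (ν := ν) hd hφ (Nat.le_of_succ_le hk) hB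
  rw [hc _ (measurable_one.indicator hB.measurableSet), lintegral_indicator_one hB.measurableSet,
    h, ENNReal.top_mul (Metric.measure_closedBall_pos _ _ one_pos).ne'] at h1
  exact lt_irrefl _ h1

theorem exists_siegel_primZs (hd : 3 ≤ d) (hφ : IsCosetWeight (S.toH d) φ) :
    ∃ c : ℝ≥0∞, c ≠ ∞ ∧ ∀ f : S.V d → ℝ≥0∞, Measurable f →
      ∫⁻ g, orbitSum (S.embV1 d) (S.primZs d) f g ∂(ν.withDensity φ) = c * ∫⁻ y, f y := by
  obtain ⟨c, hc, h⟩ := exists_siegel_frames_ne_top (ν := ν) hd hφ (k := 1) (by omega)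
  refine ⟨c, hc, fun f hf => ?_⟩
  simp_rw [← orbitSum_frames_one (show 1 ≤ d by omega)]
  refine (h _ (hf.comp (measurable_pi_apply 0))).trans ?_
  congr 1
  exact (volume_preserving_funUnique (Fin 1) (S.V d)).lintegral_comp hf

theorem lintegral_finTwo {f : S.V d × S.V d → ℝ≥0∞} (hf : Measurable f) :
    ∫⁻ y : Fin 2 → S.V d, f (y 0, y 1) = ∫⁻ v, ∫⁻ w, f (v, w) := by
  rw [← lintegral_prod _ hf.aemeasurable]
  exact (volume_preserving_finTwoArrow (S.V d)).lintegral_comp hf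

theorem isUnit_natCast_R {n : ℕ} (hn : n ≠ 0) : IsUnit (n : S.R) :=
  Prod.isUnit_iff.2 ⟨isUnit_iff_ne_zero.2 (by simpa using hn),
    Pi.isUnit_iff.2 fun i => isUnit_iff_ne_zero.2 (by simpa using hn)⟩

theorem lintegral_natCast_smul {n : ℕ} (hn : n ∈ S.NS) {f : S.V d → ℝ≥0∞} (hf : Measurable f) :
    ∫⁻ v, f ((n : S.R) • v) = ((n : ℝ≥0∞) ^ d)⁻¹ * ∫⁻ v, f v := by
  have hn0 : n ≠ 0 := hn.1.ne'
  obtain ⟨u, hu⟩ := isUnit_natCast_R (S := S) hn0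
  have hm : Measurable fun v : S.V d => (n : S.R) • v := measurable_const_smul _
  set m := (volume : Measure (S.V d)).map fun v => (n : S.R) • v with hmdef
  have hmH : m.IsAddHaarMeasure := by
    refine Measure.isAddHaarMeasure_map volume
      (DistribSMul.toAddMonoidHom (S.V d) (n : S.R)) (continuous_const_smul (n : S.R)) ?_ ?_
    · rw [← hu]
      exact (MulAction.toPerm u).surjective
    · rw [← hu]
      exact (Homeomorph.smul u).isClosedEmbedding.tendsto_cocompact
  set T : Set (S.V d) := Set.univ.pi fun _ => S.boxR (Set.Ico 0 n) with hT
  have hTm : MeasurableSet T := MeasurableSet.univ_pi fun b => measurableSet_boxR measurableSet_Ico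
  have hT1 : volume T = (n : ℝ≥0∞) ^ d := by
    rw [hT, volume_pi_pi]
    simp [volume_boxR]
  have hT2 : m T = 1 := by
    rw [hmdef, Measure.map_apply hm hTm, ← volume_tileV (S := S) (d := d)]
    congr 1
    ext v
    have hn' : (0 : ℝ) < n := by exact_mod_cast hn.1
    simp only [hT, tileV, tile, boxR, Set.mem_preimage, Set.mem_univ_pi, Pi.smul_apply,
      smul_eq_mul]
    refine forall_congr' fun b => ?_
    simp only [Set.mem_ofPred_eq, Prod.fst_mul, Prod.snd_mul, Prod.fst_natCast, Prod.snd_natCast,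
      Pi.mul_apply, Pi.natCast_apply, norm_mul, norm_NS hn, one_mul, Set.mem_Ico]
    rw [mul_nonneg_iff_of_pos_left hn', mul_lt_iff_lt_one_right hn']
  have key := Measure.isAddLeftInvariant_eq_smul m volume
  set c := Measure.addHaarScalarFactor m volume
  have hc : (c : ℝ≥0∞) = ((n : ℝ≥0∞) ^ d)⁻¹ := by
    rw [key, Measure.smul_apply, hT1] at hT2
    exact ENNReal.eq_inv_of_mul_eq_one_left hT2
  calc ∫⁻ v, f ((n : S.R) • v) = ∫⁻ v, f v ∂m := (lintegral_map hf hm).symm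
    _ = _ := by rw [key, lintegral_smul_measure, ← hc]; rfl

end PrimeTup

namespace PrimeTup

open Matrix.SpecialLinearGroup Pointwise

variable {S : PrimeTup} {d : ℕ}

theorem sl_smul_comm {A : Type*} [CommRing A] (γ : SpecialLinearGroup (Fin d) A) (a : A)
    (v : Fin d → A) : γ • (a • v) = a • γ • v := mulVec_smul γ.1 a v

theorem embV1_zs_smul (n : ℕ) (z : Fin d → S.Zs) :
    S.embV1 d ((n : S.Zs) • z) = (n : S.R) • S.embV1 d z := by
  funext b; simp

theorem exists_smul_primZs_of_ne_zero (hd : 3 ≤ d) {z : Fin d → S.Zs} (hz : z ≠ 0) :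
    ∃ n ∈ S.NS, ∃ w ∈ S.primZs d, z = (n : S.Zs) • w := by
  obtain ⟨i, hi⟩ := Function.ne_iff.1 hz
  obtain ⟨γ, -, n, hn, h⟩ := exists_smul_tail_eq (show 0 + 2 ≤ d by omega) z ⟨i, i.1.zero_le, hi⟩
  have h1 : γ • z = (n : S.Zs) • Pi.single (⟨0, by omega⟩ : Fin d) 1 := by
    funext b
    rw [h b b.1.zero_le]
    simp [Pi.single_apply, Fin.ext_iff]
  refine ⟨n, hn, _, (mem_primZs_iff (by omega)).2 ⟨γ⁻¹, rfl⟩, ?_⟩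
  rw [← sl_smul_comm, ← h1, inv_smul_smul]

theorem dvd_of_smul_primZs_eq (hd : 0 < d) {n n' : ℕ} (hn' : n' ∈ S.NS) {w w' : Fin d → S.Zs}
    (hw : w ∈ S.primZs d) (h : (n : S.Zs) • w = (n' : S.Zs) • w') : n' ∣ n := by
  obtain ⟨γ, rfl⟩ := (mem_primZs_iff hd).1 hw
  have h1 := congrFun (congrArg (γ⁻¹ • ·) h) ⟨0, hd⟩
  simp only [sl_smul_comm, inv_smul_smul, Pi.smul_apply, Pi.single_eq_same, smul_eq_mul,
    mul_one] at h1
  exact NS_dvd_of_mul_eq hn' h1.symm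

theorem smul_primZs_inj (hd : 0 < d) {n n' : ℕ} (hn : n ∈ S.NS) (hn' : n' ∈ S.NS)
    {w w' : Fin d → S.Zs} (hw : w ∈ S.primZs d) (hw' : w' ∈ S.primZs d)
    (h : (n : S.Zs) • w = (n' : S.Zs) • w') : n = n' ∧ w = w' := by
  obtain rfl := Nat.dvd_antisymm (dvd_of_smul_primZs_eq hd hn hw' h.symm)
    (dvd_of_smul_primZs_eq hd hn' hw h)
  refine ⟨rfl, funext fun b => ?_⟩
  have h1 := congrFun h b
  have h2 : (n : S.Zs) ≠ 0 := Nat.cast_ne_zero.2 hn.1.ne'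
  exact mul_left_cancel₀ h2 h1

/-- The pairs of linearly independent vectors in `ℤ_S^d` the first of which is primitive. -/
def indepPairs (S : PrimeTup) (d : ℕ) : Set (Fin 2 → Fin d → S.Zs) :=
  {z | z 0 ∈ S.primZs d ∧ ∀ q : S.Zs, z 1 ≠ q • z 0}

/-- The pairs of linearly independent primitive vectors. -/
def primPairs (S : PrimeTup) (d : ℕ) : Set (Fin 2 → Fin d → S.Zs) :=
  {z | z ∈ S.indepPairs d ∧ z 1 ∈ S.primZs d}

theorem smul_mem_indepPairs_iff (γ : SpecialLinearGroup (Fin d) S.Zs) (z : Fin 2 → Fin d → S.Zs) :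
    γ • z ∈ S.indepPairs d ↔ z ∈ S.indepPairs d := by
  refine and_congr (smul_mem_primZs_iff γ (z 0)) (forall_congr' fun q => not_congr ?_)
  rw [Pi.smul_apply, Pi.smul_apply, ← sl_smul_comm, smul_left_cancel_iff]

theorem smul_mem_primPairs_iff (γ : SpecialLinearGroup (Fin d) S.Zs) (z : Fin 2 → Fin d → S.Zs) :
    γ • z ∈ S.primPairs d ↔ z ∈ S.primPairs d :=
  and_congr (smul_mem_indepPairs_iff γ z) (smul_mem_primZs_iff γ (z 1))

theorem exists_frames_of_mem_indepPairs (hd : 3 ≤ d) {z : Fin 2 → Fin d → S.Zs}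
    (hz : z ∈ S.indepPairs d) : ∃ y ∈ S.frames (show 2 ≤ d by omega), ∃ n ∈ S.NS, ∃ r < n,
      z 0 = y 0 ∧ z 1 = (r : S.Zs) • y 0 + (n : S.Zs) • y 1 := by
  obtain ⟨γ, hγ⟩ := (mem_primZs_iff (show 0 < d by omega)).1 hz.1
  set i0 : Fin d := ⟨0, by omega⟩
  set i1 : Fin d := ⟨1, by omega⟩
  have h10 : i1 ≠ i0 := by simp [i0, i1]
  have htail : ∃ i : Fin d, 1 ≤ i.1 ∧ (γ⁻¹ • z 1) i ≠ 0 := by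
    by_contra! hc
    refine hz.2 ((γ⁻¹ • z 1) i0) ?_
    rw [← hγ, ← sl_smul_comm, ← inv_smul_eq_iff]
    funext b
    by_cases hb : b = i0
    · subst hb; simp
    · rw [hc b (Nat.one_le_iff_ne_zero.2 fun h => hb (Fin.ext h))]
      simp [hb]
  obtain ⟨γ', hγ', n, hn, h1⟩ := exists_smul_tail_eq (show 1 + 2 ≤ d by omega) _ htail
  obtain ⟨r, hr, b, hb⟩ := exists_remainder hn ((γ' • γ⁻¹ • z 1) i0)
  obtain ⟨τ, hτ, h2⟩ := exists_shear (A := S.Zs) (k := 1) (j := i1) le_rfl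
    (v := b • Pi.single i0 1) (by simp [h10])
  have h3 : γ' • γ⁻¹ • z 1 = (r : S.Zs) • Pi.single i0 1 + (n : S.Zs) • τ • (Pi.single i1 1 : Fin d → S.Zs) := by
    rw [h2]
    funext c
    by_cases hc : c = i0
    · subst hc
      rw [hb]
      simp [h10.symm]
    · rw [h1 c (Nat.one_le_iff_ne_zero.2 fun h => hc (Fin.ext h))]
      simp [hc, Pi.single_apply, Fin.ext_iff, i1]
  have h4 : τ • (Pi.single i0 1 : Fin d → S.Zs) = Pi.single i0 1 :=
    mem_fixFirst.1 hτ i0 zero_lt_one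
  have h5 : γ'⁻¹ • (Pi.single i0 1 : Fin d → S.Zs) = Pi.single i0 1 :=
    mem_fixFirst.1 (inv_mem hγ') i0 zero_lt_one
  have h6 : z 1 = γ • γ'⁻¹ • (γ' • γ⁻¹ • z 1) := by rw [inv_smul_smul, smul_inv_smul]
  refine ⟨_, ⟨γ * γ'⁻¹ * τ, rfl⟩, n, hn, r, hr, ?_, ?_⟩
  · change z 0 = (γ * γ'⁻¹ * τ) • (Pi.single i0 1 : Fin d → S.Zs)
    rw [mul_smul, mul_smul, h4, h5, hγ]
  · change z 1 = (r : S.Zs) • (γ * γ'⁻¹ * τ) • (Pi.single i0 1 : Fin d → S.Zs) +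
      (n : S.Zs) • (γ * γ'⁻¹ * τ) • (Pi.single i1 1 : Fin d → S.Zs)
    rw [h6, h3]
    simp only [mul_smul, h4, smul_add, sl_smul_comm]

theorem embV_indepPairs_mem_orbit (hd : 3 ≤ d) {z : Fin 2 → Fin d → S.Zs}
    (hz : z ∈ S.indepPairs d) : S.embV d 2 z ∈ MulAction.orbit (S.H d)
      (stdFrame S.R (show 2 ≤ d by omega) : Fin 2 → S.V d) := by
  obtain ⟨y, ⟨γ, rfl⟩, n, hn, r, -, h0, h1⟩ := exists_frames_of_mem_indepPairs hd hz
  set i0 : Fin d := ⟨0, by omega⟩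
  set i1 : Fin d := ⟨1, by omega⟩
  obtain ⟨h, h2, h3⟩ := exists_smul_single_eq_of_isUnit (A := S.R)
    (y := (r : S.R) • (Pi.single i0 1 : Fin d → S.R) + (n : S.R) • (Pi.single i1 1 : Fin d → S.R))
    (k := i1) (j := (⟨2, by omega⟩ : Fin d)) (by simp [i1])
    (by
      have := isUnit_natCast_R (S := S) hn.1.ne'
      simpa [i0, i1] using this)
  refine ⟨S.toH d γ * h, ?_⟩
  have e0 : S.embV1 d (z 0) = S.toH d γ • (Pi.single i0 1 : Fin d → S.R) := by
    rw [h0]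
    change S.embV1 d (γ • Pi.single i0 1) = _
    rw [embV1_smul, embV1_single]
  have e1 : S.embV1 d (z 1) = S.toH d γ • ((r : S.R) • (Pi.single i0 1 : Fin d → S.R) +
      (n : S.R) • (Pi.single i1 1 : Fin d → S.R)) := by
    rw [h1]
    change S.embV1 d ((r : S.Zs) • γ • (Pi.single i0 1 : Fin d → S.Zs) +
      (n : S.Zs) • γ • (Pi.single i1 1 : Fin d → S.Zs)) = _
    rw [map_add, embV1_zs_smul, embV1_zs_smul, embV1_smul, embV1_single, embV1_smul, embV1_single,
      smul_add, sl_smul_comm, sl_smul_comm]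
  funext a
  match a with
  | 0 =>
    change (S.toH d γ * h) • (Pi.single i0 1 : Fin d → S.R) = S.embV1 d (z 0)
    rw [e0, mul_smul, h3 i0 (by simp [i0, i1]) (by simp [i0])]
  | 1 =>
    change (S.toH d γ * h) • (Pi.single i1 1 : Fin d → S.R) = S.embV1 d (z 1)
    rw [e1, mul_smul, h2]

end PrimeTup

theorem tsum_indicator_le_of_injOn {α β : Type*} {s : Set α} {F : α → ℝ≥0∞} {G : β → ℝ≥0∞}
    {e : α → β} (he : s.InjOn e) (h : ∀ a ∈ s, F a ≤ G (e a)) :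
    ∑' a, s.indicator F a ≤ ∑' b, G b := by
  rw [← tsum_subtype]
  exact (ENNReal.tsum_le_tsum fun a : s => h a a.2).trans
    (ENNReal.tsum_comp_le_tsum_of_injective he.injective G)

theorem tsum_indicator_le_of_section {α β : Type*} {s : Set α} {F : α → ℝ≥0∞} {G : β → ℝ≥0∞}
    {π : β → α} (h : ∀ a ∈ s, ∃ b, π b = a ∧ F a ≤ G b) :
    ∑' a, s.indicator F a ≤ ∑' b, G b := by
  rw [← tsum_subtype]
  choose e he1 he2 using fun a : s => h a a.2
  refine (ENNReal.tsum_le_tsum he2).trans (ENNReal.tsum_comp_le_tsum_of_injective (f := e)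
    (fun a b hab => Subtype.ext ?_) G)
  rw [← he1 a, ← he1 b, hab]

namespace PrimeTup

open Matrix.SpecialLinearGroup Pointwise

variable {S : PrimeTup} {d : ℕ}

/-- The Dirichlet series of `ℕ_S` at `d`. -/
noncomputable def zetaE (S : PrimeTup) (d : ℕ) : ℝ≥0∞ := ∑' n : S.NS, (((n : ℕ) : ℝ≥0∞) ^ d)⁻¹

theorem tsum_embV1_le (hd : 3 ≤ d) (f : S.V d → ℝ≥0∞) (g : S.H d) :
    ∑' z, f (g • S.embV1 d z) ≤ f 0 + ∑' n : S.NS,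
      orbitSum (S.embV1 d) (S.primZs d) (fun v => f (((n : ℕ) : S.R) • v)) g := by
  classical
  set F : (Fin d → S.Zs) → ℝ≥0∞ := fun z => f (g • S.embV1 d z)
  have h1 : ∀ z, F z = ({0} : Set (Fin d → S.Zs)).indicator F z +
      ({0}ᶜ : Set (Fin d → S.Zs)).indicator F z := fun z =>
    (congrFun (Set.indicator_self_add_compl _ F) z).symm
  have h2 : ∑' z, F z = F 0 + ∑' z, ({0}ᶜ : Set (Fin d → S.Zs)).indicator F z := by
    rw [tsum_congr h1, ENNReal.tsum_add]
    congr 1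
    rw [← tsum_subtype, tsum_singleton (0 : Fin d → S.Zs) F]
  refine h2.le.trans (add_le_add (by simp [F]) ?_)
  unfold orbitSum
  rw [← ENNReal.tsum_prod (f := fun (n : S.NS) (w : Fin d → S.Zs) =>
    (S.primZs d).indicator (fun w => f (((n : ℕ) : S.R) • g • S.embV1 d w)) w)]
  refine tsum_indicator_le_of_section (π := fun p : S.NS × (Fin d → S.Zs) =>
    ((p.1 : ℕ) : S.Zs) • p.2) fun z hz => ?_
  obtain ⟨n, hn, w, hw, rfl⟩ := exists_smul_primZs_of_ne_zero hd hz
  refine ⟨(⟨n, hn⟩, w), rfl, ?_⟩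
  rw [Set.indicator_of_mem hw]
  simp only [F, embV1_zs_smul, sl_smul_comm, le_refl]

theorem embV_two (z : Fin 2 → Fin d → S.Zs) (a : Fin 2) : S.embV d 2 z a = S.embV1 d (z a) := rfl

theorem orbitSum_indepPairs_le (hd : 3 ≤ d) (f : S.V d × S.V d → ℝ≥0∞) (g : S.H d) :
    orbitSum (S.embV d 2) (S.indepPairs d) (fun y => f (y 0, y 1)) g ≤
      ∑' n : S.NS, ∑' r : Fin n, orbitSum (S.embV d 2) (S.frames (show 2 ≤ d by omega))
        (fun y => f (y 0, ((r : ℕ) : S.R) • y 0 + ((n : ℕ) : S.R) • y 1)) g := by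
  unfold orbitSum
  rw [← ENNReal.tsum_sigma (f := fun (n : S.NS) (r : Fin n) =>
      ∑' z, (S.frames (show 2 ≤ d by omega)).indicator (fun z => f ((g • S.embV d 2 z) 0,
        ((r : ℕ) : S.R) • (g • S.embV d 2 z) 0 + ((n : ℕ) : S.R) • (g • S.embV d 2 z) 1)) z),
    ← ENNReal.tsum_prod (f := fun (p : Σ n : S.NS, Fin n) (z : Fin 2 → Fin d → S.Zs) =>
      (S.frames (show 2 ≤ d by omega)).indicator (fun z => f ((g • S.embV d 2 z) 0,
        ((p.2 : ℕ) : S.R) • (g • S.embV d 2 z) 0 + ((p.1 : ℕ) : S.R) • (g • S.embV d 2 z) 1)) z)]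
  refine tsum_indicator_le_of_section
    (π := fun p : (Σ n : S.NS, Fin n) × (Fin 2 → Fin d → S.Zs) =>
      ![p.2 0, ((p.1.2 : ℕ) : S.Zs) • p.2 0 + ((p.1.1 : ℕ) : S.Zs) • p.2 1]) fun z hz => ?_
  obtain ⟨y, hy, n, hn, r, hr, h0, h1⟩ := exists_frames_of_mem_indepPairs hd hz
  refine ⟨(⟨⟨n, hn⟩, ⟨r, hr⟩⟩, y), ?_, ?_⟩
  · funext a
    match a with
    | 0 => exact h0.symm
    | 1 => exact h1.symm
  · rw [Set.indicator_of_mem hy]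
    simp only [Pi.smul_apply, embV_two, h0, h1, map_add, embV1_zs_smul, smul_add, sl_smul_comm,
      le_refl]

theorem tsum_orbitSum_primPairs_le (hd : 3 ≤ d) (f : S.V d × S.V d → ℝ≥0∞) (g : S.H d) :
    ∑' n : S.NS, orbitSum (S.embV d 2) (S.primPairs d)
        (fun y => f (y 0, ((n : ℕ) : S.R) • y 1)) g ≤
      orbitSum (S.embV d 2) (S.indepPairs d) (fun y => f (y 0, y 1)) g := by
  unfold orbitSum
  rw [← ENNReal.tsum_prod (f := fun (n : S.NS) (z : Fin 2 → Fin d → S.Zs) =>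
    (S.primPairs d).indicator (fun z => f ((g • S.embV d 2 z) 0,
      ((n : ℕ) : S.R) • (g • S.embV d 2 z) 1)) z)]
  have h1 : ∀ p : S.NS × (Fin 2 → Fin d → S.Zs), (S.primPairs d).indicator
      (fun z => f ((g • S.embV d 2 z) 0, ((p.1 : ℕ) : S.R) • (g • S.embV d 2 z) 1)) p.2 =
      {p : S.NS × (Fin 2 → Fin d → S.Zs) | p.2 ∈ S.primPairs d}.indicator (fun p =>
        f ((g • S.embV d 2 p.2) 0, ((p.1 : ℕ) : S.R) • (g • S.embV d 2 p.2) 1)) p := fun p => by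
    by_cases hp : p.2 ∈ S.primPairs d
    · rw [Set.indicator_of_mem hp, Set.indicator_of_mem (by exact hp)]
    · rw [Set.indicator_of_notMem hp, Set.indicator_of_notMem (by exact hp)]
  rw [tsum_congr h1]
  refine tsum_indicator_le_of_injOn
    (e := fun p => ![p.2 0, ((p.1 : ℕ) : S.Zs) • p.2 1]) ?_ ?_
  · rintro ⟨⟨n, hn⟩, z⟩ hz ⟨⟨n', hn'⟩, z'⟩ hz' h
    obtain ⟨rfl, h2⟩ := smul_primZs_inj (by omega) hn hn' hz.2 hz'.2 (congrFun h 1)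
    have h3 : z = z' := by
      funext a
      match a with
      | 0 => exact congrFun h 0
      | 1 => exact h2
    rw [h3]
  · rintro ⟨⟨n, hn⟩, z⟩ hz
    rw [Set.indicator_of_mem]
    · simp only [Pi.smul_apply, embV_two, cons_val_zero, cons_val_one, embV1_zs_smul, sl_smul_comm,
        le_refl]
    · refine ⟨hz.1.1, fun q hq => ?_⟩
      obtain ⟨γ, hγ⟩ := (mem_primZs_iff (show 0 < d by omega)).1 hz.1.1
      change _ = z 0 at hγ
      change (n : S.Zs) • z 1 = q • z 0 at hq
      have h4 := congrFun (congrArg (γ⁻¹ • ·) hq)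
      simp only [sl_smul_comm, ← hγ, inv_smul_smul, Pi.smul_apply, smul_eq_mul] at h4
      have hn0 : (n : S.Zs) ≠ 0 := Nat.cast_ne_zero.2 hn.1.ne'
      refine hz.1.2 ((γ⁻¹ • z 1) ⟨0, by omega⟩) ?_
      change z 1 = _ • z 0
      rw [← hγ, ← sl_smul_comm, ← inv_smul_eq_iff]
      funext b
      by_cases hb : b = ⟨0, by omega⟩
      · subst hb; simp
      · have h5 := h4 b
        rw [Pi.single_apply, if_neg hb, mul_zero] at h5
        rw [Pi.smul_apply, Pi.single_apply, if_neg hb, smul_zero]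
        exact (mul_eq_zero.1 h5).resolve_left hn0

variable {ν : Measure (S.H d)} [ν.IsHaarMeasure] {φ : S.H d → ℝ≥0∞}

theorem lintegral_finTwo_shear (r : ℕ) {n : ℕ} (hn : n ∈ S.NS) {f : S.V d × S.V d → ℝ≥0∞}
    (hf : Measurable f) :
    ∫⁻ y : Fin 2 → S.V d, f (y 0, (r : S.R) • y 0 + (n : S.R) • y 1) =
      ((n : ℝ≥0∞) ^ d)⁻¹ * ∫⁻ y : Fin 2 → S.V d, f (y 0, y 1) := by
  have hf' : Measurable fun p : S.V d × S.V d => f (p.1, (r : S.R) • p.1 + (n : S.R) • p.2) :=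
    hf.comp (by fun_prop)
  rw [lintegral_finTwo hf', lintegral_finTwo hf, ← lintegral_const_mul _ hf.lintegral_prod_right']
  refine lintegral_congr fun v => ?_
  rw [lintegral_natCast_smul hn (f := fun w => f (v, (r : S.R) • v + w))
    (hf.comp (by fun_prop))]
  congr 1
  exact lintegral_add_left_eq_self (fun w => f (v, w)) _

theorem mul_inv_pow_le {n : ℕ} (hn : 1 ≤ n) (hd : 3 ≤ d) :
    (n : ℝ≥0∞) * ((n : ℝ≥0∞) ^ d)⁻¹ ≤ ((((n : NNReal) ^ 2)⁻¹ : NNReal) : ℝ≥0∞) := by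
  have hn0 : (n : ℝ≥0∞) ≠ 0 := Nat.cast_ne_zero.2 (by omega)
  have hn1 : (1 : ℝ≥0∞) ≤ n := Nat.one_le_cast.2 hn
  obtain ⟨e, rfl⟩ : ∃ e, d = e + 1 := ⟨d - 1, by omega⟩
  rw [ENNReal.coe_inv (pow_ne_zero _ (Nat.cast_ne_zero.2 (by omega))), ENNReal.coe_pow,
    ENNReal.coe_natCast, pow_succ, ENNReal.mul_inv (Or.inr (ENNReal.natCast_ne_top n))
    (Or.inr hn0), mul_left_comm, ENNReal.mul_inv_cancel hn0 (ENNReal.natCast_ne_top n), mul_one]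
  exact ENNReal.inv_le_inv.2 (pow_le_pow_right₀ hn1 (by omega))

theorem summable_NS : Summable fun n : S.NS => (((n : ℕ) : NNReal) ^ 2)⁻¹ := by
  have h1 : Summable fun n : ℕ => ((n : NNReal) ^ 2)⁻¹ := by
    rw [← NNReal.summable_coe]
    push_cast
    exact Real.summable_nat_pow_inv.2 one_lt_two
  exact NNReal.summable_comp_injective h1 (i := fun n : S.NS => (n : ℕ)) Subtype.val_injective

theorem tsum_NS_mul_inv_pow_ne_top (hd : 3 ≤ d) :
    ∑' n : S.NS, ((n : ℕ) : ℝ≥0∞) * (((n : ℕ) : ℝ≥0∞) ^ d)⁻¹ ≠ ∞ :=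
  ne_top_of_le_ne_top (ENNReal.tsum_coe_ne_top_iff_summable.2 summable_NS)
    (ENNReal.tsum_le_tsum fun n => mul_inv_pow_le n.2.1 hd)

/-- A nonnegative scalar relation tested against the unit ball. -/
theorem le_of_forall_mul_lintegral_le {c c' : ℝ≥0∞}
    (h : ∀ f : S.V d × S.V d → ℝ≥0∞, Measurable f → c * ∫⁻ y : Fin 2 → S.V d, f (y 0, y 1) ≤
      c' * ∫⁻ y : Fin 2 → S.V d, f (y 0, y 1)) : c ≤ c' := by
  have hm : MeasurableSet (Metric.closedBall (0 : S.V d) 1 ×ˢ Metric.closedBall (0 : S.V d) 1) :=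
    measurableSet_closedBall.prod measurableSet_closedBall
  have h1 := h _ (measurable_one.indicator hm)
  have h2 : ∫⁻ y : Fin 2 → S.V d, (Metric.closedBall (0 : S.V d) 1 ×ˢ
      Metric.closedBall (0 : S.V d) 1).indicator (1 : S.V d × S.V d → ℝ≥0∞) (y 0, y 1) =
      (volume : Measure (S.V d × S.V d))
        (Metric.closedBall (0 : S.V d) 1 ×ˢ Metric.closedBall (0 : S.V d) 1) := by
    rw [← lintegral_indicator_one hm]
    exact (volume_preserving_finTwoArrow (S.V d)).lintegral_comp (measurable_one.indicator hm)
  have h3 : (volume : Measure (S.V d × S.V d))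
      (Metric.closedBall (0 : S.V d) 1 ×ˢ Metric.closedBall (0 : S.V d) 1) =
      volume (Metric.closedBall (0 : S.V d) 1) * volume (Metric.closedBall (0 : S.V d) 1) := by
    rw [Measure.volume_eq_prod, Measure.prod_prod]
  have h4 : volume (Metric.closedBall (0 : S.V d) 1) ≠ 0 :=
    (Metric.measure_closedBall_pos _ _ one_pos).ne'
  have h5 : volume (Metric.closedBall (0 : S.V d) 1) ≠ ∞ :=
    (isCompact_closedBall _ _).measure_lt_top.ne
  rw [h2, h3] at h1
  exact (ENNReal.mul_le_mul_iff_left (mul_ne_zero h4 h4) (ENNReal.mul_ne_top h5 h5)).1 h1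

theorem exists_siegel_indepPairs (hd : 3 ≤ d) (hφ : IsCosetWeight (S.toH d) φ) :
    ∃ c : ℝ≥0∞, c ≠ ∞ ∧ ∀ f : (Fin 2 → S.V d) → ℝ≥0∞, Measurable f →
      ∫⁻ g, orbitSum (S.embV d 2) (S.indepPairs d) f g ∂(ν.withDensity φ) = c * ∫⁻ y, f y := by
  obtain ⟨c, hc⟩ := exists_siegel_subset (ν := ν) hd hφ hd smul_mem_indepPairs_iff
    fun _ => embV_indepPairs_mem_orbit hd
  obtain ⟨c₂, h2, hc₂⟩ := exists_siegel_frames_ne_top (ν := ν) hd hφ hd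
  refine ⟨c, ?_, hc⟩
  refine ne_top_of_le_ne_top (ENNReal.mul_ne_top (tsum_NS_mul_inv_pow_ne_top (S := S) hd) h2)
    (le_of_forall_mul_lintegral_le (S := S) (d := d) fun f hf => ?_)
  have hmf : Measurable fun y : Fin 2 → S.V d => f (y 0, y 1) := hf.comp (by fun_prop)
  rw [← hc _ hmf]
  refine (lintegral_mono (orbitSum_indepPairs_le hd f)).trans ?_
  have hm : ∀ (n : S.NS) (r : Fin n), Measurable fun y : Fin 2 → S.V d =>
      f (y 0, ((r : ℕ) : S.R) • y 0 + ((n : ℕ) : S.R) • y 1) := fun n r => hf.comp (by fun_prop)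
  rw [lintegral_tsum fun n => (Measurable.tsum fun r =>
    measurable_orbitSum (hm n r)).aemeasurable, mul_assoc, ← ENNReal.tsum_mul_right]
  refine ENNReal.tsum_le_tsum fun n => ?_
  rw [lintegral_tsum fun r => (measurable_orbitSum (hm n r)).aemeasurable]
  simp_rw [hc₂ _ (hm n _), lintegral_finTwo_shear _ n.2 hf]
  rw [ENNReal.tsum_const, ENat.card_eq_coe_fintype_card, Fintype.card_fin]
  simp only [ENat.toENNReal_coe]
  apply le_of_eq
  ring

theorem exists_siegel_primPairs (hd : 3 ≤ d) (hφ : IsCosetWeight (S.toH d) φ) {c' : ℝ≥0∞}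
    (hc' : ∀ f : (Fin 2 → S.V d) → ℝ≥0∞, Measurable f →
      ∫⁻ g, orbitSum (S.embV d 2) (S.indepPairs d) f g ∂(ν.withDensity φ) = c' * ∫⁻ y, f y) :
    ∃ c : ℝ≥0∞, S.zetaE d * c ≤ c' ∧ ∀ f : (Fin 2 → S.V d) → ℝ≥0∞, Measurable f →
      ∫⁻ g, orbitSum (S.embV d 2) (S.primPairs d) f g ∂(ν.withDensity φ) = c * ∫⁻ y, f y := by
  obtain ⟨c, hc⟩ := exists_siegel_subset (ν := ν) hd hφ hd smul_mem_primPairs_iff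
    fun _ hz => embV_indepPairs_mem_orbit hd hz.1
  refine ⟨c, le_of_forall_mul_lintegral_le (S := S) (d := d) fun f hf => ?_, hc⟩
  have hmf : Measurable fun y : Fin 2 → S.V d => f (y 0, y 1) := hf.comp (by fun_prop)
  rw [← hc' _ hmf]
  refine le_trans ?_ (lintegral_mono (tsum_orbitSum_primPairs_le hd f))
  have hm : ∀ n : S.NS, Measurable fun y : Fin 2 → S.V d => f (y 0, ((n : ℕ) : S.R) • y 1) :=
    fun n => hf.comp (by fun_prop)
  rw [lintegral_tsum fun n => (measurable_orbitSum (hm n)).aemeasurable, mul_assoc, zetaE,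
    ← ENNReal.tsum_mul_right]
  refine ENNReal.tsum_le_tsum fun n => ?_
  rw [hc _ (hm n)]
  have h1 := lintegral_finTwo_shear 0 n.2 hf
  simp only [Nat.cast_zero, zero_smul, zero_add] at h1
  rw [h1]
  apply le_of_eq
  ring

theorem lintegral_tsum_embV1_le (hd : 3 ≤ d) {c : ℝ≥0∞}
    (hc : ∀ f : S.V d → ℝ≥0∞, Measurable f →
      ∫⁻ g, orbitSum (S.embV1 d) (S.primZs d) f g ∂(ν.withDensity φ) = c * ∫⁻ y, f y)
    {f : S.V d → ℝ≥0∞} (hf : Measurable f) :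
    ∫⁻ g : S.H d, ∑' z, f (g • S.embV1 d z) ∂(ν.withDensity φ) ≤
      f 0 * ν.withDensity φ Set.univ + S.zetaE d * c * ∫⁻ y, f y := by
  refine (lintegral_mono (tsum_embV1_le hd f)).trans ?_
  have hm : ∀ n : S.NS, Measurable fun v : S.V d => f (((n : ℕ) : S.R) • v) :=
    fun n => hf.comp (by fun_prop)
  rw [lintegral_add_left measurable_const, lintegral_const,
    lintegral_tsum fun n => (measurable_orbitSum (hm n)).aemeasurable, mul_assoc, zetaE,
    ← ENNReal.tsum_mul_right]
  refine add_le_add le_rfl (ENNReal.tsum_le_tsum fun n => ?_)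
  rw [hc _ (hm n), lintegral_natCast_smul n.2 hf]
  apply le_of_eq
  ring

end PrimeTup

namespace PrimeTup

open Filter Topology

variable {S : PrimeTup} {d : ℕ}

theorem tsum_finTwo {α : Type*} (F : α → α → ℝ≥0∞) :
    ∑' z : Fin 2 → α, F (z 0) (z 1) = ∑' v, ∑' w, F v w := by
  rw [← ENNReal.tsum_prod]
  exact (finTwoArrowEquiv α).tsum_eq fun p : α × α => F p.1 p.2

/-- Splitting a double sum over primitive vectors and a set `Q` of vectors into linearly
independent and dependent pairs. -/
theorem tsum_tsum_le (Q : Set (Fin d → S.Zs)) (f : S.V d → S.V d → ℝ≥0∞) (g : S.H d) :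
    ∑' v, ∑' w, {p : (Fin d → S.Zs) × (Fin d → S.Zs) | p.1 ∈ S.primZs d ∧ p.2 ∈ Q}.indicator
        (fun p => f (g • S.embV1 d p.1) (g • S.embV1 d p.2)) (v, w) ≤
      orbitSum (S.embV d 2) {z | z ∈ S.indepPairs d ∧ z 1 ∈ Q} (fun y => f (y 0) (y 1)) g +
        ∑' q : S.Zs, ∑' v, {v | v ∈ S.primZs d ∧ q • v ∈ Q}.indicator
          (fun v => f (g • S.embV1 d v) (S.emb q • g • S.embV1 d v)) v := by
  classical
  have hsm : ∀ (q : S.Zs) (v : Fin d → S.Zs),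
      g • S.embV1 d (q • v) = S.emb q • g • S.embV1 d v := fun q v => by
    rw [← sl_smul_comm]
    congr 1
    funext b
    simp
  have h1 : orbitSum (S.embV d 2) {z | z ∈ S.indepPairs d ∧ z 1 ∈ Q} (fun y => f (y 0) (y 1)) g =
      ∑' v, ∑' w, {p : (Fin d → S.Zs) × (Fin d → S.Zs) |
        (p.1 ∈ S.primZs d ∧ ∀ q : S.Zs, p.2 ≠ q • p.1) ∧ p.2 ∈ Q}.indicator
        (fun p => f (g • S.embV1 d p.1) (g • S.embV1 d p.2)) (v, w) := by
    rw [← tsum_finTwo]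
    refine tsum_congr fun z => ?_
    by_cases hz : z ∈ {z | z ∈ S.indepPairs d ∧ z 1 ∈ Q}
    · rw [Set.indicator_of_mem hz, Set.indicator_of_mem (by exact hz)]; rfl
    · rw [Set.indicator_of_notMem hz, Set.indicator_of_notMem (by exact hz)]
  have h2 : ∑' q : S.Zs, ∑' v, {v | v ∈ S.primZs d ∧ q • v ∈ Q}.indicator
        (fun v => f (g • S.embV1 d v) (S.emb q • g • S.embV1 d v)) v =
      ∑' v, ∑' w, ∑' q : S.Zs, if w = q • v then {v | v ∈ S.primZs d ∧ q • v ∈ Q}.indicator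
        (fun v => f (g • S.embV1 d v) (S.emb q • g • S.embV1 d v)) v else 0 := by
    rw [ENNReal.tsum_comm]
    refine tsum_congr fun v => ?_
    rw [ENNReal.tsum_comm]
    refine tsum_congr fun q => ?_
    rw [tsum_ite_eq]
  rw [h1, h2, ← ENNReal.tsum_add]
  refine ENNReal.tsum_le_tsum fun v => ?_
  rw [← ENNReal.tsum_add]
  refine ENNReal.tsum_le_tsum fun w => ?_
  by_cases hvw : v ∈ S.primZs d ∧ w ∈ Q
  · by_cases hq : ∀ q : S.Zs, w ≠ q • v
    · refine le_add_right (le_of_eq ?_)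
      rw [Set.indicator_of_mem (by exact hvw), Set.indicator_of_mem (by exact ⟨⟨hvw.1, hq⟩, hvw.2⟩)]
    · push Not at hq
      obtain ⟨q, rfl⟩ := hq
      refine le_add_left (le_trans (le_of_eq ?_) (ENNReal.le_tsum q))
      rw [Set.indicator_of_mem (by exact hvw), if_pos rfl, Set.indicator_of_mem (by exact hvw), hsm]
  · rw [Set.indicator_of_notMem (by exact hvw)]
    exact zero_le

theorem tsum_tsum_eq_mul (P Q : Set (Fin d → S.Zs)) (f₁ f₂ : S.V d → ℝ≥0∞) (g : S.H d) :
    ∑' v, ∑' w, {p : (Fin d → S.Zs) × (Fin d → S.Zs) | p.1 ∈ P ∧ p.2 ∈ Q}.indicator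
        (fun p => f₁ (g • S.embV1 d p.1) * f₂ (g • S.embV1 d p.2)) (v, w) =
      orbitSum (S.embV1 d) P f₁ g * orbitSum (S.embV1 d) Q f₂ g := by
  unfold orbitSum
  rw [← ENNReal.tsum_mul_right]
  refine tsum_congr fun v => ?_
  rw [← ENNReal.tsum_mul_left]
  refine tsum_congr fun w => ?_
  by_cases hv : v ∈ P
  · by_cases hw : w ∈ Q
    · rw [Set.indicator_of_mem (by exact ⟨hv, hw⟩), Set.indicator_of_mem hv, Set.indicator_of_mem hw]
    · rw [Set.indicator_of_notMem (fun h => hw h.2), Set.indicator_of_notMem hw, mul_zero]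
  · rw [Set.indicator_of_notMem (fun h => hv h.1), Set.indicator_of_notMem hv, zero_mul]

theorem orbitSum_indepPairs_le_mul (f₁ f₂ : S.V d → ℝ≥0∞) (g : S.H d) :
    orbitSum (S.embV d 2) (S.indepPairs d) (fun y => f₁ (y 0) * f₂ (y 1)) g ≤
      orbitSum (S.embV1 d) (S.primZs d) f₁ g * orbitSum (S.embV1 d) Set.univ f₂ g := by
  rw [← tsum_tsum_eq_mul, ← tsum_finTwo]
  refine ENNReal.tsum_le_tsum fun z => ?_
  by_cases hz : z ∈ S.indepPairs d
  · rw [Set.indicator_of_mem hz, Set.indicator_of_mem (by exact ⟨hz.1, trivial⟩)]; rfl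
  · rw [Set.indicator_of_notMem hz]
    exact zero_le

/-- The box of real radius `r` and `p`-adic radii `t`. -/
def ballV (S : PrimeTup) (d : ℕ) (r t : ℝ) : Set (S.V d) :=
  Set.univ.pi fun _ => Set.Icc (-r) r ×ˢ Metric.closedBall 0 t

theorem measurableSet_ballV (r t : ℝ) : MeasurableSet (S.ballV d r t) :=
  MeasurableSet.univ_pi fun _ => measurableSet_Icc.prod measurableSet_closedBall

theorem mem_ballV {r t : ℝ} {v : S.V d} :
    v ∈ S.ballV d r t ↔ ∀ b, |(v b).1| ≤ r ∧ ‖(v b).2‖ ≤ t := by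
  simp [ballV, abs_le]

theorem add_mem_ballV {r r' t : ℝ} {v w : S.V d} (hv : v ∈ S.ballV d r t)
    (hw : w ∈ S.ballV d r' t) : v + w ∈ S.ballV d (r + r') t := by
  rw [mem_ballV] at *
  exact fun b => ⟨(abs_add_le _ _).trans (add_le_add (hv b).1 (hw b).1),
    (IsUltrametricDist.norm_add_le_max _ _).trans (max_le (hv b).2 (hw b).2)⟩

theorem neg_mem_ballV {r t : ℝ} {v : S.V d} (hv : v ∈ S.ballV d r t) : -v ∈ S.ballV d r t := by
  rw [mem_ballV] at *
  simpa using hv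

theorem sub_mem_ballV {r r' t : ℝ} {v w : S.V d} (hv : v ∈ S.ballV d r t)
    (hw : w ∈ S.ballV d r' t) : v - w ∈ S.ballV d (r + r') t := by
  rw [sub_eq_add_neg]
  exact add_mem_ballV hv (neg_mem_ballV hw)

theorem volume_ballV (r t : ℝ) : volume (S.ballV d r t) =
    (ENNReal.ofReal (2 * r) * volume (Metric.closedBall (0 : (i : Fin S.s) → S.Qp i) t)) ^ d := by
  rw [ballV, volume_pi_pi]
  simp only [Measure.volume_eq_prod, Measure.prod_prod, Real.volume_Icc, Finset.prod_const,
    Finset.card_univ, Fintype.card_fin]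
  congr 3
  ring_nf

theorem volume_closedBall_one :
    volume (Metric.closedBall (0 : (i : Fin S.s) → S.Qp i) 1) = 1 := by
  rw [closedBall_pi _ zero_le_one, volume_pi_pi]
  refine Finset.prod_eq_one fun i _ => ?_
  convert Padic.volume_unitBall (p := S.p i)
  ext; simp

theorem volume_ballV_half : volume (S.ballV d (1 / 2) 1) = 1 := by
  rw [volume_ballV, volume_closedBall_one]; simp

theorem volume_ballV_ne_zero {r t : ℝ} (hr : 0 < r) (ht : 1 ≤ t) : volume (S.ballV d r t) ≠ 0 := by
  rw [volume_ballV]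
  refine pow_ne_zero _ (mul_ne_zero ?_ ?_)
  · simpa using hr
  · exact (Metric.measure_closedBall_pos _ _ (by linarith)).ne'

theorem volume_ballV_ne_top (r t : ℝ) : volume (S.ballV d r t) ≠ ∞ := by
  rw [volume_ballV]
  exact ENNReal.pow_ne_top (ENNReal.mul_ne_top ENNReal.ofReal_ne_top
    (isCompact_closedBall _ _).measure_lt_top.ne)

theorem volume_ballV_div {r r' t : ℝ} (hr : 0 < r) (ht : 1 ≤ t) :
    volume (S.ballV d r' t) / volume (S.ballV d r t) = ENNReal.ofReal (r' / r) ^ d := by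
  have h1 : volume (S.ballV d r' t) = ENNReal.ofReal (r' / r) ^ d * volume (S.ballV d r t) := by
    rw [volume_ballV, volume_ballV, ← mul_pow, ← mul_assoc,
      ← ENNReal.ofReal_mul' (show (0 : ℝ) ≤ 2 * r by positivity)]
    congr 3
    field_simp
  rw [h1, ENNReal.mul_div_cancel_right (volume_ballV_ne_zero hr ht) (volume_ballV_ne_top _ _)]

theorem natCast_le_volume_ballV (hd : 3 ≤ d) {n : ℕ} (hn : 1 ≤ n) :
    (n : ℝ≥0∞) ≤ volume (S.ballV d n n) := by
  have hn1 : (1 : ℝ) ≤ n := by exact_mod_cast hn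
  rw [volume_ballV]
  have h1 : (n : ℝ≥0∞) ≤ ENNReal.ofReal (2 * n) *
      volume (Metric.closedBall (0 : (i : Fin S.s) → S.Qp i) n) := by
    rw [← mul_one (n : ℝ≥0∞)]
    refine mul_le_mul' ?_ ?_
    · rw [← ENNReal.ofReal_natCast]
      exact ENNReal.ofReal_le_ofReal (by linarith)
    · rw [← volume_closedBall_one (S := S)]
      exact measure_mono (Metric.closedBall_subset_closedBall hn1)
  refine h1.trans (le_self_pow₀ (le_trans ?_ h1) (by omega))
  exact_mod_cast hn

theorem exists_smul_tileV_subset (g : S.H d) :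
    ∃ R > (0 : ℝ), ∀ t ≥ R, ∀ v ∈ S.tileV d, g • v ∈ S.ballV d R t := by
  have hc : Continuous fun v : S.V d => g • v := continuous_const_smul g
  obtain ⟨R, hR⟩ := ((isCompact_closedBall (0 : S.V d) 1).image hc).isBounded.exists_norm_le
  refine ⟨max R 1, by positivity, fun t ht v hv => mem_ballV.2 fun b => ?_⟩
  have h1 : ‖g • v‖ ≤ max R 1 := (hR _ ⟨v, ?_, rfl⟩).trans (le_max_left _ _)
  · have h2 := (norm_le_pi_norm (g • v) b).trans h1
    exact ⟨(norm_fst_le _).trans h2, ((norm_snd_le _).trans h2).trans ht⟩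
  · rw [mem_closedBall_zero_iff, pi_norm_le_iff_of_nonneg zero_le_one]
    intro b
    have := hv b trivial
    exact norm_le_of_mem_boxR le_rfl (abs_le.2 ⟨by linarith [this.1.1], this.1.2.le⟩) this.2

theorem lintegral_eq_lintegral_smul_tileV (hd : 3 ≤ d) (g : S.H d) {f : S.V d → ℝ≥0∞}
    (hf : Measurable f) :
    ∫⁻ v, f v = ∫⁻ v in S.tileV d, ∑' z, f (g • v + g • S.embV1 d z) := by
  have := smulInvariantMeasure_V S hd
  rw [← (measurePreserving_smul g (volume : Measure (S.V d))).lintegral_comp hf,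
    lintegral_eq_lintegral_tileV (f := fun v : S.V d => f (g • v))
      (hf.comp (measurable_const_smul g))]
  simp only [smul_add]

/-- The number of lattice points of `g ℤ_S^d` in a box. -/
noncomputable def boxCount (S : PrimeTup) (d : ℕ) (r t : ℝ) (g : S.H d) : ℝ≥0∞ :=
  orbitSum (S.embV1 d) Set.univ ((S.ballV d r t).indicator 1) g

theorem boxCount_eq (r t : ℝ) (g : S.H d) :
    S.boxCount d r t g = ∑' z, (S.ballV d r t).indicator 1 (g • S.embV1 d z) := by
  simp [boxCount, orbitSum]

theorem measurable_boxCount (r t : ℝ) : Measurable (S.boxCount d r t) :=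
  measurable_orbitSum (measurable_one.indicator (measurableSet_ballV r t))

theorem indicator_one_le {α : Type*} {s t : Set α} {x y : α} (h : x ∈ s → y ∈ t) :
    s.indicator (1 : α → ℝ≥0∞) x ≤ t.indicator 1 y := by
  by_cases hx : x ∈ s
  · rw [Set.indicator_of_mem hx, Set.indicator_of_mem (h hx)]; rfl
  · rw [Set.indicator_of_notMem hx]
    exact zero_le

theorem volume_ballV_le_boxCount (hd : 3 ≤ d) {g : S.H d} {R r t : ℝ}
    (hR : ∀ v ∈ S.tileV d, g • v ∈ S.ballV d R t) :
    volume (S.ballV d (r - R) t) ≤ S.boxCount d r t g := by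
  rw [← lintegral_indicator_one (measurableSet_ballV _ _),
    lintegral_eq_lintegral_smul_tileV hd g (measurable_one.indicator (measurableSet_ballV _ _))]
  calc _ ≤ ∫⁻ v in S.tileV d, S.boxCount d r t g := by
        refine setLIntegral_mono measurable_const fun v hv => ?_
        rw [boxCount_eq]
        refine ENNReal.tsum_le_tsum fun z => indicator_one_le fun h => ?_
        simpa using sub_mem_ballV h (hR v hv)
    _ = _ := by rw [setLIntegral_const, volume_tileV, mul_one]

theorem boxCount_le_volume_ballV (hd : 3 ≤ d) {g : S.H d} {R r t : ℝ}
    (hR : ∀ v ∈ S.tileV d, g • v ∈ S.ballV d R t) :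
    S.boxCount d r t g ≤ volume (S.ballV d (r + R) t) := by
  have hm : Measurable ((S.ballV d (r + R) t).indicator (1 : S.V d → ℝ≥0∞)) :=
    measurable_one.indicator (measurableSet_ballV _ _)
  rw [← lintegral_indicator_one (measurableSet_ballV _ _),
    lintegral_eq_lintegral_smul_tileV hd g hm]
  calc _ = ∫⁻ v in S.tileV d, S.boxCount d r t g := by
        rw [setLIntegral_const, volume_tileV, mul_one]
    _ ≤ _ := by
        refine setLIntegral_mono (Measurable.tsum fun z => hm.comp
          ((measurable_const_smul g).add_const _)) fun v hv => ?_
        rw [boxCount_eq]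
        refine ENNReal.tsum_le_tsum fun z => indicator_one_le fun h => ?_
        rw [add_comm (g • v)]
        exact add_mem_ballV h (hR v hv)

theorem boxCount_le_mul {g : S.H d} {r t : ℝ} (ht : 1 ≤ t) :
    S.boxCount d r t g ≤ volume (S.ballV d (r + 1 / 2) t) * S.boxCount d 1 1 g := by
  have hmono : S.ballV d (1 / 2) 1 ⊆ S.ballV d (1 / 2) t := fun v hv =>
    mem_ballV.2 fun b => ⟨(mem_ballV.1 hv b).1, (mem_ballV.1 hv b).2.trans ht⟩
  have hm : ∀ z, Measurable fun y =>
      (S.ballV d (1 / 2) 1).indicator (1 : S.V d → ℝ≥0∞) (y - g • S.embV1 d z) := fun z =>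
    (measurable_one.indicator (measurableSet_ballV _ _)).comp (measurable_sub_const _)
  have h1 : ∀ z, ∫⁻ y, (S.ballV d (1 / 2) 1).indicator (1 : S.V d → ℝ≥0∞)
      (y - g • S.embV1 d z) = 1 := fun z => by
    rw [lintegral_sub_right_eq_self (fun y => (S.ballV d (1 / 2) 1).indicator (1 : S.V d → ℝ≥0∞) y),
      lintegral_indicator_one (measurableSet_ballV _ _), volume_ballV_half]
  calc S.boxCount d r t g
      = ∫⁻ y, ∑' z, (S.ballV d r t).indicator 1 (g • S.embV1 d z) *
          (S.ballV d (1 / 2) 1).indicator (1 : S.V d → ℝ≥0∞) (y - g • S.embV1 d z) := by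
        rw [lintegral_tsum fun z => ((hm z).const_mul _).aemeasurable, boxCount_eq]
        refine tsum_congr fun z => ?_
        rw [lintegral_const_mul _ (hm z), h1, mul_one]
    _ ≤ ∫⁻ y, (S.ballV d (r + 1 / 2) t).indicator 1 y * S.boxCount d 1 1 g := by
        refine lintegral_mono fun y => ?_
        by_cases hy : ∃ z, g • S.embV1 d z ∈ S.ballV d r t ∧
            y - g • S.embV1 d z ∈ S.ballV d (1 / 2) 1
        · obtain ⟨z₀, h2, h3⟩ := hy
          have h4 : y ∈ S.ballV d (r + 1 / 2) t := by
            simpa using add_mem_ballV h2 (hmono h3)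
          rw [Set.indicator_of_mem h4, boxCount_eq, Pi.one_apply, one_mul,
            ← (Equiv.subLeft z₀).tsum_eq]
          refine ENNReal.tsum_le_tsum fun z => ?_
          rw [← mul_one ((S.ballV d 1 1).indicator 1 _), mul_comm]
          refine mul_le_mul' (indicator_one_le fun h => ?_) (Set.indicator_le_self' (by simp) _)
          have h5 := sub_mem_ballV h h3
          rw [Equiv.subLeft_apply, map_sub, smul_sub, add_halves] at h5
          convert h5 using 1
          abel
        · push Not at hy
          refine le_trans (le_of_eq ?_) zero_le
          refine ENNReal.tsum_eq_zero.2 fun z => ?_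
          by_cases h2 : g • S.embV1 d z ∈ S.ballV d r t
          · rw [Set.indicator_of_notMem (hy z h2), mul_zero]
          · rw [Set.indicator_of_notMem h2, zero_mul]
    _ = _ := by
        rw [lintegral_mul_const _ (measurable_one.indicator (measurableSet_ballV _ _)),
          lintegral_indicator_one (measurableSet_ballV _ _)]

end PrimeTup

namespace PrimeTup

open Filter Topology

variable {S : PrimeTup} {d : ℕ}

theorem tendsto_boxCount_div (hd : 3 ≤ d) (g : S.H d) :
    Tendsto (fun n : ℕ => S.boxCount d n n g / volume (S.ballV d n n)) atTop (𝓝 1) := by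
  obtain ⟨R, hR0, hR⟩ := exists_smul_tileV_subset g
  have h1 : ∀ c : ℝ, Tendsto (fun n : ℕ => ENNReal.ofReal ((n + c) / n) ^ d) atTop (𝓝 1) := by
    intro c
    have h2 : Tendsto (fun n : ℕ => ((n : ℝ) + c) / n) atTop (𝓝 1) := by
      have h3 : Tendsto (fun n : ℕ => 1 + c / (n : ℝ)) atTop (𝓝 (1 + 0)) :=
        tendsto_const_nhds.add (tendsto_const_div_atTop_nhds_zero_nat c)
      rw [add_zero] at h3
      refine h3.congr' ((eventually_ge_atTop 1).mono fun n hn => ?_)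
      have : (n : ℝ) ≠ 0 := by positivity
      field_simp
    simpa using ENNReal.Tendsto.pow (n := d) ((ENNReal.continuous_ofReal.tendsto 1).comp h2)
  have hn : ∀ᶠ n : ℕ in atTop, 1 ≤ (n : ℝ) ∧ R ≤ n :=
    (tendsto_natCast_atTop_atTop.eventually_ge_atTop 1).and
      (tendsto_natCast_atTop_atTop.eventually_ge_atTop R)
  refine tendsto_of_tendsto_of_tendsto_of_le_of_le' (h1 (-R)) (h1 R) ?_ ?_
  · filter_upwards [hn] with n hn
    rw [← volume_ballV_div (S := S) (t := n) (by linarith [hn.1]) hn.1]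
    exact ENNReal.div_le_div_right (volume_ballV_le_boxCount hd (hR n hn.2)) _
  · filter_upwards [hn] with n hn
    rw [← volume_ballV_div (S := S) (t := n) (by linarith [hn.1]) hn.1]
    exact ENNReal.div_le_div_right (boxCount_le_volume_ballV hd (hR n hn.2)) _

variable {ν : Measure (S.H d)} [ν.IsHaarMeasure] {φ : S.H d → ℝ≥0∞}

theorem measure_univ_le_zetaE_mul (hd : 3 ≤ d) (hφ : IsCosetWeight (S.toH d) φ) {c : ℝ≥0∞}
    (hc : ∀ f : S.V d → ℝ≥0∞, Measurable f →
      ∫⁻ g, orbitSum (S.embV1 d) (S.primZs d) f g ∂(ν.withDensity φ) = c * ∫⁻ y, f y) :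
    ν.withDensity φ Set.univ ≤ S.zetaE d * c := by
  set μ := ν.withDensity φ
  have h0 : μ Set.univ ≠ ∞ := (measure_univ_lt_top hd hφ).ne
  have h1 : ∀ᶠ n : ℕ in atTop, ∫⁻ g, S.boxCount d n n g / volume (S.ballV d n n) ∂μ ≤
      μ Set.univ / n + S.zetaE d * c := by
    filter_upwards [eventually_ge_atTop 1] with n hn
    have hn1 : (1 : ℝ) ≤ n := by exact_mod_cast hn
    have hm : Measurable ((S.ballV d n n).indicator (1 : S.V d → ℝ≥0∞)) :=
      measurable_one.indicator (measurableSet_ballV _ _)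
    simp only [div_eq_mul_inv]
    rw [lintegral_mul_const _ (measurable_boxCount _ _)]
    simp only [boxCount_eq]
    refine (mul_le_mul_left (lintegral_tsum_embV1_le hd hc hm) _).trans ?_
    rw [lintegral_indicator_one (measurableSet_ballV _ _), add_mul,
      mul_assoc (S.zetaE d * c), ENNReal.mul_inv_cancel (volume_ballV_ne_zero (by linarith) hn1) (volume_ballV_ne_top _ _),
      mul_one]
    refine add_le_add (mul_le_mul' ?_ (ENNReal.inv_le_inv.2 (natCast_le_volume_ballV hd hn))) le_rfl
    exact (mul_le_mul_left (Set.indicator_le_self' (by simp) _) _).trans (one_mul _).le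
  have h2 : Tendsto (fun n : ℕ => μ Set.univ / n + S.zetaE d * c) atTop (𝓝 (S.zetaE d * c)) := by
    have h3 : Tendsto (fun n : ℕ => μ Set.univ * (n : ℝ≥0∞)⁻¹) atTop (𝓝 (μ Set.univ * 0)) :=
      ENNReal.Tendsto.const_mul ENNReal.tendsto_inv_nat_nhds_zero (Or.inr h0)
    simpa [div_eq_mul_inv] using h3.add_const (S.zetaE d * c)
  calc μ Set.univ = ∫⁻ g, liminf (fun n : ℕ => S.boxCount d n n g / volume (S.ballV d n n)) atTop ∂μ := by
        simp_rw [fun g => (tendsto_boxCount_div hd g).liminf_eq]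
        rw [lintegral_one]
    _ ≤ liminf (fun n : ℕ => ∫⁻ g, S.boxCount d n n g / volume (S.ballV d n n) ∂μ) atTop :=
        lintegral_liminf_le fun n => (measurable_boxCount _ _).div_const _
    _ ≤ liminf (fun n : ℕ => μ Set.univ / n + S.zetaE d * c) atTop := liminf_le_liminf h1
    _ = _ := h2.liminf_eq

/-- A bounded open set of vectors whose first coordinate is bounded away from zero. -/
def testSet (S : PrimeTup) (d : ℕ) (b₀ : Fin d) : Set (S.V d) :=
  {y | (1 / 2 < |(y b₀).1| ∧ ∀ i, 1 / 2 < ‖(y b₀).2 i‖) ∧ ‖y‖ < 2}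

theorem isOpen_testSet (b₀ : Fin d) : IsOpen (S.testSet d b₀) := by
  have h1 : Continuous fun y : S.V d => |(y b₀).1| := by fun_prop
  have h2 : ∀ i, Continuous fun y : S.V d => ‖(y b₀).2 i‖ := fun i => by fun_prop
  refine IsOpen.inter (IsOpen.inter (isOpen_lt continuous_const h1) ?_)
    (isOpen_lt continuous_norm continuous_const)
  change IsOpen {y : S.V d | ∀ i, 1 / 2 < ‖(y b₀).2 i‖}
  rw [Set.ofPred_forall]
  exact isOpen_iInter_of_finite fun i => isOpen_lt continuous_const (h2 i)

theorem measurableSet_testSet (b₀ : Fin d) : MeasurableSet (S.testSet d b₀) :=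
  (isOpen_testSet b₀).measurableSet

theorem volume_testSet_ne_zero (b₀ : Fin d) : volume (S.testSet d b₀) ≠ 0 := by
  refine ((isOpen_testSet b₀).measure_pos _ ⟨1, ⟨by norm_num, fun i => by norm_num⟩, ?_⟩).ne'
  refine lt_of_le_of_lt ((pi_norm_le_iff_of_nonneg zero_le_one).2 fun b => ?_) one_lt_two
  exact norm_le_of_mem_boxR le_rfl (by simp) (by simp)

theorem volume_testSet_ne_top (b₀ : Fin d) : volume (S.testSet d b₀) ≠ ∞ := by
  refine ne_top_of_le_ne_top
    (isCompact_closedBall (0 : S.V d) 2).measure_lt_top.ne (measure_mono fun y hy => ?_)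
  rw [mem_closedBall_zero_iff]
  exact hy.2.le

theorem norm_le_two_of_smul_mem {b₀ : Fin d} {y : S.V d} (hy : y ∈ S.testSet d b₀) {r : S.R}
    (h : r • y ∈ S.ballV d 1 1) : ‖r‖ ≤ 2 := by
  have h1 := mem_ballV.1 h b₀
  simp only [Pi.smul_apply, smul_eq_mul, Prod.fst_mul, Prod.snd_mul, abs_mul] at h1
  refine max_le ?_ ((pi_norm_le_iff_of_nonneg zero_le_two).2 fun i => ?_)
  · rw [Real.norm_eq_abs]
    nlinarith [abs_nonneg r.1, hy.1.1, h1.1]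
  · have h2 := (norm_le_pi_norm _ i).trans h1.2
    rw [Pi.mul_apply, norm_mul] at h2
    nlinarith [norm_nonneg (r.2 i), hy.1.2 i, h2]

theorem lintegral_orbitSum_mul_boxCount_ne_top (b₀ : Fin d) {c c' : ℝ≥0∞}
    (hc0 : c ≠ ∞) (hc0' : c' ≠ ∞)
    (hc : ∀ f : S.V d → ℝ≥0∞, Measurable f →
      ∫⁻ g, orbitSum (S.embV1 d) (S.primZs d) f g ∂(ν.withDensity φ) = c * ∫⁻ y, f y)
    (hc' : ∀ f : (Fin 2 → S.V d) → ℝ≥0∞, Measurable f →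
      ∫⁻ g, orbitSum (S.embV d 2) (S.indepPairs d) f g ∂(ν.withDensity φ) = c' * ∫⁻ y, f y) :
    ∫⁻ g, orbitSum (S.embV1 d) (S.primZs d) ((S.testSet d b₀).indicator 1) g *
      S.boxCount d 1 1 g ∂(ν.withDensity φ) ≠ ∞ := by
  set f₁ : S.V d → ℝ≥0∞ := (S.testSet d b₀).indicator 1
  set f₂ : S.V d → ℝ≥0∞ := (S.ballV d 1 1).indicator 1
  have hf₁ : Measurable f₁ := measurable_one.indicator (measurableSet_testSet b₀)
  have hf₂ : Measurable f₂ := measurable_one.indicator (measurableSet_ballV _ _)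
  have hf : Measurable fun p : S.V d × S.V d => f₁ p.1 * f₂ p.2 :=
    (hf₁.comp measurable_fst).mul (hf₂.comp measurable_snd)
  have hfy : Measurable fun y : Fin 2 → S.V d => f₁ (y 0) * f₂ (y 1) :=
    (hf₁.comp (measurable_pi_apply 0)).mul (hf₂.comp (measurable_pi_apply 1))
  have hfin := finite_emb_mem (isCompact_closedBall (0 : S.R) 2)
  set K := hfin.toFinset
  have hle : ∀ g : S.H d, orbitSum (S.embV1 d) (S.primZs d) f₁ g * S.boxCount d 1 1 g ≤
      orbitSum (S.embV d 2) (S.indepPairs d) (fun y => f₁ (y 0) * f₂ (y 1)) g +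
        K.card * orbitSum (S.embV1 d) (S.primZs d) f₁ g := fun g => by
    rw [boxCount, ← tsum_tsum_eq_mul]
    refine (tsum_tsum_le Set.univ (fun v w => f₁ v * f₂ w) g).trans (add_le_add ?_ ?_)
    · simp only [Set.mem_univ, and_true, Set.ofPred_mem_eq, le_refl]
    · rw [tsum_eq_sum (s := K), ← nsmul_eq_mul]
      · refine Finset.sum_le_card_nsmul _ _ _ fun q _ => ENNReal.tsum_le_tsum fun v => ?_
        simp only [Set.mem_univ, and_true, Set.ofPred_mem_eq]
        refine Set.indicator_le_indicator ?_
        exact (mul_le_mul_right (Set.indicator_le_self' (by simp) _) _).trans (by simp)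
      · intro q hq
        refine ENNReal.tsum_eq_zero.2 fun v => ?_
        rw [Set.indicator_apply_eq_zero]
        intro _
        by_contra h
        obtain ⟨h1, h2⟩ := mul_ne_zero_iff.1 h
        refine hq (hfin.mem_toFinset.2 ?_)
        rw [Set.mem_ofPred_eq, mem_closedBall_zero_iff]
        exact norm_le_two_of_smul_mem (Set.mem_of_indicator_ne_zero h1)
          (Set.mem_of_indicator_ne_zero h2)
  refine ne_top_of_le_ne_top ?_ (lintegral_mono hle)
  have hI : ∫⁻ v, f₁ v ≠ ∞ := by
    rw [lintegral_indicator_one (measurableSet_testSet b₀)]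
    exact volume_testSet_ne_top b₀
  have hI₂ : ∫⁻ v, f₂ v ≠ ∞ := by
    rw [lintegral_indicator_one (measurableSet_ballV _ _)]
    exact volume_ballV_ne_top _ _
  rw [lintegral_add_left (measurable_orbitSum hfy), lintegral_const_mul _ (measurable_orbitSum hf₁),
    hc _ hf₁, hc' _ hfy, lintegral_finTwo hf]
  simp_rw [lintegral_const_mul _ hf₂]
  rw [lintegral_mul_const _ hf₁]
  finiteness

theorem indepPairs_const_le (hd : 3 ≤ d) {c c' : ℝ≥0∞}
    (hc0 : c ≠ ∞) (hc0' : c' ≠ ∞)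
    (hc : ∀ f : S.V d → ℝ≥0∞, Measurable f →
      ∫⁻ g, orbitSum (S.embV1 d) (S.primZs d) f g ∂(ν.withDensity φ) = c * ∫⁻ y, f y)
    (hc' : ∀ f : (Fin 2 → S.V d) → ℝ≥0∞, Measurable f →
      ∫⁻ g, orbitSum (S.embV d 2) (S.indepPairs d) f g ∂(ν.withDensity φ) = c' * ∫⁻ y, f y) :
    c' ≤ c := by
  set b₀ : Fin d := ⟨0, by omega⟩
  set μ := ν.withDensity φ
  set f₁ : S.V d → ℝ≥0∞ := (S.testSet d b₀).indicator 1
  have hf₁ : Measurable f₁ := measurable_one.indicator (measurableSet_testSet b₀)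
  set N := orbitSum (H := S.H d) (S.embV1 d) (S.primZs d) f₁
  have hN : Measurable N := measurable_orbitSum hf₁
  have hI : ∫⁻ v, f₁ v = volume (S.testSet d b₀) :=
    lintegral_indicator_one (measurableSet_testSet b₀)
  have hlow : ∀ᶠ n : ℕ in atTop, c' * volume (S.testSet d b₀) ≤
      ∫⁻ g, N g * (S.boxCount d n n g / volume (S.ballV d n n)) ∂μ := by
    filter_upwards [eventually_ge_atTop 1] with n hn
    have hn1 : (1 : ℝ) ≤ n := by exact_mod_cast hn
    set f₂ : S.V d → ℝ≥0∞ := (S.ballV d n n).indicator 1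
    have hf₂ : Measurable f₂ := measurable_one.indicator (measurableSet_ballV _ _)
    have hf : Measurable fun p : S.V d × S.V d => f₁ p.1 * f₂ p.2 :=
      (hf₁.comp measurable_fst).mul (hf₂.comp measurable_snd)
    have hfy : Measurable fun y : Fin 2 → S.V d => f₁ (y 0) * f₂ (y 1) :=
    (hf₁.comp (measurable_pi_apply 0)).mul (hf₂.comp (measurable_pi_apply 1))
    have h1 := hc' _ hfy
    rw [lintegral_finTwo hf] at h1
    simp_rw [lintegral_const_mul _ hf₂] at h1
    rw [lintegral_mul_const _ hf₁, hI, lintegral_indicator_one (measurableSet_ballV _ _),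
      ← mul_assoc] at h1
    simp only [div_eq_mul_inv, ← mul_assoc]
    have hm : Measurable fun g => N g * S.boxCount d n n g := hN.mul (measurable_boxCount _ _)
    rw [lintegral_mul_const _ hm, ← div_eq_mul_inv,
      ENNReal.le_div_iff_mul_le (Or.inl (volume_ballV_ne_zero (by linarith) hn1))
        (Or.inl (volume_ballV_ne_top _ _)), ← h1]
    exact lintegral_mono fun g => orbitSum_indepPairs_le_mul f₁ f₂ g
  have hlim : Tendsto (fun n : ℕ => ∫⁻ g, N g * (S.boxCount d n n g / volume (S.ballV d n n)) ∂μ)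
      atTop (𝓝 (∫⁻ g, N g ∂μ)) := by
    have hNfin : ∀ᵐ g ∂μ, N g < ∞ := ae_lt_top hN (by
      rw [hc _ hf₁, hI]
      exact ENNReal.mul_ne_top hc0 (volume_testSet_ne_top b₀))
    refine tendsto_lintegral_filter_of_dominated_convergence
      (fun g => 2 ^ d * (N g * S.boxCount d 1 1 g)) (.of_forall fun n =>
        hN.mul ((measurable_boxCount _ _).div_const _)) ?_ ?_ ?_
    · filter_upwards [eventually_ge_atTop 1] with n hn
      have hn1 : (1 : ℝ) ≤ n := by exact_mod_cast hn
      refine .of_forall fun g => ?_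
      rw [mul_left_comm]
      refine mul_le_mul_right ?_ _
      refine (ENNReal.div_le_div_right (boxCount_le_mul hn1) _).trans ?_
      rw [ENNReal.mul_div_right_comm, volume_ballV_div (by linarith) hn1]
      refine mul_le_mul_left (pow_le_pow_left₀ zero_le ?_ _) _
      rw [← ENNReal.ofReal_ofNat]
      refine ENNReal.ofReal_le_ofReal ?_
      rw [div_le_iff₀ (by linarith)]
      linarith
    · have hm : Measurable fun g => N g * S.boxCount d 1 1 g := hN.mul (measurable_boxCount _ _)
      rw [lintegral_const_mul _ hm]
      exact ENNReal.mul_ne_top (by finiteness)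
        (lintegral_orbitSum_mul_boxCount_ne_top b₀ hc0 hc0' hc hc')
    · filter_upwards [hNfin] with g hg
      simpa using ENNReal.Tendsto.const_mul (tendsto_boxCount_div hd g) (Or.inr hg.ne)
  have h2 := ge_of_tendsto hlim hlow
  rw [hc _ hf₁, hI] at h2
  exact (ENNReal.mul_le_mul_iff_left (volume_testSet_ne_zero b₀) (volume_testSet_ne_top b₀)).1 h2

end PrimeTup

namespace PrimeTup

variable {S : PrimeTup} {d : ℕ}

theorem zetaE_ne_top (hd : 3 ≤ d) : S.zetaE d ≠ ∞ := by
  refine ne_top_of_le_ne_top (ENNReal.tsum_coe_ne_top_iff_summable.2 S.summable_NS)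
    (ENNReal.tsum_le_tsum fun n => ?_)
  have h : (1 : ℝ≥0∞) ≤ ((n : ℕ) : ℝ≥0∞) := by exact_mod_cast n.2.1
  have h0 : (((n : ℕ) : NNReal) ^ 2) ≠ 0 := pow_ne_zero _ (by exact_mod_cast n.2.1.ne')
  rw [ENNReal.coe_inv h0]
  push_cast
  exact ENNReal.inv_le_inv.2 (pow_le_pow_right₀ h (by omega))

theorem zetaS_eq (S : PrimeTup) (d : ℕ) : S.zetaS d = (S.zetaE d).toReal := by
  rw [zetaE, ENNReal.tsum_toReal_eq fun n => ENNReal.inv_ne_top.2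
    (pow_ne_zero _ (by exact_mod_cast n.2.1.ne')), zetaS]
  simp

theorem one_le_zetaE (S : PrimeTup) (d : ℕ) : 1 ≤ S.zetaE d := by
  have h := ENNReal.le_tsum (f := fun n : S.NS => (((n : ℕ) : ℝ≥0∞) ^ d)⁻¹)
    ⟨1, one_pos, fun i => (S.hp i).not_dvd_one⟩
  simpa [zetaE] using h

/-- The regrouping `(ℝ × ∏ᵢ ℚ_{pᵢ})^d ≃ ℝ^d × ∏ᵢ ℚ_{pᵢ}^d`. -/
def equivQS (S : PrimeTup) (d : ℕ) : S.V d ≃ₜ+ S.QS d where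
  toFun v := (fun b => (v b).1, fun i b => (v b).2 i)
  invFun x b := (x.1 b, fun i => x.2 i b)
  left_inv _ := rfl
  right_inv _ := rfl
  map_add' _ _ := rfl
  continuous_toFun := by fun_prop
  continuous_invFun := by fun_prop

theorem measurable_equivQS : Measurable (S.equivQS d) :=
  (S.equivQS d).toHomeomorph.continuous.measurable

theorem measurableSet_unitBall_pi (i : Fin S.s) :
    MeasurableSet {v : Fin d → S.Qp i | ∀ j, ‖v j‖ ≤ 1} := by
  rw [Set.ofPred_forall]
  exact MeasurableSet.iInter fun j => (isClosed_le (by fun_prop) continuous_const).measurableSet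

theorem map_equivQS_volume {volP : (i : Fin S.s) → Measure (Fin d → S.Qp i)}
    [∀ i, (volP i).IsAddHaarMeasure] (h1 : ∀ i, volP i {v | ∀ j, ‖v j‖ ≤ 1} = 1) :
    (volume : Measure (S.V d)).map (S.equivQS d) =
      (volume : Measure (Fin d → ℝ)).prod (Measure.pi volP) := by
  have hH : ((volume : Measure (S.V d)).map (S.equivQS d)).IsAddHaarMeasure :=
    ContinuousAddEquiv.isAddHaarMeasure_map _ _
  have hP : ((volume : Measure (Fin d → ℝ)).prod (Measure.pi volP)).IsAddHaarMeasure :=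
    Measure.prod.instIsAddHaarMeasure _ _
  obtain ⟨c, hu⟩ : ∃ c : NNReal, (volume : Measure (S.V d)).map (S.equivQS d) =
      c • (volume : Measure (Fin d → ℝ)).prod (Measure.pi volP) :=
    ⟨_, Measure.isAddLeftInvariant_eq_smul _ _⟩
  have hb : MeasurableSet ((Set.univ.pi fun _ : Fin d => Set.Ico (0:ℝ) 1) ×ˢ
      Set.univ.pi fun i => {v : Fin d → S.Qp i | ∀ j, ‖v j‖ ≤ 1} : Set (S.QS d)) :=
    (MeasurableSet.univ_pi fun _ => measurableSet_Ico).prod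
      (MeasurableSet.univ_pi measurableSet_unitBall_pi)
  have h2 := congrArg (fun m : Measure (S.QS d) => m ((Set.univ.pi fun _ : Fin d => Set.Ico (0:ℝ) 1) ×ˢ
      Set.univ.pi fun i => {v : Fin d → S.Qp i | ∀ j, ‖v j‖ ≤ 1})) hu
  have h3 : S.equivQS d ⁻¹' ((Set.univ.pi fun _ : Fin d => Set.Ico (0:ℝ) 1) ×ˢ
      Set.univ.pi fun i => {v : Fin d → S.Qp i | ∀ j, ‖v j‖ ≤ 1}) = S.tileV d := by
    ext v
    simp [equivQS, tileV, tile]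
    grind
  simp only [Measure.smul_apply] at h2
  rw [Measure.map_apply measurable_equivQS hb, h3, volume_tileV, Measure.prod_prod,
    volume_pi_pi, Measure.pi_pi, Finset.prod_congr rfl fun i _ => h1 i] at h2
  simp only [Real.volume_Ico, Finset.prod_const_one, mul_one, sub_zero, ENNReal.ofReal_one] at h2
  rw [hu]
  have : c = 1 := by
    rw [ENNReal.smul_def, smul_eq_mul, mul_one] at h2
    exact_mod_cast h2.symm
  rw [this, one_smul]

end PrimeTup

theorem Padic.measure_smul_mem_unitBall_le {p : ℕ} [Fact p.Prime] {d : ℕ}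
    {μ : Measure (Fin d → ℚ_[p])} [μ.IsAddLeftInvariant] (h1 : μ {v | ∀ j, ‖v j‖ ≤ 1} = 1)
    {q : ℚ_[p]} (hq : 1 < ‖q‖) :
    μ {v | ∀ j, ‖q * v j‖ ≤ 1} ≤ ENNReal.ofReal (‖q‖ ^ d)⁻¹ := by
  obtain ⟨n, hn⟩ : ∃ n : ℕ, ‖q‖ = (p : ℝ) ^ n := by
    have h0 : q ≠ 0 := by rintro rfl; simp at hq; linarith
    have hp1 : (1 : ℝ) < p := by exact_mod_cast (Fact.out : p.Prime).one_lt
    have hm := Padic.norm_eq_zpow_neg_valuation h0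
    have h : 0 < -q.valuation := by
      rw [hm] at hq
      by_contra! h
      exact absurd hq (not_lt.2 (zpow_le_one_of_nonpos₀ hp1.le h))
    exact ⟨(-q.valuation).toNat, by rw [hm, ← zpow_natCast, Int.toNat_of_nonneg h.le]⟩
  have hp0 : (0 : ℝ) < p := by exact_mod_cast (Fact.out : p.Prime).pos
  set B : Set (Fin d → ℚ_[p]) := {v | ∀ j, ‖q * v j‖ ≤ 1} with hB
  have hBm : MeasurableSet B := by
    rw [hB, Set.ofPred_forall]
    exact MeasurableSet.iInter fun j => (isClosed_le (by fun_prop) continuous_const).measurableSet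
  have hBn : ∀ v ∈ B, ∀ j, ‖v j‖ ≤ (p : ℝ) ^ (-n : ℤ) := fun v hv j => by
    have := hv j
    rw [norm_mul, hn] at this
    rw [_root_.zpow_neg, zpow_natCast, ← one_div, le_div_iff₀ (by positivity), mul_comm]
    exact this
  let e : (Fin d → Fin (p ^ n)) → Fin d → ℚ_[p] := fun t j => ((t j : ℕ) : ℚ_[p])
  have hsubn {c : ℝ} {x y : ℚ_[p]} (hx : ‖x‖ ≤ c) (hy : ‖y‖ ≤ c) : ‖x - y‖ ≤ c := by
    rw [sub_eq_add_neg]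
    exact (Padic.nonarchimedean _ _).trans (max_le hx (by rwa [norm_neg]))
  have hdis : Pairwise (Function.onFun Disjoint fun t => (fun v => e t + v) ⁻¹' B) := by
    intro t t' htt
    refine Set.disjoint_left.2 fun v hv hv' => htt (funext fun j => ?_)
    have h := hsubn (hBn _ hv j) (hBn _ hv' j)
    simp only [e, Pi.add_apply, add_sub_add_right_eq_sub] at h
    have h3 : ‖((((t j : ℕ) : ℤ) - ((t' j : ℕ) : ℤ) : ℤ) : ℚ_[p])‖ ≤ (p : ℝ) ^ (-n : ℤ) := by
      push_cast
      exact h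
    rw [Padic.norm_int_le_pow_iff_dvd] at h3
    have h4 := Int.eq_zero_of_abs_lt_dvd h3 (by
      have h5 : (((t j : ℕ)) : ℤ) < (p : ℤ) ^ n := by exact_mod_cast (t j).2
      have h6 : (((t' j : ℕ)) : ℤ) < (p : ℤ) ^ n := by exact_mod_cast (t' j).2
      rw [abs_lt]
      constructor <;> linarith [(t j : ℕ).cast_nonneg (α := ℤ), (t' j : ℕ).cast_nonneg (α := ℤ)])
    exact Fin.ext (by omega)
  have hsub : (⋃ t, (fun v => e t + v) ⁻¹' B) ⊆ {v | ∀ j, ‖v j‖ ≤ 1} := by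
    refine Set.iUnion_subset fun t v hv j => ?_
    have h := hsubn ((hBn _ hv j).trans (zpow_le_one_of_nonpos₀ (by
      exact_mod_cast (Fact.out : p.Prime).one_le) (by simp))) (Padic.norm_int_le_one ((t j : ℕ) : ℤ))
    simpa [e] using h
  have h2 := measure_mono (μ := μ) hsub
  rw [measure_iUnion hdis fun t => hBm.preimage (by fun_prop), h1] at h2
  simp only [measure_preimage_add] at h2
  rw [tsum_fintype, Finset.sum_const, Finset.card_univ, Fintype.card_fun, Fintype.card_fin,
    Fintype.card_fin, nsmul_eq_mul] at h2
  rw [hn, ENNReal.ofReal_inv_of_pos (by positivity), ENNReal.ofReal_pow (by positivity),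
    ENNReal.ofReal_pow (by positivity), ENNReal.ofReal_natCast, ← one_div,
    ENNReal.le_div_iff_mul_le (by simp) (by simp), mul_comm]
  exact_mod_cast h2

theorem Padic.measure_inter_smul_le {p : ℕ} [Fact p.Prime] {d : ℕ}
    {μ : Measure (Fin d → ℚ_[p])} [μ.IsAddHaarMeasure] (h1 : μ {v | ∀ j, ‖v j‖ ≤ 1} = 1)
    {q : ℚ_[p]} (hq : q ≠ 0) {A : Set (Fin d → ℚ_[p])} (hA : MeasurableSet A) :
    μ (A ∩ {v | q • v ∈ A}) ≤ μ A * ENNReal.ofReal (max 1 ‖q‖ ^ d)⁻¹ := by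
  rcases le_or_gt ‖q‖ 1 with h | h
  · rw [max_eq_left h]
    simpa using measure_mono (μ := μ) Set.inter_subset_left
  rw [max_eq_right h.le]
  let e : (Fin d → ℚ_[p]) ≃L[ℚ_[p]] (Fin d → ℚ_[p]) := ContinuousLinearEquiv.smulLeft (Units.mk0 q hq)
  have he : Measurable e := e.continuous.measurable
  have := e.isAddHaarMeasure_map μ
  obtain ⟨c, hc⟩ : ∃ c : NNReal, μ.map e = c • μ := ⟨_, Measure.isAddLeftInvariant_eq_smul _ _⟩
  have hs {B : Set (Fin d → ℚ_[p])} (hB : MeasurableSet B) : μ {v | q • v ∈ B} = c * μ B := by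
    have := congrArg (fun m : Measure (Fin d → ℚ_[p]) => m B) hc
    simp only [Measure.smul_apply] at this
    rwa [Measure.map_apply he hB] at this
  have hB : MeasurableSet {v : Fin d → ℚ_[p] | ∀ j, ‖v j‖ ≤ 1} := by
    rw [Set.ofPred_forall]
    exact MeasurableSet.iInter fun j => (isClosed_le (by fun_prop) continuous_const).measurableSet
  have hc' := hs hB
  rw [h1, mul_one] at hc'
  calc μ (A ∩ {v | q • v ∈ A}) ≤ μ {v | q • v ∈ A} := measure_mono Set.inter_subset_right
    _ = μ A * c := by rw [hs hA, mul_comm]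
    _ ≤ _ := by
      gcongr
      rw [← hc']
      exact measure_smul_mem_unitBall_le h1 h

theorem Real.volume_inter_smul_le {d : ℕ} {q : ℝ} (hq : q ≠ 0) (A : Set (Fin d → ℝ)) :
    volume (A ∩ {v | q • v ∈ A}) ≤ volume A * ENNReal.ofReal (max 1 |q| ^ d)⁻¹ := by
  rcases le_or_gt |q| 1 with h | h
  · rw [max_eq_left h]
    simpa using measure_mono (μ := volume) Set.inter_subset_left
  rw [max_eq_right h.le, mul_comm]
  refine (measure_mono Set.inter_subset_right).trans ?_
  have := Measure.addHaar_preimage_smul (volume : Measure (Fin d → ℝ)) hq A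
  rw [Module.finrank_fin_fun, abs_inv, abs_pow] at this
  exact this.le

namespace PrimeTup

variable {S : PrimeTup} {d : ℕ}

/-- The set of `v` in `(ℝ × ∏ᵢ ℚ_{pᵢ})^d` with components in the given sets. -/
def prodSet (S : PrimeTup) {d : ℕ} (A : Set (Fin d → ℝ)) (B : (i : Fin S.s) → Set (Fin d → S.Qp i)) :
    Set (S.V d) :=
  S.equivQS d ⁻¹' {x | x.1 ∈ A ∧ ∀ i, x.2 i ∈ B i}

theorem measurableSet_prod_pi {A : Set (Fin d → ℝ)} {B : (i : Fin S.s) → Set (Fin d → S.Qp i)}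
    (hA : MeasurableSet A) (hB : ∀ i, MeasurableSet (B i)) :
    MeasurableSet {x : S.QS d | x.1 ∈ A ∧ ∀ i, x.2 i ∈ B i} := by
  have := hA.prod (MeasurableSet.univ_pi hB)
  convert this using 1
  ext
  simp

theorem measurableSet_prodSet {A : Set (Fin d → ℝ)} {B : (i : Fin S.s) → Set (Fin d → S.Qp i)}
    (hA : MeasurableSet A) (hB : ∀ i, MeasurableSet (B i)) : MeasurableSet (S.prodSet A B) :=
  (measurableSet_prod_pi hA hB).preimage measurable_equivQS

section

variable {volP : (i : Fin S.s) → Measure (Fin d → S.Qp i)} [∀ i, (volP i).IsAddHaarMeasure]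

theorem prod_pi_apply (A : Set (Fin d → ℝ)) (B : (i : Fin S.s) → Set (Fin d → S.Qp i)) :
    (volume : Measure (Fin d → ℝ)).prod (Measure.pi volP) {x | x.1 ∈ A ∧ ∀ i, x.2 i ∈ B i} =
      volume A * ∏ i, volP i (B i) := by
  rw [← Measure.pi_pi, ← Measure.prod_prod]
  congr 1
  ext
  simp

theorem volume_preimage_equivQS (h1 : ∀ i, volP i {v | ∀ j, ‖v j‖ ≤ 1} = 1) {A : Set (S.QS d)}
    (hA : MeasurableSet A) :
    volume (S.equivQS d ⁻¹' A) = (volume : Measure (Fin d → ℝ)).prod (Measure.pi volP) A := by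
  rw [← map_equivQS_volume h1, Measure.map_apply measurable_equivQS hA]

theorem volume_prodSet (h1 : ∀ i, volP i {v | ∀ j, ‖v j‖ ≤ 1} = 1)
    {A : Set (Fin d → ℝ)} {B : (i : Fin S.s) → Set (Fin d → S.Qp i)}
    (hA : MeasurableSet A) (hB : ∀ i, MeasurableSet (B i)) :
    volume (S.prodSet A B) = volume A * ∏ i, volP i (B i) := by
  rw [prodSet, volume_preimage_equivQS h1 (measurableSet_prod_pi hA hB), prod_pi_apply]

theorem volume_prodSet_inter_smul_le (hd : 3 ≤ d) (h1 : ∀ i, volP i {v | ∀ j, ‖v j‖ ≤ 1} = 1)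
    {A : Set (Fin d → ℝ)} {B : (i : Fin S.s) → Set (Fin d → S.Qp i)}
    (hA : MeasurableSet A) (hB : ∀ i, MeasurableSet (B i)) {q : S.Zs} (hq : q ≠ 0) :
    volume (S.prodSet A B ∩ {v | S.emb q • v ∈ S.prodSet A B}) ≤
      volume (S.prodSet A B) * ENNReal.ofReal ((height q : ℝ) ^ 3)⁻¹ := by
  have hq' : (q : ℚ) ≠ 0 := by simpa using hq
  have hqr : ((q : ℚ) : ℝ) ≠ 0 := by exact_mod_cast hq'
  have hqp (i) : ((q : ℚ) : S.Qp i) ≠ 0 := by exact_mod_cast hq'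
  have e : S.prodSet A B ∩ {v | S.emb q • v ∈ S.prodSet A B} =
      S.prodSet (A ∩ {v | ((q : ℚ) : ℝ) • v ∈ A}) fun i => B i ∩ {v | ((q : ℚ) : S.Qp i) • v ∈ B i} := by
    ext v
    have h2 : S.equivQS d (S.emb q • v) = (((q : ℚ) : ℝ) • (S.equivQS d v).1,
      fun i => ((q : ℚ) : S.Qp i) • (S.equivQS d v).2 i) := rfl
    simp only [prodSet, Set.mem_inter_iff, Set.mem_preimage, Set.mem_ofPred_eq, h2]
    grind
  have hA' : MeasurableSet (A ∩ {v | ((q : ℚ) : ℝ) • v ∈ A}) :=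
    hA.inter (hA.preimage (by fun_prop : Measurable fun v : Fin d → ℝ => ((q : ℚ) : ℝ) • v))
  have hB' (i) : MeasurableSet (B i ∩ {v | ((q : ℚ) : S.Qp i) • v ∈ B i}) :=
    (hB i).inter ((hB i).preimage
      (continuous_const_smul _ : Continuous fun v : Fin d → S.Qp i => ((q : ℚ) : S.Qp i) • v).measurable)
  rw [e, volume_prodSet h1 hA' hB', volume_prodSet h1 hA hB]
  calc _ ≤ volume A * ENNReal.ofReal (max 1 |((q : ℚ) : ℝ)| ^ d)⁻¹ *
        ∏ i, (volP i (B i) * ENNReal.ofReal (max 1 ‖((q : ℚ) : S.Qp i)‖ ^ d)⁻¹) := by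
        refine mul_le_mul' (Real.volume_inter_smul_le hqr A) (Finset.prod_le_prod' fun i _ => ?_)
        exact Padic.measure_inter_smul_le (h1 i) (hqp i) (hB i)
    _ = volume A * (∏ i, volP i (B i)) * ENNReal.ofReal
          ((max 1 |((q : ℚ) : ℝ)| * ∏ i, max 1 ‖((q : ℚ) : S.Qp i)‖) ^ d)⁻¹ := by
        rw [Finset.prod_mul_distrib, mul_pow, mul_inv, ENNReal.ofReal_mul (by positivity),
          ← ENNReal.ofReal_prod_of_nonneg fun i _ => by positivity, ← Finset.prod_pow,
          Finset.prod_inv_distrib]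
        ring
    _ ≤ _ := by
        have h : (0 : ℝ) < height q := by
          exact_mod_cast lt_max_of_lt_right (q : ℚ).den_pos
        have h2 := height_le q.2
        have h3 : (1 : ℝ) ≤ height q := by exact_mod_cast h
        gcongr
        calc (height (q : ℚ) : ℝ) ^ 3 ≤ (height (q : ℚ) : ℝ) ^ d := pow_le_pow_right₀ h3 hd
          _ ≤ _ := by gcongr

end

theorem tsum_height_ne_top :
    ∑' q : S.Zs, ENNReal.ofReal ((height q : ℝ) ^ 3)⁻¹ ≠ ∞ := by
  have h := summable_height.comp_injective (Subtype.val_injective (p := (· ∈ S.Zs)))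
  exact h.tsum_ofReal_ne_top

end PrimeTup

/-- Symmetric truncated difference on `ℝ≥0∞`. -/
theorem ENNReal.sq_symm_sub_add {x a : ℝ≥0∞} (ha : a ≠ ∞) :
    ((x - a) + (a - x)) ^ 2 + 2 * a * x = x ^ 2 + a ^ 2 := by
  rcases le_total a x with h | h
  · obtain ⟨y, rfl⟩ := exists_add_of_le h
    rw [ENNReal.add_sub_cancel_left ha, tsub_eq_zero_of_le h]
    ring
  · obtain ⟨y, rfl⟩ := exists_add_of_le h
    rw [ENNReal.add_sub_cancel_left (ne_top_of_le_ne_top ha h), tsub_eq_zero_of_le h]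
    ring

namespace PrimeTup

variable {S : PrimeTup} {d : ℕ}

theorem zero_notMem_primZs (hd : 0 < d) : (0 : Fin d → S.Zs) ∉ S.primZs d := fun h => by
  obtain ⟨γ, h⟩ := (mem_primZs_iff hd).1 h
  have h2 := congrArg (fun w => γ⁻¹ • w) h
  simp only [inv_smul_smul, smul_zero] at h2
  simpa using congrFun h2 ⟨0, hd⟩

/-- The number of points of `g • P(ℤ_S^d)` in `A`. -/
noncomputable def primCount (S : PrimeTup) {d : ℕ} (A : Set (S.V d)) (g : S.H d) : ℝ≥0∞ :=
  orbitSum (S.embV1 d) (S.primZs d) (A.indicator 1) g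

theorem measurable_primCount {A : Set (S.V d)} (hA : MeasurableSet A) : Measurable (S.primCount A) :=
  measurable_orbitSum (measurable_one.indicator hA)

theorem primCount_sq_le (hd : 0 < d) (A : Set (S.V d)) (g : S.H d) :
    S.primCount A g ^ 2 ≤
      orbitSum (S.embV d 2) (S.primPairs d)
        (fun y => A.indicator 1 (y 0) * A.indicator 1 (y 1)) g +
      ∑' q : S.Zs, {q : S.Zs | q ≠ 0}.indicator
        (fun q => S.primCount (A ∩ {v | S.emb q • v ∈ A}) g) q := by
  rw [sq, primCount, ← tsum_tsum_eq_mul]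
  refine (tsum_tsum_le (S.primZs d) (fun v w => A.indicator 1 v * A.indicator 1 w) g).trans ?_
  refine add_le_add le_rfl (ENNReal.tsum_le_tsum fun q => ?_)
  rcases eq_or_ne q 0 with rfl | hq
  · refine le_of_eq_of_le (ENNReal.tsum_eq_zero.2 fun v => Set.indicator_of_notMem ?_ _) bot_le
    rintro ⟨-, h⟩
    rw [zero_smul] at h
    exact zero_notMem_primZs hd h
  · rw [Set.indicator_of_mem (by exact hq)]
    refine ENNReal.tsum_le_tsum fun v => ?_
    by_cases hv : v ∈ S.primZs d
    · rw [Set.indicator_of_mem hv]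
      refine (Set.indicator_le_self' (fun _ _ => bot_le) v).trans (le_of_eq ?_)
      by_cases h1 : g • S.embV1 d v ∈ A <;> by_cases h2 : S.emb q • g • S.embV1 d v ∈ A <;> simp [h1, h2]
    · rw [Set.indicator_of_notMem fun h => hv h.1]
      exact bot_le

variable {ν : Measure (S.H d)} [ν.IsHaarMeasure] {φ : S.H d → ℝ≥0∞}
  {volP : (i : Fin S.s) → Measure (Fin d → S.Qp i)} [∀ i, (volP i).IsAddHaarMeasure]

theorem lintegral_primCount_sq_le (hd : 3 ≤ d) (hφ : IsCosetWeight (S.toH d) φ)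
    (h1 : ∀ i, volP i {v | ∀ j, ‖v j‖ ≤ 1} = 1) {c : ℝ≥0∞} (hc0 : c ≠ ∞)
    (hc : ∀ f : S.V d → ℝ≥0∞, Measurable f →
      ∫⁻ g, orbitSum (S.embV1 d) (S.primZs d) f g ∂(ν.withDensity φ) = c * ∫⁻ y, f y)
    {A : Set (Fin d → ℝ)} {B : (i : Fin S.s) → Set (Fin d → S.Qp i)}
    (hA : MeasurableSet A) (hB : ∀ i, MeasurableSet (B i)) :
    ∫⁻ g, S.primCount (S.prodSet A B) g ^ 2 ∂(ν.withDensity φ) ≤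
      (S.zetaE d)⁻¹ * c * volume (S.prodSet A B) ^ 2 +
        c * (∑' q : S.Zs, ENNReal.ofReal ((height q : ℝ) ^ 3)⁻¹) * volume (S.prodSet A B) := by
  have hAm := measurableSet_prodSet hA hB
  set X := S.prodSet A B
  obtain ⟨c', hc0', hc'⟩ := exists_siegel_indepPairs (ν := ν) hd hφ
  obtain ⟨c₂, hζ, hc₂⟩ := exists_siegel_primPairs (ν := ν) hd hφ hc'
  have hcc := indepPairs_const_le hd hc0 hc0' hc hc'
  have hz0 : S.zetaE d ≠ 0 := (one_pos.trans_le (S.one_le_zetaE d)).ne'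
  have hc₂' : c₂ ≤ (S.zetaE d)⁻¹ * c := by
    rw [mul_comm, ← div_eq_mul_inv, ENNReal.le_div_iff_mul_le (.inl hz0) (.inl (zetaE_ne_top hd)),
      mul_comm]
    exact hζ.trans hcc
  have hXi : Measurable (X.indicator (1 : S.V d → ℝ≥0∞)) := measurable_one.indicator hAm
  have hm : Measurable fun y : Fin 2 → S.V d =>
      X.indicator (1 : S.V d → ℝ≥0∞) (y 0) * X.indicator 1 (y 1) :=
    (hXi.comp (measurable_pi_apply 0)).mul (hXi.comp (measurable_pi_apply 1))
  have hqm (q : S.Zs) : MeasurableSet (X ∩ {v | S.emb q • v ∈ X}) :=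
    hAm.inter (hAm.preimage (continuous_const_smul (S.emb q) :
      Continuous fun v : S.V d => S.emb q • v).measurable)
  have hX1 : ∫⁻ v, X.indicator 1 v = volume X := lintegral_indicator_one hAm
  refine (lintegral_mono (primCount_sq_le (by omega) X)).trans ?_
  rw [lintegral_add_left (measurable_orbitSum hm), hc₂ _ hm, lintegral_tsum fun q => ?_]
  · refine add_le_add ?_ ?_
    · have h2 : ∫⁻ y : Fin 2 → S.V d, X.indicator (1 : S.V d → ℝ≥0∞) (y 0) * X.indicator 1 (y 1) =
          volume X ^ 2 := by
        rw [lintegral_finTwo (f := fun p : S.V d × S.V d => X.indicator 1 p.1 * X.indicator 1 p.2)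
          ((hXi.comp measurable_fst).mul (hXi.comp measurable_snd))]
        simp only [lintegral_const_mul _ hXi, hX1, lintegral_mul_const _ hXi, sq]
      rw [h2]
      gcongr
    · rw [mul_assoc, ← ENNReal.tsum_mul_right, ← ENNReal.tsum_mul_left]
      refine ENNReal.tsum_le_tsum fun q => ?_
      rcases eq_or_ne q 0 with rfl | hq
      · simp
      · simp only [Set.indicator_of_mem (show q ∈ {q : S.Zs | q ≠ 0} from hq), primCount]
        rw [hc _ (measurable_one.indicator (hqm q)), lintegral_indicator_one (hqm q),
          mul_comm (ENNReal.ofReal _)]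
        gcongr
        exact volume_prodSet_inter_smul_le hd h1 hA hB hq
  · by_cases hq : q ∈ {q : S.Zs | q ≠ 0}
    · simp only [Set.indicator_of_mem hq]
      exact (measurable_primCount (hqm q)).aemeasurable
    · simp only [Set.indicator_of_notMem hq]
      exact aemeasurable_const

theorem exists_variance_le (hd : 3 ≤ d) (hφ : IsCosetWeight (S.toH d) φ)
    (h1 : ∀ i, volP i {v | ∀ j, ‖v j‖ ≤ 1} = 1) :
    ∃ K : ℝ≥0∞, K ≠ ∞ ∧ ∀ (A : Set (Fin d → ℝ)) (B : (i : Fin S.s) → Set (Fin d → S.Qp i)),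
      MeasurableSet A → (∀ i, MeasurableSet (B i)) → volume (S.prodSet A B) ≠ ∞ →
      ∫⁻ g, ((S.primCount (S.prodSet A B) g - volume (S.prodSet A B) / S.zetaE d) +
        (volume (S.prodSet A B) / S.zetaE d - S.primCount (S.prodSet A B) g)) ^ 2 ∂(ν.withDensity φ) ≤
      K * volume (S.prodSet A B) := by
  obtain ⟨c, hc0, hc⟩ := exists_siegel_primZs (ν := ν) hd hφ
  refine ⟨c * ∑' q : S.Zs, ENNReal.ofReal ((height q : ℝ) ^ 3)⁻¹,
    ENNReal.mul_ne_top hc0 tsum_height_ne_top, fun A B hA hB hV => ?_⟩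
  have h2 := lintegral_primCount_sq_le hd hφ h1 hc0 hc hA hB
  have hAm := measurableSet_prodSet hA hB
  set X := S.prodSet A B
  have hz0 : S.zetaE d ≠ 0 := (one_pos.trans_le (S.one_le_zetaE d)).ne'
  have ha : volume X / S.zetaE d ≠ ∞ := ENNReal.div_ne_top hV hz0
  have hN := measurable_primCount hAm
  have e1 : ∫⁻ g, S.primCount X g ∂(ν.withDensity φ) = c * volume X := by
    rw [← lintegral_indicator_one hAm]
    exact hc _ (measurable_one.indicator hAm)
  have e := lintegral_congr (μ := ν.withDensity φ) fun g =>
    ENNReal.sq_symm_sub_add (x := S.primCount X g) ha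
  rw [lintegral_add_right _ (hN.const_mul _), lintegral_const_mul _ hN, e1,
    lintegral_add_right _ measurable_const, lintegral_const] at e
  have hfin : 2 * (volume X / S.zetaE d) * (c * volume X) ≠ ∞ := by finiteness
  rw [← ENNReal.add_le_add_iff_right hfin, e]
  refine (add_le_add h2 (mul_le_mul_right (measure_univ_le_zetaE_mul hd hφ hc) _)).trans (le_of_eq ?_)
  have hz : (S.zetaE d)⁻¹ * S.zetaE d = 1 := ENNReal.inv_mul_cancel hz0 (zetaE_ne_top hd)
  rw [div_eq_mul_inv]
  calc _ = (S.zetaE d)⁻¹ * c * volume X ^ 2 + c * (∑' q : S.Zs, ENNReal.ofReal ((height q : ℝ) ^ 3)⁻¹) *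
        volume X + (S.zetaE d)⁻¹ * S.zetaE d * ((S.zetaE d)⁻¹ * c * volume X ^ 2) := by ring
    _ = _ := by rw [hz]; ring

end PrimeTup

section

open Filter Topology

theorem ENNReal.tsum_prod_fin (f : ℕ → ℝ≥0∞) (s : ℕ) :
    ∑' k : Fin s → ℕ, ∏ i, f (k i) = (∑' n, f n) ^ s := by
  induction s with
  | zero => simp
  | succ s ih =>
    rw [← (Fin.consEquiv fun _ => ℕ).tsum_eq, ENNReal.tsum_prod', pow_succ', ← ih,
      ← ENNReal.tsum_mul_right]
    refine tsum_congr fun n => ?_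
    rw [← ENNReal.tsum_mul_left]
    simp [Fin.prod_univ_succ, Fin.consEquiv]

theorem Set.Nonempty.exists_monotone_cofinal {C : Set ℝ} (hC : C.Nonempty) (hb : BddAbove C) :
    ∃ u : ℕ → ℝ, Monotone u ∧ (∀ k, u k ∈ C) ∧ ∀ t ∈ C, ∃ k, t ≤ u k := by
  by_cases h : sSup C ∈ C
  · exact ⟨fun _ => sSup C, monotone_const, fun _ => h, fun t ht => ⟨0, le_csSup hb ht⟩⟩
  · obtain ⟨u, hu, hlim, hmem⟩ := exists_seq_tendsto_sSup hC hb
    refine ⟨u, hu, hmem, fun t ht => ?_⟩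
    have hlt : t < sSup C := lt_of_le_of_ne (le_csSup hb ht) fun e => h (e ▸ ht)
    exact ((hlim.eventually (lt_mem_nhds hlt)).exists).imp fun _ => le_of_lt

theorem Set.Nonempty.exists_antitone_coinitial {C : Set ℝ} (hC : C.Nonempty) (hb : BddBelow C) :
    ∃ u : ℕ → ℝ, Antitone u ∧ (∀ k, u k ∈ C) ∧ ∀ t ∈ C, ∃ k, u k ≤ t := by
  by_cases h : sInf C ∈ C
  · exact ⟨fun _ => sInf C, antitone_const, fun _ => h, fun t ht => ⟨0, csInf_le hb ht⟩⟩
  · obtain ⟨u, hu, hlim, hmem⟩ := exists_seq_tendsto_sInf hC hb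
    refine ⟨u, hu, hmem, fun t ht => ?_⟩
    have hlt : sInf C < t := lt_of_le_of_ne (csInf_le hb ht) fun e => h (e ▸ ht)
    exact ((hlim.eventually (gt_mem_nhds hlt)).exists).imp fun _ => le_of_lt

theorem Real.rpow_succ_sub_rpow_le {a V : ℝ} (ha : 1 ≤ a) {m : ℝ} (hm : 1 ≤ m) (hV : m ^ a ≤ V) :
    (m + 1) ^ (a - 1) ≤ 2 ^ (a - 1) * V ^ ((a - 1) / a) ∧
      (m + 1) ^ a - m ^ a ≤ a * (m + 1) ^ (a - 1) := by
  have hm0 : 0 < m + 1 := by linarith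
  constructor
  · calc (m + 1) ^ (a - 1) ≤ (2 * m) ^ (a - 1) := by
          gcongr
          linarith
      _ = 2 ^ (a - 1) * (m ^ a) ^ ((a - 1) / a) := by
          rw [Real.mul_rpow (by norm_num) (by linarith), ← Real.rpow_mul (by linarith),
            mul_div_cancel₀ _ (by linarith)]
      _ ≤ _ := by
          gcongr
  · have h := one_add_mul_self_le_rpow_one_add (s := -(1 / (m + 1))) (p := a) (by
      rw [neg_le_neg_iff, div_le_one hm0]; linarith) ha
    have e : 1 + -(1 / (m + 1)) = m / (m + 1) := by field_simp; ring
    rw [e, Real.div_rpow (by linarith) hm0.le, le_div_iff₀ (by positivity)] at h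
    have e2 : (m + 1) ^ a = (m + 1) ^ (a - 1) * (m + 1) := by
      rw [← Real.rpow_add_one hm0.ne']
      ring_nf
    have e3 : 1 / (m + 1) * (m + 1) ^ a = (m + 1) ^ (a - 1) := by
      rw [e2]; field_simp
    linear_combination h + a * e3

namespace PrimeTup

variable {S : PrimeTup} {d : ℕ}

theorem prodSet_mono {A A' : Set (Fin d → ℝ)} {B B' : (i : Fin S.s) → Set (Fin d → S.Qp i)}
    (hA : A ⊆ A') (hB : ∀ i, B i ⊆ B' i) : S.prodSet A B ⊆ S.prodSet A' B' :=
  fun _ hv => ⟨hA hv.1, fun i => hB i (hv.2 i)⟩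

/-- Squeezing an increasing bounded chain of product sets between two product sets. -/
theorem exists_prodSet_squeeze {C : Set ℝ} (hC : C.Nonempty) (hbb : BddBelow C) (hba : BddAbove C)
    {A : ℝ → Set (Fin d → ℝ)} {B : ℝ → (i : Fin S.s) → Set (Fin d → S.Qp i)}
    (hA : ∀ t ∈ C, MeasurableSet (A t)) (hB : ∀ t ∈ C, ∀ i, MeasurableSet (B t i))
    (hAm : MonotoneOn A C) (hBm : ∀ i, MonotoneOn (fun t => B t i) C) {x y : ℝ≥0∞} (hy : y ≠ ∞)
    (hx : ∀ t ∈ C, x ≤ volume (S.prodSet (A t) (B t)))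
    (hy' : ∀ t ∈ C, volume (S.prodSet (A t) (B t)) ≤ y) :
    ∃ (A₀ A₁ : Set (Fin d → ℝ)) (B₀ B₁ : (i : Fin S.s) → Set (Fin d → S.Qp i)),
      MeasurableSet A₀ ∧ MeasurableSet A₁ ∧ (∀ i, MeasurableSet (B₀ i)) ∧ (∀ i, MeasurableSet (B₁ i)) ∧
      x ≤ volume (S.prodSet A₀ B₀) ∧ volume (S.prodSet A₁ B₁) ≤ y ∧
      ∀ t ∈ C, S.prodSet A₀ B₀ ⊆ S.prodSet (A t) (B t) ∧ S.prodSet (A t) (B t) ⊆ S.prodSet A₁ B₁ := by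
  obtain ⟨u, hu, huC, hut⟩ := hC.exists_antitone_coinitial hbb
  obtain ⟨w, hw, hwC, hwt⟩ := hC.exists_monotone_cofinal hba
  refine ⟨⋂ k, A (u k), ⋃ k, A (w k), fun i => ⋂ k, B (u k) i, fun i => ⋃ k, B (w k) i,
    .iInter fun k => hA _ (huC k), .iUnion fun k => hA _ (hwC k),
    fun i => .iInter fun k => hB _ (huC k) i, fun i => .iUnion fun k => hB _ (hwC k) i, ?_, ?_,
    fun t ht => ⟨?_, ?_⟩⟩
  · have e : S.prodSet (⋂ k, A (u k)) (fun i => ⋂ k, B (u k) i) =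
        ⋂ k, S.prodSet (A (u k)) (B (u k)) := by
      ext v
      simp only [prodSet, Set.mem_preimage, Set.mem_ofPred_eq, Set.mem_iInter]
      exact ⟨fun h k => ⟨h.1 k, fun i => h.2 i k⟩, fun h => ⟨fun k => (h k).1, fun i k => (h k).2 i⟩⟩
    have hanti : Antitone fun k => S.prodSet (A (u k)) (B (u k)) := fun k l hkl =>
      prodSet_mono (hAm (huC l) (huC k) (hu hkl)) fun i => hBm i (huC l) (huC k) (hu hkl)
    rw [e]
    exact ge_of_tendsto' (tendsto_measure_iInter_atTop
      (fun k => (measurableSet_prodSet (hA _ (huC k)) (hB _ (huC k))).nullMeasurableSet) hanti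
      ⟨0, ne_top_of_le_ne_top hy (hy' _ (huC 0))⟩) fun k => hx _ (huC k)
  · have hmono : Monotone fun k => S.prodSet (A (w k)) (B (w k)) := fun k l hkl =>
      prodSet_mono (hAm (hwC k) (hwC l) (hw hkl)) fun i => hBm i (hwC k) (hwC l) (hw hkl)
    have e : S.prodSet (⋃ k, A (w k)) (fun i => ⋃ k, B (w k) i) ⊆
        ⋃ k, S.prodSet (A (w k)) (B (w k)) := by
      rintro v ⟨h1, h2⟩
      simp only [Set.mem_iUnion] at h1 h2
      obtain ⟨k, hk⟩ := h1
      choose l hl using h2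
      refine Set.mem_iUnion.2 ⟨k ⊔ Finset.univ.sup l, ?_, fun i => ?_⟩
      · exact hAm (hwC _) (hwC _) (hw le_sup_left) hk
      · exact hBm i (hwC _) (hwC _) (hw ((Finset.le_sup (Finset.mem_univ i)).trans le_sup_right)) (hl i)
    refine (measure_mono e).trans ?_
    rw [hmono.measure_iUnion]
    exact iSup_le fun k => hy' _ (hwC k)
  · obtain ⟨k, hk⟩ := hut t ht
    exact prodSet_mono ((Set.iInter_subset _ k).trans (hAm (huC k) ht hk))
      fun i => (Set.iInter_subset _ k).trans (hBm i (huC k) ht hk)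
  · obtain ⟨k, hk⟩ := hwt t ht
    exact prodSet_mono ((hAm ht (hwC k) hk).trans (Set.subset_iUnion (fun k => A (w k)) k))
      fun i => (hBm i ht (hwC k) hk).trans (Set.subset_iUnion (fun k => B (w k) i) k)

/-- The deviation of the number of points of `g • P(ℤ_S^d)` in `A` from its expected value. -/
noncomputable def primErr (S : PrimeTup) {d : ℕ} (A : Set (S.V d)) (g : S.H d) : ℝ≥0∞ :=
  (S.primCount A g - volume A / S.zetaE d) + (volume A / S.zetaE d - S.primCount A g)

theorem measurable_primErr {A : Set (S.V d)} (hA : MeasurableSet A) : Measurable (S.primErr A) := by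
  have h := measurable_primCount hA
  exact (h.sub measurable_const).add (measurable_const.sub h)

theorem primCount_mono {A B : Set (S.V d)} (h : A ⊆ B) (g : S.H d) : S.primCount A g ≤ S.primCount B g :=
  orbitSum_mono (fun _ => Set.indicator_le_indicator_of_subset h (fun _ => bot_le) _) g

theorem primErr_le_add (A : Set (S.V d)) (g : S.H d) : S.primErr A g ≤ S.primCount A g + volume A :=
  add_le_add tsub_le_self (tsub_le_self.trans (ENNReal.div_le_of_le_mul
    (le_mul_of_one_le_right' (S.one_le_zetaE d))))

theorem primErr_le_of_subset {L X U : Set (S.V d)} (hL : L ⊆ X) (hU : X ⊆ U) (g : S.H d) :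
    S.primErr X g ≤ S.primErr L g + S.primErr U g + 2 * (volume U - volume L) := by
  have h1 : volume U / S.zetaE d ≤ volume L / S.zetaE d + (volume U - volume L) := by
    conv_lhs => rw [← add_tsub_cancel_of_le (measure_mono (μ := volume) (hL.trans hU)), ENNReal.add_div]
    gcongr
    exact ENNReal.div_le_of_le_mul (le_mul_of_one_le_right' (S.one_le_zetaE d))
  have h2 : S.primCount X g - volume X / S.zetaE d ≤ S.primErr U g + (volume U - volume L) := by
    refine tsub_le_iff_right.2 ((primCount_mono hU g).trans ?_)
    calc S.primCount U g ≤ (S.primCount U g - volume U / S.zetaE d) + volume U / S.zetaE d := le_tsub_add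
      _ ≤ S.primErr U g + (volume X / S.zetaE d + (volume U - volume L)) :=
        add_le_add le_self_add (h1.trans (by gcongr))
      _ = _ := by ring
  have h3 : volume X / S.zetaE d - S.primCount X g ≤ S.primErr L g + (volume U - volume L) := by
    refine tsub_le_iff_right.2 ?_
    calc volume X / S.zetaE d ≤ volume U / S.zetaE d := by gcongr
      _ ≤ (volume L / S.zetaE d - S.primCount L g) + S.primCount L g + (volume U - volume L) :=
        h1.trans (by gcongr; exact le_tsub_add)
      _ ≤ S.primErr L g + S.primCount X g + (volume U - volume L) := by
        gcongr
        · exact le_add_self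
        · exact primCount_mono hL g
      _ = _ := by ring
  exact (add_le_add h2 h3).trans (le_of_eq (by ring))

variable {ν : Measure (S.H d)} [ν.IsHaarMeasure] {φ : S.H d → ℝ≥0∞}
  {volP : (i : Fin S.s) → Measure (Fin d → S.Qp i)} [∀ i, (volP i).IsAddHaarMeasure]

theorem ae_primCount_ne_top (hd : 3 ≤ d) (hφ : IsCosetWeight (S.toH d) φ) {A : Set (S.V d)}
    (hA : MeasurableSet A) (hV : volume A ≠ ∞) : ∀ᵐ g ∂ν, S.primCount A g ≠ ∞ := by
  obtain ⟨c, hc0, hc⟩ := exists_siegel_primZs (ν := ν) hd hφ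
  refine hφ.absolutelyContinuous.ae_le ((ae_lt_top (measurable_primCount hA) ?_).mono fun _ => ne_of_lt)
  rw [show ∫⁻ g, S.primCount A g ∂(ν.withDensity φ) = c * ∫⁻ y, A.indicator 1 y from
    hc _ (measurable_one.indicator hA), lintegral_indicator_one hA]
  exact ENNReal.mul_ne_top hc0 hV

theorem ae_finite_primErr (hd : 3 ≤ d) (hφ : IsCosetWeight (S.toH d) φ)
    (h1 : ∀ i, volP i {v | ∀ j, ‖v j‖ ≤ 1} = 1) {δ : ℝ} {ι : Type*} [Countable ι]
    {A : ι → Set (Fin d → ℝ)} {B : ι → (i : Fin S.s) → Set (Fin d → S.Qp i)}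
    (hA : ∀ k, MeasurableSet (A k)) (hB : ∀ k i, MeasurableSet (B k i))
    (hV : ∀ k, volume (S.prodSet (A k) (B k)) ≠ ∞) (hV1 : ∀ k, 1 ≤ volume (S.prodSet (A k) (B k)))
    (hs : ∑' k, volume (S.prodSet (A k) (B k)) ^ (1 - 2 * δ) ≠ ∞) :
    ∀ᵐ g ∂ν, {k | volume (S.prodSet (A k) (B k)) ^ δ ≤ S.primErr (S.prodSet (A k) (B k)) g}.Finite := by
  obtain ⟨K, hK, hvar⟩ := exists_variance_le (ν := ν) hd hφ h1
  refine hφ.absolutelyContinuous.ae_le (ae_finite_setOfPred_mem (μ := ν.withDensity φ) ?_)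
  refine ne_top_of_le_ne_top (ENNReal.mul_ne_top hK hs) ?_
  rw [← ENNReal.tsum_mul_left]
  refine ENNReal.tsum_le_tsum fun k => ?_
  have hm := measurableSet_prodSet (hA k) (hB k)
  have h0 : volume (S.prodSet (A k) (B k)) ≠ 0 := (one_pos.trans_le (hV1 k)).ne'
  have h2 := mul_meas_ge_le_lintegral (μ := ν.withDensity φ) ((measurable_primErr hm).pow_const 2)
    (volume (S.prodSet (A k) (B k)) ^ (2 * δ))
  have h3 := h2.trans (hvar _ _ (hA k) (hB k) (hV k))
  have h4 : {g | volume (S.prodSet (A k) (B k)) ^ δ ≤ S.primErr (S.prodSet (A k) (B k)) g} ⊆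
      {g | volume (S.prodSet (A k) (B k)) ^ (2 * δ) ≤ S.primErr (S.prodSet (A k) (B k)) g ^ 2} := by
    intro g hg
    rw [Set.mem_ofPred_eq] at hg ⊢
    rw [mul_comm, ENNReal.rpow_mul, ENNReal.rpow_ofNat]
    gcongr
  refine (measure_mono h4).trans ?_
  rw [ENNReal.rpow_sub _ _ h0 (hV k), ENNReal.rpow_one, ← mul_div_assoc,
    ENNReal.le_div_iff_mul_le (.inl (by simp [h0, hV k])) (.inl (by simp [h0, hV k])), mul_comm]
  exact h3

end PrimeTup

end

section

open Filter Topology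

namespace PrimeTup

variable {S : PrimeTup} {d : ℕ}

theorem summable_cells {δ : ℝ} (hδ₁ : 2 / 3 < δ) (hδ₂ : δ < 1) (s : ℕ) :
    ∑' c : (Fin s → ℕ) × ℕ, ENNReal.ofReal
      (max (((c.2 : ℝ) + 1) ^ (1 - δ)⁻¹) (2 ^ ∑ i, c.1 i)) ^ (1 - 2 * δ) ≠ ∞ := by
  set θ : ℝ := (3 * δ - 2) / 2
  have hδ0 : 0 < δ := by linarith
  have hθ : 0 < θ := by simp only [θ]; linarith
  have ha : 0 < 1 - δ := by linarith
  set b : ℝ := (1 - δ)⁻¹ * (δ / 2)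
  have hb : 1 < b := by
    simp only [b]
    rw [← div_eq_inv_mul, lt_div_iff₀ ha]
    linarith
  have hle (c : (Fin s → ℕ) × ℕ) : ENNReal.ofReal
      (max (((c.2 : ℝ) + 1) ^ (1 - δ)⁻¹) (2 ^ ∑ i, c.1 i)) ^ (1 - 2 * δ) ≤
      (∏ i, ENNReal.ofReal ((2 : ℝ) ^ (-θ)) ^ c.1 i) * ENNReal.ofReal (((c.2 : ℝ) + 1) ^ (-b)) := by
    have hP : 0 < ((c.2 : ℝ) + 1) ^ (1 - δ)⁻¹ := by positivity
    have hM : 0 < max (((c.2 : ℝ) + 1) ^ (1 - δ)⁻¹) (2 ^ ∑ i, c.1 i) := lt_max_of_lt_left hP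
    rw [ENNReal.ofReal_rpow_of_pos hM, Finset.prod_pow_eq_pow_sum, ← ENNReal.ofReal_pow (by positivity),
      ← ENNReal.ofReal_mul (by positivity)]
    refine ENNReal.ofReal_le_ofReal ?_
    rw [show 1 - 2 * δ = -θ + -(δ / 2) by simp only [θ]; ring, Real.rpow_add hM]
    gcongr ?_ * ?_
    · rw [← Real.rpow_natCast (2 ^ (-θ)), ← Real.rpow_mul (by norm_num), mul_comm, Real.rpow_mul (by norm_num),
        Real.rpow_natCast]
      exact Real.rpow_le_rpow_of_nonpos (by positivity) (le_max_right _ _) (by linarith)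
    · rw [show -b = (1 - δ)⁻¹ * -(δ / 2) by simp only [b]; ring, Real.rpow_mul (by positivity)]
      exact Real.rpow_le_rpow_of_nonpos hP (le_max_left _ _) (by linarith)
  refine ne_top_of_le_ne_top ?_ (ENNReal.tsum_le_tsum hle)
  rw [ENNReal.tsum_prod']
  simp_rw [ENNReal.tsum_mul_left]
  rw [ENNReal.tsum_mul_right, ENNReal.tsum_prod_fin fun n => ENNReal.ofReal ((2 : ℝ) ^ (-θ)) ^ n]
  have h1 : ∑' n, ENNReal.ofReal ((2 : ℝ) ^ (-θ)) ^ n ≠ ∞ := by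
    rw [ENNReal.tsum_geometric, Ne, ENNReal.inv_eq_top, tsub_eq_zero_iff_le, not_le]
    rw [← ENNReal.ofReal_one, ENNReal.ofReal_lt_ofReal_iff one_pos]
    exact Real.rpow_lt_one_of_one_lt_of_neg (by norm_num) (by linarith)
  have h2 : ∑' n : ℕ, ENNReal.ofReal (((n : ℝ) + 1) ^ (-b)) ≠ ∞ := by
    refine Summable.tsum_ofReal_ne_top ?_
    have := (summable_nat_add_iff 1).2 (Real.summable_nat_rpow.2 (show -b < -1 by linarith))
    simpa using this
  exact ENNReal.mul_ne_top (ENNReal.pow_ne_top h1) h2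

variable {ν : Measure (S.H d)} [ν.IsHaarMeasure] {φ : S.H d → ℝ≥0∞}
  {volP : (i : Fin S.s) → Measure (Fin d → S.Qp i)} [∀ i, (volP i).IsAddHaarMeasure]

theorem ae_exists_primErr_le (hd : 3 ≤ d) (hφ : IsCosetWeight (S.toH d) φ)
    (h1 : ∀ i, volP i {v | ∀ j, ‖v j‖ ≤ 1} = 1) {δ : ℝ} (hδ₁ : 2 / 3 < δ) (hδ₂ : δ < 1)
    {𝒯 : Set (ℝ × (Fin S.s → ℕ))} {A : ℝ × (Fin S.s → ℕ) → Set (Fin d → ℝ)}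
    {B : ℝ × (Fin S.s → ℕ) → (i : Fin S.s) → Set (Fin d → S.Qp i)}
    (hA : ∀ T ∈ 𝒯, MeasurableSet (A T)) (hB : ∀ T ∈ 𝒯, ∀ i, MeasurableSet (B T i))
    (hmono : ∀ T ∈ 𝒯, ∀ T' ∈ 𝒯, T.2 = T'.2 → T.1 ≤ T'.1 → A T ⊆ A T' ∧ ∀ i, B T i ⊆ B T' i)
    {w : (Fin S.s → ℕ) → ℝ} (hw : ∀ k, 0 < w k)
    (hvol : ∀ T ∈ 𝒯, volume (S.prodSet (A T) (B T)) = ENNReal.ofReal (w T.2 * T.1))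
    (hlow : ∀ T ∈ 𝒯, 2 ^ (∑ i, T.2 i) ≤ w T.2 * T.1) :
    ∀ᵐ g ∂ν, ∃ C : ℝ, 0 < C ∧ ∀ T ∈ 𝒯,
      S.primErr (S.prodSet (A T) (B T)) g ≤ ENNReal.ofReal (C * (w T.2 * T.1) ^ δ) := by
  set a : ℝ := (1 - δ)⁻¹ with ha_def
  have hδ0 : 0 < 1 - δ := by linarith
  have ha : 1 ≤ a := (one_le_inv₀ hδ0).2 (by linarith)
  have haδ : (a - 1) / a = δ := by rw [ha_def]; field_simp; ring
  let cell (c : (Fin S.s → ℕ) × ℕ) : Set ℝ :=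
    {t | (t, c.1) ∈ 𝒯 ∧ ((c.2 : ℝ) + 1) ^ a ≤ w c.1 * t ∧ w c.1 * t < ((c.2 : ℝ) + 1 + 1) ^ a}
  let x (c : (Fin S.s → ℕ) × ℕ) : ℝ := max (((c.2 : ℝ) + 1) ^ a) (2 ^ ∑ i, c.1 i)
  have hsq (c : {c // (cell c).Nonempty}) := exists_prodSet_squeeze (S := S) (d := d) c.2
    (x := ENNReal.ofReal (x c)) (y := ENNReal.ofReal (((c.1.2 : ℝ) + 1 + 1) ^ a))
    (A := fun t => A (t, c.1.1)) (B := fun t => B (t, c.1.1))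
    ⟨((c.1.2 : ℝ) + 1) ^ a / w c.1.1, fun t ht => (div_le_iff₀' (hw _)).2 ht.2.1⟩
    ⟨((c.1.2 : ℝ) + 1 + 1) ^ a / w c.1.1, fun t ht => (le_div_iff₀' (hw _)).2 ht.2.2.le⟩
    (fun t ht => hA _ ht.1) (fun t ht => hB _ ht.1)
    (fun t ht t' ht' h => (hmono _ ht.1 _ ht'.1 rfl h).1)
    (fun i t ht t' ht' h => (hmono _ ht.1 _ ht'.1 rfl h).2 i) ENNReal.ofReal_ne_top
    (fun t ht => by
      rw [hvol _ ht.1]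
      exact ENNReal.ofReal_le_ofReal (max_le ht.2.1 (hlow _ ht.1)))
    (fun t ht => by
      rw [hvol _ ht.1]
      exact ENNReal.ofReal_le_ofReal ht.2.2.le)
  choose A₀ A₁ B₀ B₁ hA₀ hA₁ hB₀ hB₁ hx hy hsub using hsq
  have hx1 (c) : 1 ≤ x c := le_max_of_le_left (Real.one_le_rpow (by simp) (by linarith))
  have hLU (c : {c // (cell c).Nonempty}) :
      volume (S.prodSet (A₀ c) (B₀ c)) ≤ volume (S.prodSet (A₁ c) (B₁ c)) := by
    obtain ⟨t, ht⟩ := c.2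
    exact measure_mono ((hsub c t ht).1.trans (hsub c t ht).2)
  have hsum (f : {c // (cell c).Nonempty} → ℝ≥0∞) 
      (hf : ∀ c : {c // (cell c).Nonempty}, ENNReal.ofReal (x c) ≤ f c) :
      ∑' c, f c ^ (1 - 2 * δ) ≠ ∞ := by
    refine ne_top_of_le_ne_top (summable_cells hδ₁ hδ₂ S.s) ((ENNReal.tsum_le_tsum fun c => ?_).trans
      (ENNReal.tsum_comp_le_tsum_of_injective Subtype.val_injective _))
    rw [← neg_sub, ENNReal.rpow_neg, ENNReal.rpow_neg, ENNReal.inv_le_inv]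
    exact ENNReal.rpow_le_rpow (hf c) (by linarith)
  have hUtop (c : {c // (cell c).Nonempty}) : volume (S.prodSet (A₁ c) (B₁ c)) ≠ ∞ :=
    ne_top_of_le_ne_top ENNReal.ofReal_ne_top (hy c)
  have hx1' (c : {c // (cell c).Nonempty}) : 1 ≤ volume (S.prodSet (A₀ c) (B₀ c)) :=
    (ENNReal.one_le_ofReal.2 (hx1 c)).trans (hx c)
  have aeL := ae_finite_primErr (ν := ν) (δ := δ) hd hφ h1 hA₀ hB₀
    (fun c => ne_top_of_le_ne_top (hUtop c) (hLU c)) hx1' (hsum _ hx)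
  have aeU := ae_finite_primErr (ν := ν) (δ := δ) hd hφ h1 hA₁ hB₁ hUtop
    (fun c => (hx1' c).trans (hLU c)) (hsum _ fun c => (hx c).trans (hLU c))
  have aeN := ae_all_iff.2 fun c => ae_primCount_ne_top (ν := ν) hd hφ
    (measurableSet_prodSet (hA₁ c) (hB₁ c)) (hUtop c)
  filter_upwards [aeL, aeU, aeN] with g hgL hgU hgN
  set D : ℝ := 2 ^ (a - 1)
  have hD : 0 < D := by positivity
  let M (c : {c // (cell c).Nonempty}) : ℝ≥0∞ :=
    S.primCount (S.prodSet (A₁ c) (B₁ c)) g + volume (S.prodSet (A₁ c) (B₁ c))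
  have hM (c) : M c ≠ ∞ := ENNReal.add_ne_top.2 ⟨hgN c, hUtop c⟩
  set E := (hgL.union hgU).toFinset
  have hE0 : 0 ≤ ∑ c ∈ E, (M c).toReal := Finset.sum_nonneg fun _ _ => ENNReal.toReal_nonneg
  refine ⟨1 + D + 2 * (a * D) + ∑ c ∈ E, (M c).toReal, by positivity, fun T hT => ?_⟩
  set V := w T.2 * T.1
  have hV1 : 1 ≤ V := (one_le_pow₀ one_le_two).trans (hlow T hT)
  have hVδ : 1 ≤ V ^ δ := Real.one_le_rpow hV1 (by linarith)
  obtain ⟨n, hn1, hn2⟩ : ∃ n : ℕ, ((n : ℝ) + 1) ^ a ≤ V ∧ V < ((n : ℝ) + 1 + 1) ^ a := by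
    have h2 : 1 ≤ V ^ a⁻¹ := Real.one_le_rpow hV1 (by positivity)
    obtain ⟨n, hn⟩ := Nat.exists_eq_add_of_le' ((Nat.one_le_floor_iff _).2 h2)
    have h3 := Nat.floor_le (zero_le_one.trans h2)
    have h4 := Nat.lt_floor_add_one (V ^ a⁻¹)
    rw [hn] at h3 h4
    push_cast at h3 h4
    exact ⟨n, (Real.le_rpow_inv_iff_of_pos (by positivity) (by linarith) (by linarith)).1 h3,
      (Real.rpow_inv_lt_iff_of_pos (by linarith) (by positivity) (by linarith)).1 h4⟩
  have hmem : T.1 ∈ cell (T.2, n) := ⟨hT, hn1, hn2⟩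
  let c : {c // (cell c).Nonempty} := ⟨(T.2, n), T.1, hmem⟩
  obtain ⟨hL, hU⟩ := hsub c T.1 hmem
  by_cases hc : c ∈ E
  · calc S.primErr (S.prodSet (A T) (B T)) g ≤ M c :=
          (primErr_le_add _ _).trans (add_le_add (primCount_mono hU g) (measure_mono hU))
      _ = ENNReal.ofReal (M c).toReal := (ENNReal.ofReal_toReal (hM c)).symm
      _ ≤ _ := by
          refine ENNReal.ofReal_le_ofReal ?_
          have h5 := Finset.single_le_sum (f := fun c => (M c).toReal)
            (fun _ _ => ENNReal.toReal_nonneg) hc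
          have h6 : 0 ≤ 1 + D + 2 * (a * D) := by positivity
          nlinarith [ENNReal.toReal_nonneg (a := M c)]
  · simp only [E, Set.Finite.mem_toFinset, Set.mem_union, Set.mem_ofPred_eq, not_or, not_le] at hc
    obtain ⟨h7, h8⟩ := Real.rpow_succ_sub_rpow_le ha (m := (n : ℝ) + 1) (by simp) hn1
    rw [haδ] at h7
    have hV0 : volume (S.prodSet (A T) (B T)) = ENNReal.ofReal V := hvol T hT
    have e1 : S.primErr (S.prodSet (A₀ c) (B₀ c)) g ≤ ENNReal.ofReal (V ^ δ) := by
      refine hc.1.le.trans ?_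
      rw [← ENNReal.ofReal_rpow_of_pos (by linarith), ← hV0]
      exact ENNReal.rpow_le_rpow (measure_mono hL) (by linarith)
    have e2 : S.primErr (S.prodSet (A₁ c) (B₁ c)) g ≤ ENNReal.ofReal (D * V ^ δ) := by
      refine hc.2.le.trans ((ENNReal.rpow_le_rpow (hy c) (by linarith)).trans ?_)
      rw [ENNReal.ofReal_rpow_of_pos (by positivity), ← Real.rpow_mul (by positivity), ← haδ,
        mul_div_cancel₀ _ (by positivity), haδ]
      exact ENNReal.ofReal_le_ofReal h7
    have e3 : volume (S.prodSet (A₁ c) (B₁ c)) - volume (S.prodSet (A₀ c) (B₀ c)) ≤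
        ENNReal.ofReal (a * (D * V ^ δ)) := by
      refine (tsub_le_tsub (hy c) ((ENNReal.ofReal_le_ofReal (le_max_left _ _)).trans (hx c))).trans ?_
      rw [← ENNReal.ofReal_sub _ (by positivity)]
      refine ENNReal.ofReal_le_ofReal (h8.trans ?_)
      gcongr
    refine (primErr_le_of_subset hL hU g).trans ((add_le_add (add_le_add e1 e2)
      (mul_le_mul_right e3 2)).trans ?_)
    rw [← ENNReal.ofReal_ofNat 2, ← ENNReal.ofReal_mul (by norm_num), ← ENNReal.ofReal_add (by positivity)
      (by positivity), ← ENNReal.ofReal_add (by positivity) (by positivity)]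
    refine ENNReal.ofReal_le_ofReal ?_
    nlinarith

end PrimeTup

end

section

open Filter Topology

namespace PrimeTup

variable {S : PrimeTup} {d : ℕ}

theorem act_equivG (h : S.H d) (w : Fin d → S.Zs) :
    S.act (S.equivG d h) (S.diag fun j => (w j : ℚ)) = S.equivQS d (h • S.embV1 d w) := by
  refine Prod.ext (funext fun a => ?_) (funext fun i => funext fun a => ?_)
  · exact (Prod.fst_sum (s := Finset.univ) (f := fun b => h.1 a b * S.emb (w b))).symm
  · have : (∑ b, h.1 a b * S.emb (w b)).2 i = ∑ b, (h.1 a b * S.emb (w b)).2 i := by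
      rw [Prod.snd_sum, Finset.sum_apply]
    exact this.symm

theorem diag_injective : Function.Injective fun w : Fin d → S.Zs => S.diag fun j => (w j : ℚ) :=
  fun w w' h => funext fun j => Subtype.ext <| by
    have : ((w j : ℚ) : ℝ) = (w' j : ℚ) := congrFun (congrArg Prod.fst h) j
    exact_mod_cast this

theorem tsum_prim_eq_primCount (h : S.H d) (A : Set (S.QS d)) :
    ∑' v : S.prim d, A.indicator (fun _ => (1 : ℝ≥0∞)) (S.act (S.equivG d h) v) =
      S.primCount (S.equivQS d ⁻¹' A) h := by
  have h1 := tsum_image (s := S.primZs d)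
    (fun v => A.indicator (fun _ => (1 : ℝ≥0∞)) (S.act (S.equivG d h) v)) diag_injective.injOn
  refine h1.trans ?_
  rw [primCount, orbitSum, ← tsum_subtype]
  refine tsum_congr fun w => ?_
  rw [act_equivG]
  rfl

theorem primCount_bounds_of_primErr_le (hd : 3 ≤ d) {X : Set (S.V d)} {g : S.H d} {v e : ℝ} (he : 0 ≤ e)
    (hv : 0 ≤ v) (hX : volume X = ENNReal.ofReal v) (h : S.primErr X g ≤ ENNReal.ofReal e) :
    S.primCount X g ≤ ENNReal.ofReal (v / S.zetaS d + e) ∧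
      ENNReal.ofReal (v / S.zetaS d - e) ≤ S.primCount X g := by
  have hζ : 1 ≤ S.zetaS d := by
    rw [zetaS_eq]
    exact ENNReal.toReal_mono (zetaE_ne_top hd) (one_le_zetaE S d)
  have hdiv : volume X / S.zetaE d = ENNReal.ofReal (v / S.zetaS d) := by
    rw [hX, ENNReal.ofReal_div_of_pos (by linarith), zetaS_eq, ENNReal.ofReal_toReal (zetaE_ne_top hd)]
  rw [primErr, hdiv] at h
  rw [ENNReal.ofReal_add (by positivity) he, ENNReal.ofReal_sub _ he]
  refine ⟨?_, ?_⟩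
  · rw [add_comm]
    exact tsub_le_iff_right.1 (le_self_add.trans h)
  · rw [tsub_le_iff_left]
    exact tsub_le_iff_right.1 (le_add_self.trans h)

theorem isHaarMeasure_of_regular {ν : Measure (S.G d)} (hinv : ν.IsMulLeftInvariant) (hreg : ν.Regular)
    (hfin : IsFiniteMeasureOnCompacts ν) [NeZero ν] : ν.IsHaarMeasure where
  toIsFiniteMeasureOnCompacts := hfin
  toIsMulLeftInvariant := hinv
  toIsOpenPosMeasure := isOpenPosMeasure_of_mulLeftInvariant_of_regular

theorem ae_of_ae_equivG {ν : Measure (S.G d)} {P : S.G d → Prop}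
    (h : ∀ᵐ h ∂ν.map (S.equivG d).symm, P (S.equivG d h)) : ∀ᵐ g ∂ν, P g := by
  have hm : Measurable (S.equivG d).symm := (S.equivG d).symm.continuous.measurable
  filter_upwards [ae_of_ae_map hm.aemeasurable h] with g hg
  rwa [ContinuousMulEquiv.apply_symm_apply] at hg

theorem prod_component_subset {A A' : Set (Fin d → ℝ)} {B B' : (i : Fin S.s) → Set (Fin d → S.Qp i)}
    (h : {x : S.QS d | x.1 ∈ A ∧ ∀ i, x.2 i ∈ B i} ⊆ {x | x.1 ∈ A' ∧ ∀ i, x.2 i ∈ B' i})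
    (hne : {x : S.QS d | x.1 ∈ A ∧ ∀ i, x.2 i ∈ B i}.Nonempty) : A ⊆ A' ∧ ∀ i, B i ⊆ B' i := by
  classical
  obtain ⟨x, hxA, hxB⟩ := hne
  refine ⟨fun a ha => (@h (a, x.2) ⟨ha, hxB⟩).1, fun i b hb => ?_⟩
  have := (@h (x.1, Function.update x.2 i b) ⟨hxA, fun j => ?_⟩).2 i
  · simpa using this
  · rcases eq_or_ne j i with rfl | hj
    · simpa using hb
    · simpa [hj] using hxB j

theorem exists_exponents {𝒯 : Set (ℝ × (Fin S.s → ℝ))}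
    (h𝒯 : ∀ T ∈ 𝒯, 0 ≤ T.1 ∧ ∀ i, ∃ z : ℤ, T.2 i = (S.p i : ℝ) ^ z)
    (hinf : ∀ i, ∃ ε > (0:ℝ), ∀ T ∈ 𝒯, ε ≤ T.2 i) :
    ∃ m : Fin S.s → ℤ, ∀ T ∈ 𝒯, ∃ k : Fin S.s → ℕ, T.2 = fun i => (S.p i : ℝ) ^ (m i + (k i : ℤ)) := by
  have hp (i) : (1 : ℝ) < S.p i := by exact_mod_cast (S.hp i).one_lt
  have hm (i) : ∃ m : ℤ, ∀ T ∈ 𝒯, (S.p i : ℝ) ^ m ≤ T.2 i := by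
    obtain ⟨ε, hε, h⟩ := hinf i
    obtain ⟨m, hm, -⟩ := exists_mem_Ioc_zpow hε (hp i)
    exact ⟨m, fun T hT => hm.le.trans (h T hT)⟩
  choose m hm using hm
  refine ⟨m, fun T hT => ?_⟩
  choose z hz using (h𝒯 T hT).2
  refine ⟨fun i => (z i - m i).toNat, funext fun i => ?_⟩
  have h1 := hm i T hT
  rw [hz i, zpow_le_zpow_iff_right₀ (hp i)] at h1
  rw [hz i, Int.toNat_of_nonneg (sub_nonneg.2 h1), add_sub_cancel]

theorem ae_exists_primErr_le_of_family (hd : 3 ≤ d) {δ : ℝ} (hδ₁ : 2 / 3 < δ) (hδ₂ : δ < 1)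
    {volP : (i : Fin S.s) → Measure (Fin d → S.Qp i)} [∀ i, (volP i).IsAddHaarMeasure]
    (h1 : ∀ i, volP i {v | ∀ j, ‖v j‖ ≤ 1} = 1) {𝒯 : Set (ℝ × (Fin S.s → ℝ))}
    (h𝒯 : ∀ T ∈ 𝒯, 0 ≤ T.1 ∧ ∀ i, ∃ z : ℤ, T.2 i = (S.p i : ℝ) ^ z)
    {A : ℝ × (Fin S.s → ℝ) → Set (Fin d → ℝ)}
    {B : ℝ × (Fin S.s → ℝ) → (i : Fin S.s) → Set (Fin d → S.Qp i)}
    (hA : ∀ T ∈ 𝒯, MeasurableSet (A T)) (hB : ∀ T ∈ 𝒯, ∀ i, MeasurableSet (B T i))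
    (hAvol : ∀ T ∈ 𝒯, volume (A T) = ENNReal.ofReal T.1)
    (hBvol : ∀ T ∈ 𝒯, ∀ i, volP i (B T i) = ENNReal.ofReal (T.2 i))
    (hmono : ∀ T₁ ∈ 𝒯, ∀ T₂ ∈ 𝒯, (T₁.1 ≤ T₂.1 ∧ ∀ i, T₁.2 i ≤ T₂.2 i) →
      A T₁ ⊆ A T₂ ∧ ∀ i, B T₁ i ⊆ B T₂ i)
    (hinf : ∀ i, ∃ ε > (0:ℝ), ∀ T ∈ 𝒯, ε ≤ T.2 i) (ν : Measure (S.H d)) [ν.IsHaarMeasure] :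
    ∃ t₀ : ℝ, ∀ᵐ g ∂ν, ∃ C > (0 : ℝ), ∀ T ∈ 𝒯, t₀ ≤ T.1 →
      S.primErr (S.prodSet (A T) (B T)) g ≤ ENNReal.ofReal (C * (T.1 * ∏ i, T.2 i) ^ δ) := by
  obtain ⟨φ, hφ⟩ := exists_isCosetWeight (S.toH d) fun K hK => finite_toH_mem hK
  obtain ⟨m, hm⟩ := exists_exponents h𝒯 hinf
  have hp0 (i) : (0 : ℝ) < S.p i := by exact_mod_cast (S.hp i).pos
  let τ (q : ℝ × (Fin S.s → ℕ)) : ℝ × (Fin S.s → ℝ) :=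
    (q.1, fun i => (S.p i : ℝ) ^ (m i + (q.2 i : ℤ)))
  have hP : 0 < ∏ i, (S.p i : ℝ) ^ m i := Finset.prod_pos fun i _ => zpow_pos (hp0 i) _
  refine ⟨(∏ i, (S.p i : ℝ) ^ m i)⁻¹, ?_⟩
  have := ae_exists_primErr_le (ν := ν) hd hφ h1 hδ₁ hδ₂
    (𝒯 := {q | τ q ∈ 𝒯 ∧ (∏ i, (S.p i : ℝ) ^ m i)⁻¹ ≤ q.1}) (A := fun q => A (τ q))
    (B := fun q => B (τ q)) (fun q hq => hA _ hq.1) (fun q hq => hB _ hq.1)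
    (fun q hq q' hq' h2 h3 => hmono _ hq.1 _ hq'.1 ⟨h3, fun i => by simp only [τ, h2]; exact le_rfl⟩)
    (w := fun k => ∏ i, (S.p i : ℝ) ^ (m i + (k i : ℤ)))
    (fun k => Finset.prod_pos fun i _ => zpow_pos (hp0 i) _)
    (fun q hq => by
      rw [volume_prodSet h1 (hA _ hq.1) (hB _ hq.1), hAvol _ hq.1,
        Finset.prod_congr rfl fun i _ => hBvol _ hq.1 i,
        ← ENNReal.ofReal_prod_of_nonneg fun i _ => (zpow_pos (hp0 i) _).le,
        ← ENNReal.ofReal_mul (h𝒯 _ hq.1).1, mul_comm])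
    (fun q hq => by
      have h4 : (2 : ℝ) ^ ∑ i, q.2 i ≤ ∏ i, (S.p i : ℝ) ^ q.2 i := by
        rw [← Finset.prod_pow_eq_pow_sum]
        refine Finset.prod_le_prod (fun _ _ => by positivity) fun i _ => ?_
        have : (2 : ℝ) ≤ S.p i := by exact_mod_cast (S.hp i).two_le
        gcongr
      simp only [zpow_add₀ (hp0 _).ne', zpow_natCast, Finset.prod_mul_distrib]
      refine h4.trans ?_
      have h5 : 1 ≤ (∏ i, (S.p i : ℝ) ^ m i) * q.1 := (inv_le_iff_one_le_mul₀' hP).1 hq.2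
      have h6 : 0 ≤ ∏ i, (S.p i : ℝ) ^ q.2 i := Finset.prod_nonneg fun _ _ => by positivity
      nlinarith)
  filter_upwards [this] with g hg
  obtain ⟨C, hC, h⟩ := hg
  refine ⟨C, hC, fun T hT hT0 => ?_⟩
  obtain ⟨k, hk⟩ := hm T hT
  have hT' : τ (T.1, k) = T := Prod.ext rfl hk.symm
  have h7 := h (T.1, k) ⟨hT'.symm ▸ hT, hT0⟩
  simp only [hT'] at h7
  rwa [mul_comm (∏ i, _), ← Finset.prod_congr rfl fun i _ => congrFun hk i] at h7

end PrimeTup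

end

open PrimeTup in
/-- **Counting `S`-primitive lattice points with error term, `d ≥ 3`**
(Theorem 2.10 (1)).  For an increasing, unbounded family `{A_T}` of product Borel sets
with prescribed per-place volumes, any `δ ∈ (2/3, 1)`, and Haar-almost every
`g ∈ G_d`, one has `#(g·P(ℤ_S^d) ∩ A_T) = vol_S(A_T)/ζ_S(d) + O_g(vol_S(A_T)^δ)`
for all sufficiently large `T ∈ 𝒯`. -/
theorem schmidt_counting_theorem
    (S : PrimeTup) (d : ℕ) (hd : 3 ≤ d) (δ : ℝ) (hδ₁ : 2/3 < δ) (hδ₂ : δ < 1)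
    (volP : (i : Fin S.s) → Measure (Fin d → S.Qp i))
    (hvolP : ∀ i, (volP i).IsAddHaarMeasure ∧ (volP i).Regular ∧
      volP i {v | ∀ j, ‖v j‖ ≤ 1} = 1)
    (volS : Measure (S.QS d))
    (hvolS : volS = (volume : Measure (Fin d → ℝ)).prod (Measure.pi volP))
    (𝒯 : Set (ℝ × (Fin S.s → ℝ)))
    (h𝒯 : ∀ T ∈ 𝒯, 0 ≤ T.1 ∧ ∀ i, ∃ z : ℤ, T.2 i = (S.p i : ℝ) ^ z)
    (A : ℝ × (Fin S.s → ℝ) → Set (S.QS d))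
    (hprod : ∀ T ∈ 𝒯, ∃ (Ainf : Set (Fin d → ℝ))
        (Ap : (i : Fin S.s) → Set (Fin d → S.Qp i)),
        MeasurableSet Ainf ∧ (∀ i, MeasurableSet (Ap i)) ∧
        A T = {x | x.1 ∈ Ainf ∧ ∀ i, x.2 i ∈ Ap i} ∧
        volume Ainf = ENNReal.ofReal T.1 ∧ ∀ i, volP i (Ap i) = ENNReal.ofReal (T.2 i))
    (hpos : ∀ T ∈ 𝒯, 0 < volS (A T))
    (hmono : ∀ T₁ ∈ 𝒯, ∀ T₂ ∈ 𝒯,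
      (T₁.1 ≤ T₂.1 ∧ ∀ i, T₁.2 i ≤ T₂.2 i) → A T₁ ⊆ A T₂)
    (hunbdd : ¬ Bornology.IsBounded 𝒯)
    (hinf : ∀ i, ∃ ε > (0:ℝ), ∀ T ∈ 𝒯, ε ≤ T.2 i)
    (ν : Measure (S.G d)) (hinv : ν.IsMulLeftInvariant) (hreg : ν.Regular)
    (hfin : IsFiniteMeasureOnCompacts ν) (hne : ν ≠ 0) :
    ∀ᵐ g ∂ν, ∃ C > (0:ℝ), ∃ T₀ : ℝ × (Fin S.s → ℝ), ∀ T ∈ 𝒯,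
      (T₀.1 ≤ T.1 ∧ ∀ i, T₀.2 i ≤ T.2 i) →
      (∑' v : S.prim d, (A T).indicator (fun _ => (1:ℝ≥0∞)) (S.act g v)) ≤
          ENNReal.ofReal ((volS (A T)).toReal / S.zetaS d + C * (volS (A T)).toReal ^ δ) ∧
        ENNReal.ofReal ((volS (A T)).toReal / S.zetaS d - C * (volS (A T)).toReal ^ δ) ≤
          ∑' v : S.prim d, (A T).indicator (fun _ => (1:ℝ≥0∞)) (S.act g v) := by
  have : ∀ i, (volP i).IsAddHaarMeasure := fun i => (hvolP i).1
  have h1 (i) := (hvolP i).2.2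
  have : NeZero ν := ⟨hne⟩
  have hHaar : ν.IsHaarMeasure := isHaarMeasure_of_regular hinv hreg hfin
  have hH : (ν.map (S.equivG d).symm).IsHaarMeasure := ContinuousMulEquiv.isHaarMeasure_map _ _
  choose! Ainf Ap hAinf hAp hA hAvol hpvol using hprod
  obtain ⟨t₀, h⟩ := ae_exists_primErr_le_of_family hd hδ₁ hδ₂ h1 h𝒯 hAinf hAp hAvol hpvol
    (fun T₁ hT₁ T₂ hT₂ hle => by
      have hsub := hmono T₁ hT₁ T₂ hT₂ hle
      rw [hA T₁ hT₁, hA T₂ hT₂] at hsub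
      refine prod_component_subset hsub ?_
      rw [← hA T₁ hT₁]
      exact nonempty_of_measure_ne_zero (hpos T₁ hT₁).ne') hinf (ν.map (S.equivG d).symm)
  refine ae_of_ae_equivG (h.mono fun g hg => ?_)
  obtain ⟨C, hC, hg⟩ := hg
  refine ⟨C, hC, (t₀, 0), fun T hT hT₀ => ?_⟩
  have hp (i) : 0 ≤ T.2 i := by
    obtain ⟨z, hz⟩ := (h𝒯 T hT).2 i
    rw [hz]
    positivity
  have hV0 : 0 ≤ T.1 * ∏ i, T.2 i := mul_nonneg (h𝒯 T hT).1 (Finset.prod_nonneg fun i _ => hp i)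
  have hprod : volume (Ainf T) * ∏ i, volP i (Ap T i) = ENNReal.ofReal (T.1 * ∏ i, T.2 i) := by
    rw [ENNReal.ofReal_mul (h𝒯 T hT).1, ENNReal.ofReal_prod_of_nonneg fun i _ => hp i, hAvol T hT,
      Finset.prod_congr rfl fun i _ => hpvol T hT i]
  have hV : (volS (A T)).toReal = T.1 * ∏ i, T.2 i := by
    rw [hvolS, hA T hT, prod_pi_apply, hprod, ENNReal.toReal_ofReal hV0]
  rw [hV, tsum_prim_eq_primCount, hA T hT]
  exact primCount_bounds_of_primErr_le hd (by positivity) hV0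
    ((volume_prodSet h1 (hAinf T hT) (hAp T hT)).trans hprod) (hg T hT hT₀.1)
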